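/- Assume the Riemann Hypothesis. Then μ_D ≤ 0.60729; that is, for every λ > 0.60729 one has liminf_{T→∞} D(λ,T) > 0. -/

import Mathlib

open Filter MeasureTheory
open scoped Real

noncomputable section

/-- The multiplicity (order of vanishing) of the Riemann zeta function at a point `z`:
the least `n` such that the `n`-th derivative of `ζ` at `z` is nonzero. -/
def zetaMult (z : ℂ) : ℕ := sInf {n : ℕ | iteratedDeriv n riemannZeta z ≠ 0}

/-- Under RH, the set of ordinates `γ` with `0 < γ ≤ T` of nontrivial zeros `1/2 + iγ` of `ζ`. -/
def zetaOrds (T : ℝ) : Set ℝ :=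
  {γ : ℝ | 0 < γ ∧ γ ≤ T ∧ riemannZeta (1 / 2 + γ * Complex.I) = 0}

/-- The multiplicity of the zero of `ζ` at `1/2 + iγ`. -/
def ordMult (γ : ℝ) : ℕ := zetaMult (1 / 2 + γ * Complex.I)

/-- `N(T)`: the number of ordinates of nontrivial zeros in `(0, T]`, counted with multiplicity. -/
def zetaN (T : ℝ) : ℕ := ∑ᶠ γ ∈ zetaOrds T, ordMult γ

/-- The next ordinate of a nontrivial zero strictly above `γ`. -/
def nextOrd (γ : ℝ) : ℝ :=
  sInf {γ' : ℝ | γ < γ' ∧ riemannZeta (1 / 2 + γ' * Complex.I) = 0}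

/-- The number of ordinates `0 < γ ≤ T`, counted with multiplicity, whose successor `γ⁺` in the
nondecreasing sequence of ordinates (with multiplicity) satisfies `γ⁺ - γ ≤ 2πλ / log T`.
A distinct ordinate of multiplicity `m` contributes `m - 1` spacings equal to `0`, together
with the gap `nextOrd γ - γ` to the next distinct ordinate. -/
def Dcount (lam T : ℝ) : ℕ :=
  ∑ᶠ γ ∈ zetaOrds T,
    ((ordMult γ - 1) + if nextOrd γ - γ ≤ 2 * π * lam / Real.log T then 1 else 0)

/-- `D(λ, T)`: the proportion of ordinates `0 < γ ≤ T` (with multiplicity) with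
`γ⁺ - γ ≤ 2πλ / log T`. -/
def Dprop (lam T : ℝ) : ℝ := (Dcount lam T : ℝ) / (zetaN T : ℝ)

open Complex Metric Topology in
lemma hadFact1 (n : ℕ) (r : ℂ) : ∀ g : ℂ → ℂ, Differentiable ℂ g → analyticOrderAt g r = n →
    ∃ h : ℂ → ℂ, Differentiable ℂ h ∧ (∀ z, g z = (z - r) ^ n * h z) ∧ h r ≠ 0 := by
  induction n with
  | zero =>
    intro g hg h0
    refine ⟨g, hg, by simp, fun h => ?_⟩
    exact ((hg.analyticAt r).analyticOrderAt_ne_zero.2 h) (by simpa using h0)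
  | succ n ih =>
    intro g hg h0
    have hr : g r = 0 := (hg.analyticAt r).analyticOrderAt_ne_zero.1 (by rw [h0]; simp)
    have hd : Differentiable ℂ (dslope g r) := by
      rw [← differentiableOn_univ] at hg ⊢
      exact (Complex.differentiableOn_dslope Filter.univ_mem).2 hg
    have he : g = (fun z => z - r) * dslope g r := by
      funext z
      have := sub_smul_dslope g r z
      simp only [smul_eq_mul, hr, sub_zero] at this
      simp [this]
    have ho : analyticOrderAt (dslope g r) r = n := by
      have h1 : analyticOrderAt g r = 1 + analyticOrderAt (dslope g r) r := by
        conv_lhs => rw [he]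
        rw [analyticOrderAt_mul (by fun_prop) (hd.analyticAt r)]
        congr 1
        have : AnalyticAt ℂ (fun z : ℂ => z - r) r := by fun_prop
        have h2 := (this.analyticOrderAt_eq_natCast (n := 1)).2 ⟨fun _ => 1, by fun_prop, by simp, by simp⟩
        exact h2
      rw [h0] at h1
      push_cast at h1
      rw [add_comm] at h1
      exact (ENat.add_right_injective_of_ne_top ENat.one_ne_top h1).symm
    obtain ⟨h, h1, h2, h3⟩ := ih _ hd ho
    refine ⟨h, h1, fun z => ?_, h3⟩
    rw [congrFun he z, Pi.mul_apply, h2 z]; ring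

open Complex Metric Topology in
lemma hadFact (f : ℂ → ℂ) (hf : Differentiable ℂ f) (ht : ∀ z, analyticOrderAt f z ≠ ⊤) (S : Finset ℂ) :
    ∃ g : ℂ → ℂ, Differentiable ℂ g ∧
      (∀ z, f z = (∏ r ∈ S, (z - r) ^ analyticOrderNatAt f r) * g z) ∧ ∀ r ∈ S, g r ≠ 0 := by
  classical
  induction S using Finset.induction_on with
  | empty => exact ⟨f, hf, by simp, by simp⟩
  | insert a S ha ih =>
    obtain ⟨g, hg, h1, h2⟩ := ih
    have he : f = (fun z => ∏ r ∈ S, (z - r) ^ analyticOrderNatAt f r) * g := funext h1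
    have hP : AnalyticAt ℂ (fun z => ∏ r ∈ S, (z - r) ^ analyticOrderNatAt f r) a := by fun_prop
    have hP0 : (∏ r ∈ S, (a - r) ^ analyticOrderNatAt f r) ≠ 0 := by
      refine Finset.prod_ne_zero_iff.2 fun r hr => pow_ne_zero _ (sub_ne_zero.2 ?_)
      rintro rfl; exact ha hr
    have ho : analyticOrderAt g a = analyticOrderNatAt f a := by
      have : analyticOrderAt f a = 0 + analyticOrderAt g a := by
        conv_lhs => rw [he]
        rw [analyticOrderAt_mul hP (hg.analyticAt a)]
        congr 1
        by_contra h
        exact hP0 (hP.analyticOrderAt_ne_zero.1 h)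
      rw [zero_add] at this
      rw [← this, Nat.cast_analyticOrderNatAt (ht a)]
    obtain ⟨h, h3, h4, h5⟩ := hadFact1 _ _ g hg ho
    refine ⟨h, h3, fun z => ?_, fun r hr => ?_⟩
    · rw [Finset.prod_insert ha, h1 z, h4 z]; ring
    · rcases Finset.mem_insert.1 hr with rfl | hr
      · exact h5
      · intro h0; exact h2 r hr (by rw [h4 r, h0, mul_zero])

open Complex Metric Topology in
lemma hadEst (g : ℂ → ℂ) (R M : ℝ) (hR : 0 < R) (hM : 0 < M) (z₀ : ℂ)
    (hg : DifferentiableOn ℂ g (ball z₀ R))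
    (hn : ∀ z ∈ ball z₀ R, g z ≠ 0) (hb : ∀ z ∈ ball z₀ R, ‖g z‖ ≤ Real.exp M * ‖g z₀‖)
    (z w : ℂ) (hz : z ∈ ball z₀ (R / 8)) (hw : w ∈ ball z₀ (R / 8)) :
    ‖logDeriv g z - logDeriv g w‖ ≤ 64 * M / R ^ 2 * ‖z - w‖ := by
  have hq : DifferentiableOn ℂ (logDeriv g) (ball z₀ R) := by
    intro x hx
    exact (((hg.deriv isOpen_ball).differentiableAt (isOpen_ball.mem_nhds hx)).div
      (hg.differentiableAt (isOpen_ball.mem_nhds hx)) (hn x hx)).differentiableWithinAt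
  obtain ⟨G, hG0, hG⟩ := (hq.isExactOn_ball).with_val_at z₀ 0
  have h00 : z₀ ∈ ball z₀ R := mem_ball_self hR
  have hexp : ∀ x ∈ ball z₀ R, g x = g z₀ * exp (G x) := by
    have hd : ∀ x ∈ ball z₀ R, HasDerivAt (fun x => g x * exp (-G x)) 0 x := by
      intro x hx
      refine ((hg.differentiableAt (isOpen_ball.mem_nhds hx)).hasDerivAt.mul
        ((hG x hx).neg.cexp)).congr_deriv ?_
      have := hn x hx
      rw [logDeriv_apply, Pi.neg_apply]; field_simp; ring
    intro x hx
    have hc := (convex_ball z₀ R).is_const_of_fderivWithin_eq_zero (𝕜 := ℂ)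
      (f := fun x => g x * exp (-G x)) (fun y hy => (hd y hy).differentiableAt.differentiableWithinAt)
      (fun y hy => by
        rw [fderivWithin_of_isOpen isOpen_ball hy]
        ext; simp [(hd y hy).deriv]) hx h00
    simp only [hG0, neg_zero, exp_zero, mul_one] at hc
    rw [← hc, mul_assoc, ← exp_add]; simp
  have hre : ∀ x ∈ ball z₀ R, (G x).re ≤ M := by
    intro x hx
    have h1 := hb x hx
    rw [hexp x hx, norm_mul, norm_exp, mul_comm] at h1
    have := le_of_mul_le_mul_right h1 (norm_pos_iff.2 (hn z₀ h00))
    exact Real.exp_le_exp.1 this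
  have hGb : ∀ x, ‖x - z₀‖ ≤ R / 2 → ‖G x‖ ≤ 2 * M := by
    intro x hx
    have := borelCaratheodory_zero (f := fun y => G (z₀ + y)) (M := M) (R := R) (z := x - z₀) hM
      (fun y hy => by
        have hy' : z₀ + y ∈ ball z₀ R := by simpa using hy
        exact ((hG _ hy').differentiableAt.comp y (by fun_prop)).differentiableWithinAt)
      (fun y hy => hre _ (by simpa using hy)) hR (by rw [mem_ball_zero_iff]; linarith) (by simpa using hG0)
    simp only [add_sub_cancel] at this
    refine this.trans ?_
    rw [div_le_iff₀ (by linarith)]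
    nlinarith [norm_nonneg (x - z₀)]
  have hqb : ∀ x, ‖x - z₀‖ ≤ R / 4 → ‖logDeriv g x‖ ≤ 8 * M / R := by
    intro x hx
    have hxb : x ∈ ball z₀ R := by rw [mem_ball_iff_norm]; linarith
    rw [← (hG x hxb).deriv]
    have hsub : closedBall x (R / 4) ⊆ ball z₀ R := fun y hy => by
      rw [mem_ball_iff_norm]; rw [mem_closedBall_iff_norm] at hy
      have := norm_add_le (y - x) (x - z₀); simp at this; linarith
    have := norm_deriv_le_of_forall_mem_sphere_norm_le (f := G) (c := x) (R := R / 4) (C := 2 * M) (by linarith)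
      (DifferentiableOn.diffContOnCl fun y hy => (hG y (hsub (closure_ball_subset_closedBall hy))).differentiableAt.differentiableWithinAt)
      (fun y hy => hGb y (by
        rw [mem_sphere_iff_norm] at hy
        have := norm_add_le (y - x) (x - z₀); simp at this; linarith))
    refine this.trans (le_of_eq ?_); field_simp; ring
  have hdq : ∀ x ∈ ball z₀ (R / 8), ‖deriv (logDeriv g) x‖ ≤ 64 * M / R ^ 2 := by
    intro x hx
    rw [mem_ball_iff_norm] at hx
    have hsub : closedBall x (R / 8) ⊆ ball z₀ R := fun y hy => by
      rw [mem_ball_iff_norm]; rw [mem_closedBall_iff_norm] at hy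
      have := norm_add_le (y - x) (x - z₀); simp at this; linarith
    have := norm_deriv_le_of_forall_mem_sphere_norm_le (f := logDeriv g) (c := x) (R := R / 8) (C := 8 * M / R) (by linarith)
      ((hq.mono (closure_ball_subset_closedBall.trans hsub)).diffContOnCl)
      (fun y hy => hqb y (by
        rw [mem_sphere_iff_norm] at hy
        have := norm_add_le (y - x) (x - z₀); simp at this; linarith))
    refine this.trans (le_of_eq ?_); field_simp; ring
  refine (convex_ball z₀ (R / 8)).norm_image_sub_le_of_norm_deriv_le (f := logDeriv g) (fun x hx => ?_) hdq hw hz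
  exact (hq.differentiableAt (isOpen_ball.mem_nhds (ball_subset_ball (by linarith) hx)))

open Complex Metric Topology in
lemma hadLim (f : ℂ → ℂ) (hf : Differentiable ℂ f) (hev : ∀ z, f (-z) = f z) (z₀ : ℂ) (h0 : f z₀ ≠ 0)
    (C : ℝ) (hC : 0 < C) (hgr : ∀ R : ℝ, 1 ≤ R → ∀ z, ‖z‖ ≤ R → ‖f z‖ ≤ Real.exp (C * R ^ (3 / 2 : ℝ)) * ‖f z₀‖)
    (S : ℕ → Finset ℂ) (hS : ∀ R r, r ∈ S R ↔ ‖r‖ ≤ R ∧ f r = 0) (z : ℂ) (hz : f z ≠ 0) :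
    Tendsto (fun R => ∑ r ∈ S R, (analyticOrderNatAt f r : ℂ) / (z - r)) atTop (𝓝 (logDeriv f z)) := by
  have ht : ∀ z, analyticOrderAt f z ≠ ⊤ := by
    intro w hw
    have h1 := AnalyticOnNhd.eqOn_zero_of_preconnected_of_eventuallyEq_zero (f := f) (U := Set.univ) (z₀ := w)
      (fun z _ => hf.analyticAt z) isPreconnected_univ (Set.mem_univ _) (analyticOrderAt_eq_top.1 hw)
    exact h0 (h1 (Set.mem_univ _))
  have hord : ∀ r, analyticOrderNatAt f (-r) = analyticOrderNatAt f r := by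
    intro r
    have h1 : f ∘ (fun z => -z) = f := funext hev
    have h2 := analyticOrderAt_comp_of_deriv_ne_zero (f := f) (g := fun z : ℂ => -z) (z₀ := r) (by fun_prop) (by simp)
    rw [h1] at h2
    rw [analyticOrderNatAt, analyticOrderNatAt, h2]
  have hodd : logDeriv f (-z) = - logDeriv f z := by
    have h1 : (fun z => f (-z)) = f := funext hev
    have h2 := deriv_comp_neg (f := f) (x := z)
    rw [h1] at h2
    rw [logDeriv_apply, logDeriv_apply, hev, h2]; ring
  have hsodd : ∀ R, ∑ r ∈ S R, (analyticOrderNatAt f r : ℂ) / (-z - r) = -∑ r ∈ S R, (analyticOrderNatAt f r : ℂ) / (z - r) := by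
    intro R
    rw [← Finset.sum_neg_distrib]
    refine Finset.sum_bij (fun r _ => -r) (fun r hr => ?_) (by simp) (fun r hr => ⟨-r, ?_, by simp⟩) (fun r hr => ?_)
    · rw [hS] at hr ⊢; simpa [hev] using hr
    · rw [hS] at hr ⊢; simpa [hev] using hr
    · rw [hord, ← div_neg]; congr 1; ring
  have key : ∀ᶠ R : ℕ in atTop, ‖(∑ r ∈ S R, (analyticOrderNatAt f r : ℂ) / (z - r)) - logDeriv f z‖
      ≤ (256 * C * 8 * ‖z‖) * (R : ℝ) ^ (-(1 / 2) : ℝ) := by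
    have e1 : ∀ᶠ R : ℕ in atTop, 16 * (‖z‖ + ‖z₀‖ + 1) < (R : ℝ) :=
      (tendsto_natCast_atTop_atTop (R := ℝ)).eventually_gt_atTop _
    filter_upwards [e1] with R hR
    have nz := norm_nonneg z
    have nz0 := norm_nonneg z₀
    obtain ⟨g, hg, hfg, hgS⟩ := hadFact f hf ht (S R)
    set M := C * (4 * R : ℝ) ^ (3 / 2 : ℝ)
    have hR0 : (0 : ℝ) < R := by linarith
    have hM : 0 < M := by positivity
    have hgn : ∀ w, ‖w‖ ≤ R → g w ≠ 0 := by
      intro w hw hgw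
      by_cases hfw : f w = 0
      · exact hgS w ((hS _ _).2 ⟨hw, hfw⟩) hgw
      · exact hfw (by rw [hfg, hgw, mul_zero])
    have hsph : ∀ w ∈ sphere (0 : ℂ) (4 * R), ‖g w‖ ≤ Real.exp M * ‖g z₀‖ := by
      intro w hw
      rw [mem_sphere_zero_iff_norm] at hw
      have h1 := hgr (4 * R) (by linarith) w hw.le
      rw [hfg w, hfg z₀, norm_mul, norm_mul] at h1
      have h2 : ‖∏ r ∈ S R, (z₀ - r) ^ analyticOrderNatAt f r‖ ≤ ‖∏ r ∈ S R, (w - r) ^ analyticOrderNatAt f r‖ := by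
        rw [norm_prod, norm_prod]
        refine Finset.prod_le_prod (fun _ _ => norm_nonneg _) fun r hr => ?_
        rw [norm_pow, norm_pow]
        refine pow_le_pow_left₀ (norm_nonneg _) ?_ _
        have hr' := ((hS _ _).1 hr).1
        have := norm_sub_le z₀ r
        have := norm_sub_norm_le w r
        linarith
      have h3 : 0 < ‖∏ r ∈ S R, (z₀ - r) ^ analyticOrderNatAt f r‖ := by
        refine norm_pos_iff.2 (fun h => h0 ?_)
        rw [hfg, h, zero_mul]
      have h4 := mul_le_mul_of_nonneg_right h2 (norm_nonneg (g w))
      have h5 : ‖∏ r ∈ S R, (z₀ - r) ^ analyticOrderNatAt f r‖ * ‖g w‖ ≤ ‖∏ r ∈ S R, (z₀ - r) ^ analyticOrderNatAt f r‖ * (Real.exp M * ‖g z₀‖) := by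
        calc _ ≤ _ := h4
          _ ≤ _ := h1
          _ = _ := by ring
      exact le_of_mul_le_mul_left h5 h3
    have hball : ∀ w, ‖w‖ ≤ 4 * R → ‖g w‖ ≤ Real.exp M * ‖g z₀‖ := by
      intro w hw
      refine norm_le_of_forall_mem_frontier_norm_le (f := g) (U := ball 0 (4 * R)) isBounded_ball hg.diffContOnCl
        (fun x hx => hsph x (by rwa [frontier_ball _ (by positivity)] at hx)) ?_
      rw [closure_ball _ (by positivity)]; simpa using hw
    have hsubn : ∀ w ∈ ball z₀ (R / 2 : ℝ), ‖w‖ ≤ R := fun w hw => by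
      rw [mem_ball_iff_norm] at hw
      have := norm_add_le (w - z₀) z₀; simp at this; linarith
    have hest := hadEst g (R / 2) M (by positivity) hM z₀ hg.differentiableOn (fun w hw => hgn w (hsubn w hw))
      (fun w hw => hball w (by have := hsubn w hw; linarith)) z (-z)
      (by rw [mem_ball_iff_norm]; have := norm_sub_le z z₀; linarith)
      (by rw [mem_ball_iff_norm]; have := norm_sub_le (-z) z₀; rw [norm_neg] at this; linarith)
    have hld : ∀ w, f w ≠ 0 → logDeriv g w = logDeriv f w - ∑ r ∈ S R, (analyticOrderNatAt f r : ℂ) / (w - r) := by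
      intro w hw
      have hne : ∀ r ∈ S R, w - r ≠ 0 := by
        intro r hr h
        rw [sub_eq_zero.1 h] at hw
        exact hw ((hS _ _).1 hr).2
      have hgw : g w ≠ 0 := fun h => hw (by rw [hfg, h, mul_zero])
      have h1 : f = fun w => (∏ r ∈ S R, (w - r) ^ analyticOrderNatAt f r) * g w := funext hfg
      have h2 : logDeriv f w = logDeriv (fun w => (∏ r ∈ S R, (w - r) ^ analyticOrderNatAt f r)) w + logDeriv g w := by
        conv_lhs => rw [h1]
        rw [logDeriv_mul (f := fun w => (∏ r ∈ S R, (w - r) ^ analyticOrderNatAt f r)) (g := g) w (Finset.prod_ne_zero_iff.2 fun r hr => pow_ne_zero _ (hne r hr)) hgw (by fun_prop) (hg w)]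
      have h3 := logDeriv_prod (s := S R) (f := fun r w => (w - r) ^ analyticOrderNatAt f r) (x := w)
        (fun r hr => pow_ne_zero _ (hne r hr)) (fun r _ => by fun_prop)
      rw [h2, h3, add_comm, add_sub_assoc]
      rw [left_eq_add, sub_eq_zero]
      refine Finset.sum_congr rfl fun r hr => ?_
      have h4 := logDeriv_fun_pow (f := fun w : ℂ => w - r) (x := w) (by fun_prop) (analyticOrderNatAt f r)
      rw [h4, logDeriv_apply]; simp [div_eq_mul_inv]
    rw [hld z hz, hld (-z) (by rwa [hev]), hsodd, hodd] at hest
    have e2 : logDeriv f z - ∑ r ∈ S R, (analyticOrderNatAt f r : ℂ) / (z - r) - (-logDeriv f z - -∑ r ∈ S R, (analyticOrderNatAt f r : ℂ) / (z - r))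
      = -(2 * ((∑ r ∈ S R, (analyticOrderNatAt f r : ℂ) / (z - r)) - logDeriv f z)) := by ring
    have e3 : z - -z = 2 * z := by ring
    rw [e2, e3, norm_neg, norm_mul, norm_mul] at hest
    simp only [Complex.norm_ofNat] at hest
    have e4 : M / (R / 2 : ℝ) ^ 2 = 32 * C * (R : ℝ) ^ (-(1 / 2) : ℝ) := by
      have e5 : (R : ℝ) ^ (3 / 2 : ℝ) = (R : ℝ) ^ (-(1 / 2) : ℝ) * (R : ℝ) ^ 2 := by
        rw [← Real.rpow_natCast, ← Real.rpow_add hR0]; norm_num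
      have e6 : (4 : ℝ) ^ (3 / 2 : ℝ) = 8 := by
        rw [show (4 : ℝ) = 2 ^ (2 : ℝ) by norm_num, ← Real.rpow_mul (by norm_num)]; norm_num
      simp only [M]
      rw [Real.mul_rpow (by norm_num) hR0.le, e6, e5]; field_simp; ring
    rw [mul_div_assoc, e4] at hest
    linarith
  rw [tendsto_iff_norm_sub_tendsto_zero]
  refine squeeze_zero' (Eventually.of_forall fun _ => norm_nonneg _) key ?_
  have := ((tendsto_rpow_neg_atTop (y := 1 / 2) (by norm_num)).comp (tendsto_natCast_atTop_atTop (R := ℝ))).const_mul (256 * C * 8 * ‖z‖)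
  simpa using this

open Complex in
lemma normGammaLe {z : ℂ} (hz : 0 < z.re) : ‖Gamma z‖ ≤ Real.Gamma z.re := by
  rw [Complex.Gamma_eq_integral hz, Real.Gamma_eq_integral hz, GammaIntegral]
  refine (norm_integral_le_integral_norm _).trans (le_of_eq ?_)
  refine setIntegral_congr_fun measurableSet_Ioi fun x hx => ?_
  have hx : 0 < x := hx
  simp only [norm_mul, norm_cpow_eq_rpow_re_of_pos hx, sub_re, one_re, norm_real, Real.norm_eq_abs, abs_of_pos (Real.exp_pos _)]

lemma realGammaLe {x : ℝ} (hx : 2 ≤ x) : Real.Gamma x ≤ Real.exp (8 * x ^ (3 / 2 : ℝ)) := by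
  have h1 := Nat.le_ceil x
  have h2 : (⌈x⌉₊ : ℝ) < x + 1 := Nat.ceil_lt_add_one (by linarith)
  have h3 : Real.Gamma x ≤ Real.Gamma (⌈x⌉₊ + 1) :=
    Real.Gamma_strictMonoOn_Ici.monotoneOn (by simpa using hx) (by simp; linarith) (by linarith)
  rw [Real.Gamma_nat_eq_factorial] at h3
  have h4 : ((⌈x⌉₊.factorial : ℕ) : ℝ) ≤ (⌈x⌉₊ : ℝ) ^ ⌈x⌉₊ := by exact_mod_cast Nat.factorial_le_pow _
  refine h3.trans (h4.trans ?_)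
  have hn : (0 : ℝ) < ⌈x⌉₊ := by linarith
  rw [← Real.rpow_natCast, Real.rpow_def_of_pos hn, Real.exp_le_exp]
  have h5 : Real.log (⌈x⌉₊ : ℝ) ≤ 4 * x ^ (1 / 2 : ℝ) := by
    have h6 := Real.log_le_rpow_div (x := 2 * x) (ε := 1 / 2) (by linarith) (by norm_num)
    have h7 : Real.log (⌈x⌉₊ : ℝ) ≤ Real.log (2 * x) := Real.log_le_log hn (by linarith)
    rw [Real.mul_rpow (by norm_num) (by linarith)] at h6
    have h8 : (2 : ℝ) ^ (1 / 2 : ℝ) ≤ 2 := by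
      conv_rhs => rw [← Real.rpow_one 2]
      exact Real.rpow_le_rpow_of_exponent_le (by norm_num) (by norm_num)
    have h9 : 0 ≤ x ^ (1 / 2 : ℝ) := by positivity
    nlinarith
  have h6 : x ^ (3 / 2 : ℝ) = x ^ (1 / 2 : ℝ) * x := by
    rw [← Real.rpow_add_one (by linarith)]; norm_num
  have h9 : 0 ≤ x ^ (1 / 2 : ℝ) := by positivity
  rw [h6]
  calc _ ≤ 4 * x ^ (1 / 2 : ℝ) * (2 * x) := by gcongr; linarith
    _ = _ := by ring

open Complex in
lemma lam0Strip : ∃ B : ℝ, 0 ≤ B ∧ ∀ s : ℂ, 1 / 2 ≤ s.re → s.re ≤ 4 → ‖completedRiemannZeta₀ s‖ ≤ B := by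
  set P := HurwitzZeta.hurwitzEvenFEPair 0
  have hc : ∀ s : ℂ, MellinConvergent P.f_modif s := fun s => (P.isStrongFEPair_toStrongFEPair.hasMellin s).1
  have hi : ∀ a : ℝ, IntegrableOn (fun x : ℝ => x ^ (a - 1) * ‖P.f_modif x‖) (Set.Ioi 0) := by
    intro a
    have h := (hc a).norm
    refine IntegrableOn.congr_fun (f := fun x : ℝ => ‖(x : ℂ) ^ ((a : ℂ) - 1) • P.f_modif x‖) h (fun x hx => ?_) measurableSet_Ioi
    simp only [norm_smul, norm_cpow_eq_rpow_re_of_pos (Set.mem_Ioi.1 hx), sub_re, one_re, ofReal_re]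
  refine ⟨(∫ x in Set.Ioi (0 : ℝ), (x ^ ((1 / 4 : ℝ) - 1) * ‖P.f_modif x‖ + x ^ ((2 : ℝ) - 1) * ‖P.f_modif x‖)), ?_, ?_⟩
  · exact setIntegral_nonneg measurableSet_Ioi fun x hx => by have : 0 < x := hx; positivity
  intro s h1 h2
  have e : completedRiemannZeta₀ s = mellin P.f_modif (s / 2) / 2 := rfl
  rw [e, norm_div, Complex.norm_ofNat]
  have h3 : ‖mellin P.f_modif (s / 2)‖ ≤ ∫ x in Set.Ioi (0 : ℝ), (x ^ ((1 / 4 : ℝ) - 1) * ‖P.f_modif x‖ + x ^ ((2 : ℝ) - 1) * ‖P.f_modif x‖) := by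
    refine norm_integral_le_of_norm_le ((hi _).add (hi _)) ?_
    refine (ae_restrict_iff' measurableSet_Ioi).2 (Eventually.of_forall fun x hx => ?_)
    have hx : 0 < x := hx
    rw [norm_smul, norm_cpow_eq_rpow_re_of_pos hx, ← add_mul]
    refine mul_le_mul_of_nonneg_right ?_ (norm_nonneg _)
    have hre : (s / 2 - 1).re = s.re / 2 - 1 := by simp
    rw [hre]
    rcases le_total x 1 with h | h
    · have := Real.rpow_le_rpow_of_exponent_ge hx h (show (1 / 4 : ℝ) - 1 ≤ s.re / 2 - 1 by linarith)
      exact this.trans (le_add_of_nonneg_right (by positivity))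
    · have := Real.rpow_le_rpow_of_exponent_le h (show s.re / 2 - 1 ≤ (2 : ℝ) - 1 by linarith)
      exact this.trans (le_add_of_nonneg_left (by positivity))
  linarith [norm_nonneg (mellin P.f_modif (s / 2))]

/-- The even entire function `z ↦ ξ(1/2+z)` (up to a factor 2). -/
def xiF (z : ℂ) : ℂ := (z ^ 2 - 1 / 4) * completedRiemannZeta₀ (1 / 2 + z) + 1

lemma xiF_diff : Differentiable ℂ xiF := by
  have := differentiable_completedZeta₀
  unfold xiF
  fun_prop

lemma xiF_neg (z : ℂ) : xiF (-z) = xiF z := by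
  unfold xiF
  rw [← completedRiemannZeta₀_one_sub]; ring_nf

lemma xiF_eq (z : ℂ) (h1 : 1 / 2 + z ≠ 0) (h2 : z ≠ 1 / 2) :
    xiF z = (z ^ 2 - 1 / 4) * completedRiemannZeta (1 / 2 + z) := by
  rw [xiF, completedRiemannZeta_eq]
  have h3 : (1 : ℂ) - (1 / 2 + z) ≠ 0 := fun h => h2 (by linear_combination -h)
  have e1 := mul_one_div_cancel h1
  have e2 := mul_one_div_cancel h3
  linear_combination (z - 1 / 2) * e1 - (z + 1 / 2) * e2

lemma xiF_eq2 (z : ℂ) (h0 : -1 / 2 < z.re) (h2 : z ≠ 1 / 2) :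
    xiF z = (z ^ 2 - 1 / 4) * (Complex.Gammaℝ (1 / 2 + z) * riemannZeta (1 / 2 + z)) := by
  have h1 : 1 / 2 + z ≠ 0 := fun h => by
    have := congrArg Complex.re h; simp at this; linarith
  rw [xiF_eq z h1 h2, riemannZeta_def_of_ne_zero h1]
  have : Complex.Gammaℝ (1 / 2 + z) ≠ 0 := Complex.Gammaℝ_ne_zero_of_re_pos (by simp; linarith)
  rw [mul_div_cancel₀ _ this]

open Complex in
lemma xiF_growth : ∃ C : ℝ, 0 < C ∧ ∀ R : ℝ, 1 ≤ R → ∀ z, ‖z‖ ≤ R →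
    ‖xiF z‖ ≤ Real.exp (C * R ^ (3 / 2 : ℝ)) * ‖xiF (3 / 2)‖ := by
  have h0 : xiF (3 / 2) ≠ 0 := by
    rw [xiF_eq2 _ (by norm_num) (by norm_num)]
    have e : (1 / 2 + 3 / 2 : ℂ) = 2 := by norm_num
    rw [e]
    refine mul_ne_zero (by norm_num) (mul_ne_zero (Gammaℝ_ne_zero_of_re_pos (by simp)) (riemannZeta_ne_zero_of_one_le_re (by simp)))
  obtain ⟨B, hB, hs⟩ := lam0Strip
  set Z := ∑' n : ℕ, ‖1 / (n : ℂ) ^ (2 : ℂ)‖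
  have hZs : Summable fun n : ℕ => ‖1 / (n : ℂ) ^ (2 : ℂ)‖ := (Complex.summable_one_div_nat_cpow.2 (by simp)).norm
  have hZ : 0 ≤ Z := tsum_nonneg fun _ => norm_nonneg _
  have hl : ∀ R : ℝ, 1 ≤ R → ∀ s : ℂ, 1 / 2 ≤ s.re → s.re ≤ 2 * R → ‖completedRiemannZeta₀ s‖ ≤ (B + Z + 2) * Real.exp (8 * R ^ (3 / 2 : ℝ)) := by
    intro R hR s h1 h2
    have hE : 1 ≤ Real.exp (8 * R ^ (3 / 2 : ℝ)) := Real.one_le_exp (by positivity)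
    rcases le_total s.re 4 with h | h
    · have := hs s h1 h
      nlinarith
    · have e1 : completedRiemannZeta₀ s = completedRiemannZeta s + 1 / s + 1 / (1 - s) := by
        rw [completedRiemannZeta_eq]; ring
      have i1 : ‖1 / s‖ ≤ 1 := by
        rw [norm_div, norm_one]
        have := (abs_re_le_norm s); rw [abs_of_pos (by linarith)] at this
        exact (div_le_one (by linarith)).2 (by linarith)
      have i2 : ‖1 / (1 - s)‖ ≤ 1 := by
        rw [norm_div, norm_one]
        have := (abs_re_le_norm (1 - s)); rw [sub_re, one_re, abs_of_neg (by linarith)] at this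
        exact (div_le_one (by linarith)).2 (by linarith)
      have i3 : ‖completedRiemannZeta s‖ ≤ Real.exp (8 * R ^ (3 / 2 : ℝ)) * Z := by
        rw [completedZeta_eq_tsum_of_one_lt_re (by linarith), norm_mul, norm_mul]
        have j1 : ‖(π : ℂ) ^ (-s / 2)‖ ≤ 1 := by
          rw [norm_cpow_eq_rpow_re_of_pos Real.pi_pos]
          have : (-s / 2).re = -(s.re / 2) := by simp; ring
          rw [this]
          exact Real.rpow_le_one_of_one_le_of_nonpos (by linarith [Real.pi_gt_three]) (by linarith)
        have j2 : ‖Gamma (s / 2)‖ ≤ Real.exp (8 * R ^ (3 / 2 : ℝ)) := by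
          have hre : (s / 2).re = s.re / 2 := by simp
          refine (normGammaLe (by rw [hre]; linarith)).trans ?_
          rw [hre]
          refine (realGammaLe (by linarith)).trans ?_
          have : s.re / 2 ≤ R := by linarith
          gcongr
        have j3 : ‖∑' n : ℕ, 1 / (n : ℂ) ^ s‖ ≤ Z := by
          refine tsum_of_norm_bounded hZs.hasSum fun n => ?_
          rcases Nat.eq_zero_or_pos n with rfl | hn
          · rw [Nat.cast_zero, zero_cpow (by intro h'; rw [h'] at h; simp at h; linarith)]; simp
          · rw [norm_div, norm_div, norm_natCast_cpow_of_pos hn, norm_natCast_cpow_of_pos hn]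
            have : (1 : ℝ) ≤ n := by exact_mod_cast hn
            exact div_le_div_of_nonneg_left (by simp) (by positivity) (Real.rpow_le_rpow_of_exponent_le this (by simp; linarith))
        calc _ ≤ 1 * Real.exp (8 * R ^ (3 / 2 : ℝ)) * Z := by gcongr
          _ = _ := by ring
      rw [e1]
      have := norm_add₃_le (a := completedRiemannZeta s) (b := 1 / s) (c := 1 / (1 - s))
      nlinarith
  have hp : ∀ R : ℝ, 1 ≤ R → ∀ z : ℂ, 0 ≤ z.re → ‖z‖ ≤ R → ‖xiF z‖ ≤ 2 * (B + Z + 3) * Real.exp (10 * R ^ (3 / 2 : ℝ)) := by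
    intro R hR z h1 h2
    have hre := (le_abs_self _).trans (abs_re_le_norm z)
    have h3 := hl R hR (1 / 2 + z) (by simp; linarith) (by simp; linarith)
    have h4 : ‖z ^ 2 - 1 / 4‖ ≤ 2 * R ^ 2 := by
      refine (norm_sub_le _ _).trans ?_
      rw [norm_pow]
      have : ‖z‖ ^ 2 ≤ R ^ 2 := by gcongr
      have : ‖(1 / 4 : ℂ)‖ = 1 / 4 := by norm_num
      nlinarith
    have hR32 : R ≤ R ^ (3 / 2 : ℝ) := by
      conv_lhs => rw [← Real.rpow_one R]
      exact Real.rpow_le_rpow_of_exponent_le hR (by norm_num)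
    have h5 : R ^ 2 ≤ Real.exp (2 * R ^ (3 / 2 : ℝ)) := by
      have : R ≤ Real.exp (R ^ (3 / 2 : ℝ)) := by linarith [Real.add_one_le_exp (R ^ (3 / 2 : ℝ))]
      rw [two_mul, Real.exp_add, sq]; gcongr
    have h6 : Real.exp (10 * R ^ (3 / 2 : ℝ)) = Real.exp (2 * R ^ (3 / 2 : ℝ)) * Real.exp (8 * R ^ (3 / 2 : ℝ)) := by
      rw [← Real.exp_add]; ring_nf
    have hE : 1 ≤ Real.exp (8 * R ^ (3 / 2 : ℝ)) := Real.one_le_exp (by positivity)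
    unfold xiF
    refine (norm_add_le _ _).trans ?_
    rw [norm_mul, norm_one, h6]
    have hE2 : 1 ≤ R ^ 2 := by nlinarith
    have hE3 : 1 ≤ Real.exp (2 * R ^ (3 / 2 : ℝ)) * Real.exp (8 * R ^ (3 / 2 : ℝ)) := by nlinarith
    calc _ ≤ (2 * R ^ 2) * ((B + Z + 2) * Real.exp (8 * R ^ (3 / 2 : ℝ))) + 1 := by gcongr
      _ ≤ (2 * Real.exp (2 * R ^ (3 / 2 : ℝ))) * ((B + Z + 2) * Real.exp (8 * R ^ (3 / 2 : ℝ))) + 1 := by gcongr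
      _ ≤ _ := by nlinarith
  set K := 2 * (B + Z + 3) / ‖xiF (3 / 2)‖ with hK
  have hn : 0 < ‖xiF (3 / 2)‖ := norm_pos_iff.2 h0
  have hKp : 0 < K := by positivity
  refine ⟨10 + K, by positivity, fun R hR z hz => ?_⟩
  have h1 : ‖xiF z‖ ≤ 2 * (B + Z + 3) * Real.exp (10 * R ^ (3 / 2 : ℝ)) := by
    rcases le_total 0 z.re with h | h
    · exact hp R hR z h hz
    · rw [← xiF_neg]; exact hp R hR (-z) (by simpa using h) (by simpa using hz)
  have h2 : 2 * (B + Z + 3) = K * ‖xiF (3 / 2)‖ := by rw [hK]; field_simp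
  have h3 : K ≤ Real.exp (K * R ^ (3 / 2 : ℝ)) := by
    have : 1 ≤ R ^ (3 / 2 : ℝ) := Real.one_le_rpow hR (by norm_num)
    have := Real.add_one_le_exp (K * R ^ (3 / 2 : ℝ))
    nlinarith
  rw [h2] at h1
  rw [add_mul, Real.exp_add]
  calc _ ≤ _ := h1
    _ ≤ Real.exp (K * R ^ (3 / 2 : ℝ)) * ‖xiF (3 / 2)‖ * Real.exp (10 * R ^ (3 / 2 : ℝ)) := by gcongr
    _ = _ := by ring

lemma zetaMult_eq {s : ℂ} (hs : s ≠ 1) (ht : analyticOrderAt riemannZeta s ≠ ⊤) :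
    zetaMult s = analyticOrderNatAt riemannZeta s := by
  have ha : AnalyticAt ℂ riemannZeta s := by
    rw [Complex.analyticAt_iff_eventually_differentiableAt]
    filter_upwards [isOpen_compl_singleton.mem_nhds hs] with z hz using differentiableAt_riemannZeta hz
  set n := analyticOrderNatAt riemannZeta s with hn
  have hn' : (n : ℕ∞) = analyticOrderAt riemannZeta s := Nat.cast_analyticOrderNatAt ht
  have h1 := (natCast_le_analyticOrderAt_iff_iteratedDeriv_eq_zero (n := n) ha).1 hn'.le
  have h2 : ¬ ∀ i < n + 1, iteratedDeriv i riemannZeta s = 0 := by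
    rw [← natCast_le_analyticOrderAt_iff_iteratedDeriv_eq_zero ha, ← hn', Nat.cast_le]; omega
  push Not at h2
  obtain ⟨i, hi, h3⟩ := h2
  have : i = n := by
    by_contra h
    exact h3 (h1 i (by omega))
  subst this
  refine le_antisymm (Nat.sInf_le h3) (le_csInf ⟨_, h3⟩ fun j hj => ?_)
  by_contra h
  exact hj (h1 j (by omega))

lemma half_ne_one (γ : ℝ) : (1 / 2 + γ * Complex.I : ℂ) ≠ 1 := fun h => by
  have := congrArg Complex.re h; norm_num at this

open Complex Topology in
lemma xiF_order (γ : ℝ) : analyticOrderNatAt xiF (γ * I) = ordMult γ ∧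
    (xiF (γ * I) = 0 ↔ riemannZeta (1 / 2 + γ * I) = 0) ∧ (ordMult γ = 0 ↔ riemannZeta (1 / 2 + γ * I) ≠ 0) := by
  have hre : (γ * I : ℂ).re = 0 := by simp
  have hs := half_ne_one γ
  have hne : (γ * I : ℂ) ≠ 1 / 2 := fun h => by
    have := congrArg Complex.re h; simp at this
  have ha : AnalyticAt ℂ riemannZeta (1 / 2 + γ * I) := by
    rw [Complex.analyticAt_iff_eventually_differentiableAt]
    filter_upwards [isOpen_compl_singleton.mem_nhds hs] with z hz using differentiableAt_riemannZeta hz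
  have hG : DifferentiableOn ℂ (fun z => (z ^ 2 - 1 / 4) * Gammaℝ (1 / 2 + z)) {z | -1 / 2 < z.re} := by
    intro z hz
    have hz : -1 / 2 < z.re := hz
    refine DifferentiableAt.differentiableWithinAt (DifferentiableAt.mul (by fun_prop) ?_)
    have h1 : DifferentiableAt ℂ Gammaℝ (1 / 2 + z) := by
      have h3 : DifferentiableAt ℂ (fun s => (Gammaℝ s)⁻¹⁻¹) (1 / 2 + z) :=
        (differentiable_Gammaℝ_inv _).inv (inv_ne_zero (Gammaℝ_ne_zero_of_re_pos (by simp; linarith)))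
      simpa using h3
    exact h1.comp z (by fun_prop)
  have ho : IsOpen {z : ℂ | -1 / 2 < z.re} := isOpen_lt continuous_const continuous_re
  have hm : (γ * I : ℂ) ∈ {z : ℂ | -1 / 2 < z.re} := by norm_num
  have hu : AnalyticAt ℂ (fun z => (z ^ 2 - 1 / 4) * Gammaℝ (1 / 2 + z)) (γ * I) := hG.analyticAt (ho.mem_nhds hm)
  have hu0 : ((γ * I : ℂ) ^ 2 - 1 / 4) * Gammaℝ (1 / 2 + γ * I) ≠ 0 := by
    refine mul_ne_zero (fun h => ?_) (Gammaℝ_ne_zero_of_re_pos (by simp))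
    have : ((γ * I : ℂ) ^ 2 - 1 / 4) = ((-(γ ^ 2) - 1 / 4 : ℝ) : ℂ) := by
      rw [mul_pow, I_sq]; push_cast; ring
    rw [this, ofReal_eq_zero] at h
    nlinarith [sq_nonneg γ]
  have hz : xiF =ᶠ[𝓝 (γ * I : ℂ)] (fun z => (z ^ 2 - 1 / 4) * Gammaℝ (1 / 2 + z)) * (riemannZeta ∘ fun z => 1 / 2 + z) := by
    filter_upwards [ho.mem_nhds hm, isOpen_compl_singleton.mem_nhds hne] with z h1 h2
    rw [xiF_eq2 z h1 h2]; simp [mul_assoc]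
  have hc : analyticOrderAt (riemannZeta ∘ fun z => 1 / 2 + z) (γ * I) = analyticOrderAt riemannZeta (1 / 2 + γ * I) :=
    analyticOrderAt_comp_of_deriv_ne_zero (by fun_prop) (by simp)
  have hu1 : analyticOrderAt (fun z => (z ^ 2 - 1 / 4) * Gammaℝ (1 / 2 + z)) (γ * I) = 0 := by
    by_contra h
    exact hu0 (hu.analyticOrderAt_ne_zero.1 h)
  have hac : AnalyticAt ℂ (riemannZeta ∘ fun z => 1 / 2 + z) (γ * I) :=
    AnalyticAt.comp (g := riemannZeta) (f := fun z => 1 / 2 + z) ha (by fun_prop)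
  have key : analyticOrderAt xiF (γ * I) = analyticOrderAt riemannZeta (1 / 2 + γ * I) := by
    rw [analyticOrderAt_congr hz, analyticOrderAt_mul hu hac, hu1, zero_add, hc]
  have ht : analyticOrderAt riemannZeta (1 / 2 + γ * I) ≠ ⊤ := by
    rw [← key]
    intro hw
    have h1 := AnalyticOnNhd.eqOn_zero_of_preconnected_of_eventuallyEq_zero (f := xiF) (U := Set.univ)
      (fun z _ => xiF_diff.analyticAt z) isPreconnected_univ (Set.mem_univ _) (analyticOrderAt_eq_top.1 hw)
    have := h1 (Set.mem_univ (1 / 2))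
    norm_num [xiF] at this
  refine ⟨?_, ?_, ?_⟩
  · rw [ordMult, zetaMult_eq hs ht, analyticOrderNatAt, key]; rfl
  · rw [hz.eq_of_nhds]; simp only [Pi.mul_apply, Function.comp_apply, mul_eq_zero (b := riemannZeta _), hu0, false_or]
  · rw [ordMult, zetaMult_eq hs ht, ← ha.analyticOrderAt_eq_zero, ← Nat.cast_analyticOrderNatAt ht]; simp

open Complex in
lemma xiF_zero_re (hRH : RiemannHypothesis) (r : ℂ) (h : xiF r = 0) : r.re = 0 := by
  have aux : ∀ r : ℂ, 0 ≤ r.re → xiF r = 0 → r.re = 0 := by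
    intro r hr h
    have h2 : r ≠ 1 / 2 := by rintro rfl; norm_num [xiF] at h
    rw [xiF_eq2 r (by linarith) h2] at h
    have hG : Gammaℝ (1 / 2 + r) ≠ 0 := Gammaℝ_ne_zero_of_re_pos (by simp; linarith)
    have h3 : (r ^ 2 - 1 / 4) ≠ 0 := by
      intro h3
      have : (r - 1 / 2) * (r + 1 / 2) = 0 := by linear_combination h3
      rcases mul_eq_zero.1 this with h | h
      · exact h2 (sub_eq_zero.1 h)
      · have := congrArg re h; simp at this; linarith
    have h4 : riemannZeta (1 / 2 + r) = 0 := ((mul_eq_zero.1 h).resolve_left h3 |> mul_eq_zero.1).resolve_left hG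
    have := hRH _ h4 (by
      rintro ⟨n, hn⟩
      have := congrArg re hn; simp at this
      have h0 : (0 : ℝ) ≤ n := n.cast_nonneg
      linarith) (fun h => h2 (by linear_combination h))
    simpa using this
  rcases le_total 0 r.re with h1 | h1
  · exact aux r h1 h
  · have := aux (-r) (by simpa using h1) (by rwa [xiF_neg]); simpa using this

lemma ordsFinite (R : ℝ) : {γ : ℝ | |γ| ≤ R ∧ riemannZeta (1 / 2 + γ * Complex.I) = 0}.Finite := by
  have h := (isCompact_closedBall (1 / 2 : ℂ) R).inter_riemannZetaZeros_finite
  refine (h.preimage (f := fun γ : ℝ => (1 / 2 + γ * Complex.I : ℂ)) ?_).subset ?_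
  · intro a _ b _ hab; simpa using hab
  · rintro γ ⟨h1, h2⟩
    refine ⟨?_, h2⟩
    simpa [Metric.mem_closedBall, dist_eq_norm] using h1

open Complex Topology in
lemma poissonSum (hRH : RiemannHypothesis) (c t : ℝ) (hc : 0 < c) :
    HasSum (fun γ : ℝ => (ordMult γ : ℝ) * (c / (c ^ 2 + (t - γ) ^ 2))) (logDeriv xiF (c + t * I)).re := by
  classical
  set T : ℕ → Finset ℝ := fun R => (ordsFinite R).toFinset
  have hT : ∀ R γ, γ ∈ T R ↔ |γ| ≤ R ∧ riemannZeta (1 / 2 + γ * I) = 0 := fun R γ => by simp [T]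
  obtain ⟨C, hC, hgr⟩ := xiF_growth
  have h0 : ∀ z : ℂ, 0 < z.re → xiF z ≠ 0 := fun z hz h => hz.ne' (xiF_zero_re hRH z h)
  have hl := hadLim xiF xiF_diff xiF_neg (3 / 2) (h0 _ (by norm_num)) C hC hgr
    (fun R => (T R).image fun γ : ℝ => (γ * I : ℂ)) (fun R r => by
      rw [Finset.mem_image]
      constructor
      · rintro ⟨γ, h1, rfl⟩
        rw [hT] at h1
        exact ⟨by simpa using h1.1, (xiF_order γ).2.1.2 h1.2⟩
      · rintro ⟨h1, h2⟩
        have h3 := xiF_zero_re hRH r h2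
        have h4 : ((r.im : ℝ) * I : ℂ) = r := by apply Complex.ext <;> simp [h3]
        refine ⟨r.im, (hT _ _).2 ⟨(abs_im_le_norm r).trans h1, ?_⟩, h4⟩
        rw [← (xiF_order _).2.1, h4, h2]) (c + t * I) (h0 _ (by simpa using hc))
  have hl2 := (continuous_re.tendsto _).comp hl
  have e : (re ∘ fun R : ℕ => ∑ r ∈ (T R).image fun γ : ℝ => (γ * I : ℂ), (analyticOrderNatAt xiF r : ℂ) / (c + t * I - r))
      = fun R => ∑ γ ∈ T R, (ordMult γ : ℝ) * (c / (c ^ 2 + (t - γ) ^ 2)) := by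
    funext R
    rw [Function.comp_apply, Finset.sum_image (fun a _ b _ h => by simpa using h), re_sum]
    refine Finset.sum_congr rfl fun γ _ => ?_
    rw [(xiF_order γ).1, div_re, normSq_apply]
    simp
    ring
  rw [e] at hl2
  have hnn : ∀ γ : ℝ, 0 ≤ (ordMult γ : ℝ) * (c / (c ^ 2 + (t - γ) ^ 2)) := fun γ => by positivity
  have hmono : Monotone fun R => ∑ γ ∈ T R, (ordMult γ : ℝ) * (c / (c ^ 2 + (t - γ) ^ 2)) := by
    intro a b hab
    refine Finset.sum_le_sum_of_subset_of_nonneg (fun γ h => ?_) fun _ _ _ => hnn _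
    rw [hT] at h ⊢
    exact ⟨h.1.trans (by exact_mod_cast hab), h.2⟩
  refine hasSum_of_isLUB_of_nonneg _ hnn ⟨?_, ?_⟩
  · rintro _ ⟨s, rfl⟩
    obtain ⟨R, hR⟩ : ∃ R : ℕ, ∀ γ ∈ s, |γ| ≤ R := by
      obtain ⟨R, hR⟩ := exists_nat_ge (∑ γ ∈ s, |γ|)
      exact ⟨R, fun γ hγ => (Finset.single_le_sum (f := fun γ => |γ|) (fun _ _ => abs_nonneg _) hγ).trans hR⟩
    refine le_trans ?_ (hmono.ge_of_tendsto hl2 R)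
    beta_reduce
    rw [← Finset.sum_filter_add_sum_filter_not s (fun γ : ℝ => riemannZeta (1 / 2 + γ * I) = 0)]
    have : ∑ x ∈ s with ¬riemannZeta (1 / 2 + (x : ℝ) * I) = 0, (ordMult x : ℝ) * (c / (c ^ 2 + (t - x) ^ 2)) = 0 := by
      refine Finset.sum_eq_zero fun γ h => ?_
      rw [(xiF_order γ).2.2.2 (Finset.mem_filter.1 h).2]; simp
    rw [this, add_zero]
    refine Finset.sum_le_sum_of_subset_of_nonneg (fun γ h => ?_) fun _ _ _ => hnn _
    rw [Finset.mem_filter] at h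
    exact (hT _ _).2 ⟨hR γ h.1, h.2⟩
  · intro b hb
    exact le_of_tendsto hl2 (Eventually.of_forall fun R => hb ⟨_, rfl⟩)

open Complex Topology in
lemma digammaSum (z w : ℂ) (hz : 0 < z.re) (hw : 0 < w.re) :
    Tendsto (fun N : ℕ => ∑ k ∈ Finset.range N, (1 / (w + k) - 1 / (z + k))) atTop (𝓝 (digamma z - digamma w)) := by
  have hstep : ∀ u : ℂ, 0 < u.re → ∀ N : ℕ, digamma (u + N) = digamma u + ∑ k ∈ Finset.range N, 1 / (u + k) := by
    intro u hu N
    induction N with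
    | zero => simp
    | succ n ih =>
      have hne : ∀ m : ℕ, u + n ≠ -m := fun m h => by
        have := congrArg re h; simp at this
        have h0 : (0 : ℝ) ≤ n := n.cast_nonneg
        have h1 : (0 : ℝ) ≤ m := m.cast_nonneg
        linarith
      rw [Finset.sum_range_succ, ← add_assoc, ← ih, Nat.cast_succ, ← add_assoc, digamma_apply_add_one _ hne]
      simp
  have key : Tendsto (fun N : ℕ => digamma (z + N) - digamma (w + N)) atTop (𝓝 0) := by
    have hb : ∀ᶠ N : ℕ in atTop, ‖digamma (z + N) - digamma (w + N)‖ ≤ (64 * 64 * ‖z - w‖) * (N : ℝ) ^ (-(1 / 2) : ℝ) := by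
      have e1 : ∀ᶠ R : ℕ in atTop, 8 * (‖z‖ + ‖w‖ + 2) < (R : ℝ) :=
        (tendsto_natCast_atTop_atTop (R := ℝ)).eventually_gt_atTop _
      filter_upwards [e1] with N hN
      have nz := norm_nonneg z
      have nw := norm_nonneg w
      have hN0 : (0 : ℝ) < N := by linarith
      have hre : ∀ u ∈ Metric.ball ((N : ℂ) + 1) N, 1 < u.re ∧ u.re < 2 * N + 1 := by
        intro u hu
        rw [mem_ball_iff_norm] at hu
        have := (abs_re_le_norm (u - (N + 1))).trans_lt hu
        simp only [sub_re, add_re, natCast_re, one_re] at this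
        rw [abs_lt] at this
        constructor <;> linarith
      have h := hadEst Gamma N (64 * (N : ℝ) ^ (3 / 2 : ℝ)) hN0 (by positivity) (N + 1)
        (fun u hu => (differentiableAt_Gamma u fun m h => by
          have h1 := (hre u hu).1; rw [h] at h1; simp at h1
          have h1 : (0 : ℝ) ≤ m := m.cast_nonneg
          linarith).differentiableWithinAt)
        (fun u hu => Gamma_ne_zero_of_re_pos (by linarith [(hre u hu).1]))
        (fun u hu => by
          obtain ⟨h1, h2⟩ := hre u hu
          refine (normGammaLe (by linarith)).trans ?_
          have h3 : Real.Gamma u.re ≤ Real.Gamma (u.re + 1) := by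
            rw [Real.Gamma_add_one (by linarith)]
            have := Real.Gamma_pos_of_pos (show 0 < u.re by linarith)
            nlinarith
          have h4 : Real.Gamma (u.re + 1) ≤ Real.Gamma (4 * N) :=
            Real.Gamma_strictMonoOn_Ici.monotoneOn (by simp; linarith) (by simp; linarith) (by linarith)
          have h5 := realGammaLe (x := 4 * N) (by linarith)
          have e6 : (4 : ℝ) ^ (3 / 2 : ℝ) = 8 := by
            rw [show (4 : ℝ) = 2 ^ (2 : ℝ) by norm_num, ← Real.rpow_mul (by norm_num)]; norm_num
          rw [Real.mul_rpow (by norm_num) hN0.le, e6] at h5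
          have h6 : (1 : ℝ) ≤ ‖Gamma ((N : ℂ) + 1)‖ := by
            rw [Gamma_nat_eq_factorial, norm_natCast]; exact_mod_cast Nat.factorial_pos N
          have h7 := Real.exp_pos (64 * (N : ℝ) ^ (3 / 2 : ℝ))
          calc _ ≤ _ := h3.trans (h4.trans h5)
            _ = Real.exp (64 * (N : ℝ) ^ (3 / 2 : ℝ)) := by ring_nf
            _ ≤ _ := le_mul_of_one_le_right h7.le h6)
        (z + N) (w + N)
        (by
          rw [mem_ball_iff_norm]
          have := norm_sub_le z 1
          rw [show z + N - (N + 1) = z - 1 by ring]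
          rw [norm_one] at this; linarith)
        (by
          rw [mem_ball_iff_norm]
          have := norm_sub_le w 1
          rw [show w + N - (N + 1) = w - 1 by ring]
          rw [norm_one] at this; linarith)
      refine h.trans (le_of_eq ?_)
      have e5 : (N : ℝ) ^ (3 / 2 : ℝ) = (N : ℝ) ^ (-(1 / 2) : ℝ) * (N : ℝ) ^ 2 := by
        rw [← Real.rpow_natCast, ← Real.rpow_add hN0]; norm_num
      rw [e5, show z + N - (w + N) = z - w by ring]
      field_simp
    refine squeeze_zero_norm' hb ?_
    have := ((tendsto_rpow_neg_atTop (y := 1 / 2) (by norm_num)).comp (tendsto_natCast_atTop_atTop (R := ℝ))).const_mul (64 * 64 * ‖z - w‖)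
    simpa using this
  have h2 := key.const_sub (digamma z - digamma w)
  rw [sub_zero] at h2
  refine h2.congr fun N => ?_
  rw [hstep z hz, hstep w hw, Finset.sum_sub_distrib]; ring

/-- Constant in the explicit formula. -/
def kap : ℝ := (Complex.digamma 1).re / 2 - Real.log π / 2

open Complex in
lemma gamSum (c t : ℝ) (hc : 0 < c) :
    HasSum (fun k : ℕ => 1 / (2 * k + 2 : ℝ) - (2 * k + 5 / 2 + c) / ((2 * k + 5 / 2 + c) ^ 2 + t ^ 2))
      ((digamma ((1 / 2 + c + t * I) / 2 + 1) - digamma 1).re / 2) := by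
  have hre : ((1 / 2 + c + t * I : ℂ) / 2 + 1).re = (1 / 2 + c) / 2 + 1 := by
    simp
  have h := digammaSum ((1 / 2 + c + t * I) / 2 + 1) 1 (by rw [hre]; positivity) (by simp)
  have h2 := ((continuous_re.tendsto _).comp h).div_const 2
  rw [hasSum_iff_tendsto_nat_of_nonneg]
  · refine h2.congr fun N => ?_
    rw [Function.comp_apply, re_sum, Finset.sum_div]
    refine Finset.sum_congr rfl fun k _ => ?_
    have h0 : (0 : ℝ) ≤ k := k.cast_nonneg
    have e1 : (1 / (1 + k : ℂ)).re = 1 / (1 + k : ℝ) := by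
      rw [show (1 / (1 + k : ℂ)) = ((1 / (1 + k : ℝ) : ℝ) : ℂ) by push_cast; rfl, ofReal_re]
    rw [sub_re, e1, one_div ((1 / 2 + c + t * I : ℂ) / 2 + 1 + k), inv_re, normSq_apply]
    simp only [add_re, hre, natCast_re, add_im, div_ofNat_im, mul_im, ofReal_re, I_im, ofReal_im, I_re, one_im, natCast_im]
    simp
    have : (1 + (k : ℝ)) ≠ 0 := by positivity
    have h3 : (2 * k + 5 / 2 + c) ^ 2 + t ^ 2 ≠ 0 := by positivity
    have h4 : ((2⁻¹ + c) / 2 + 1 + k) * ((2⁻¹ + c) / 2 + 1 + k) + t / 2 * (t / 2) ≠ 0 := by nlinarith [sq_nonneg t]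
    rw [sub_div]
    congr 1
    · field_simp; ring
    · rw [div_div, div_eq_div_iff (by positivity) h3]; ring
  · intro k
    have h0 : (0 : ℝ) ≤ k := k.cast_nonneg
    rw [sub_nonneg, div_le_div_iff₀ (by positivity) (by positivity)]
    nlinarith [sq_nonneg t, mul_nonneg h0 hc.le]

open Complex Topology in
lemma xiF_logDeriv (c t : ℝ) (hc : 1 / 2 < c) :
    (logDeriv xiF (c + t * I)).re = (c - 1 / 2) / ((c - 1 / 2) ^ 2 + t ^ 2) + kap
      + ∑' k : ℕ, (1 / (2 * k + 2 : ℝ) - (2 * k + 5 / 2 + c) / ((2 * k + 5 / 2 + c) ^ 2 + t ^ 2))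
      - (LSeries (fun n => (ArithmeticFunction.vonMangoldt n : ℂ)) (1 / 2 + c + t * I)).re := by
  set z : ℂ := c + t * I with hz
  have hzre : z.re = c := by simp [hz]
  set s : ℂ := 1 / 2 + z with hs
  have hsre : s.re = 1 / 2 + c := by simp [hs, hzre]
  have ho : IsOpen {z : ℂ | 1 / 2 < z.re} := isOpen_lt continuous_const continuous_re
  have hev : xiF =ᶠ[𝓝 z] fun z => (2 * (z - 1 / 2)) * ((π : ℂ) ^ (-(1 / 2 + z) / 2) * (Gamma ((1 / 2 + z) / 2 + 1) * riemannZeta (1 / 2 + z))) := by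
    filter_upwards [ho.mem_nhds (show z ∈ {z : ℂ | 1 / 2 < z.re} by simpa [hzre] using hc)] with u hu
    have hu : 1 / 2 < u.re := hu
    have h1 : u ≠ 1 / 2 := by rintro rfl; norm_num at hu
    have h2 : (1 / 2 + u) / 2 ≠ 0 := fun h => by
      have := congrArg re h; simp at this; linarith
    rw [xiF_eq2 u (by linarith) h1, Gammaℝ_def, Gamma_add_one _ h2]; ring
  have hld : logDeriv xiF z = logDeriv (fun z => (2 * (z - 1 / 2)) * ((π : ℂ) ^ (-(1 / 2 + z) / 2) * (Gamma ((1 / 2 + z) / 2 + 1) * riemannZeta (1 / 2 + z)))) z := by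
    rw [logDeriv_apply, logDeriv_apply, hev.deriv_eq, hev.eq_of_nhds]
  have hz1 : z - 1 / 2 ≠ 0 := fun h => by
    have := congrArg re h; simp [hzre] at this; linarith
  have hpi : (π : ℂ) ≠ 0 := by exact_mod_cast Real.pi_ne_zero
  have hGre : 0 < ((1 / 2 + z) / 2 + 1).re := by simp [hzre]; linarith
  have hG0 := Gamma_ne_zero_of_re_pos hGre
  have hGd : DifferentiableAt ℂ Gamma ((1 / 2 + z) / 2 + 1) := differentiableAt_Gamma _ fun m h => by
    rw [h] at hGre; simp at hGre
    have h1 : (0 : ℝ) ≤ m := m.cast_nonneg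
    linarith
  have hs1 : s ≠ 1 := fun h => by rw [h] at hsre; simp at hsre; linarith
  have hzd : DifferentiableAt ℂ riemannZeta (1 / 2 + z) := differentiableAt_riemannZeta hs1
  have hz0 : riemannZeta (1 / 2 + z) ≠ 0 := riemannZeta_ne_zero_of_one_le_re (by rw [← hs, hsre]; linarith)
  have hP0 : (π : ℂ) ^ (-(1 / 2 + z) / 2) ≠ 0 := by rw [Ne, cpow_eq_zero_iff]; tauto
  have dG : DifferentiableAt ℂ (fun z => Gamma ((1 / 2 + z) / 2 + 1)) z :=
    DifferentiableAt.comp (g := Gamma) (f := fun z => (1 / 2 + z) / 2 + 1) z hGd (by fun_prop)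
  have dZ : DifferentiableAt ℂ (fun z => riemannZeta (1 / 2 + z)) z :=
    DifferentiableAt.comp (g := riemannZeta) (f := fun z => 1 / 2 + z) z hzd (by fun_prop)
  have dP : HasDerivAt (fun z => (π : ℂ) ^ (-(1 / 2 + z) / 2)) ((π : ℂ) ^ (-(1 / 2 + z) / 2) * log π * (-1 / 2)) z := by
    have h1 : HasDerivAt (fun z : ℂ => -(1 / 2 + z) / 2) (-1 / 2) z := by
      have := (((hasDerivAt_id z).const_add (1 / 2)).neg).div_const 2
      simpa using this
    exact h1.const_cpow (Or.inl hpi)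
  have m1 := logDeriv_mul (f := fun z => Gamma ((1 / 2 + z) / 2 + 1)) (g := fun z => riemannZeta (1 / 2 + z)) z hG0 hz0 dG dZ
  have m2 := logDeriv_mul (f := fun z => (π : ℂ) ^ (-(1 / 2 + z) / 2)) (g := fun z => Gamma ((1 / 2 + z) / 2 + 1) * riemannZeta (1 / 2 + z)) z hP0
    (mul_ne_zero hG0 hz0) dP.differentiableAt (dG.mul dZ)
  have m3 := logDeriv_mul (f := fun z : ℂ => 2 * (z - 1 / 2)) (g := fun z => (π : ℂ) ^ (-(1 / 2 + z) / 2) * (Gamma ((1 / 2 + z) / 2 + 1) * riemannZeta (1 / 2 + z))) z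
    (mul_ne_zero two_ne_zero hz1) (mul_ne_zero hP0 (mul_ne_zero hG0 hz0)) (by fun_prop) (dP.differentiableAt.mul (dG.mul dZ))
  rw [m3, m2, m1] at hld
  have l1 : logDeriv (fun z : ℂ => 2 * (z - 1 / 2)) z = 1 / (z - 1 / 2) := by
    have hd : HasDerivAt (fun z : ℂ => 2 * (z - 1 / 2)) (2 * 1) z := ((hasDerivAt_id z).sub_const _).const_mul 2
    rw [logDeriv_apply, hd.deriv]
    field_simp
  have l2 : logDeriv (fun z : ℂ => (π : ℂ) ^ (-(1 / 2 + z) / 2)) z = -((Real.log π / 2 : ℝ) : ℂ) := by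
    rw [logDeriv_apply, dP.deriv, mul_assoc, mul_div_cancel_left₀ _ hP0, ofReal_div, ofReal_log Real.pi_pos.le]; push_cast; ring
  have l3 : logDeriv (fun z => Gamma ((1 / 2 + z) / 2 + 1)) z = digamma ((1 / 2 + z) / 2 + 1) / 2 := by
    have := logDeriv_comp (f := Gamma) (g := fun z => (1 / 2 + z) / 2 + 1) (x := z) hGd (by fun_prop)
    have e : (Gamma ∘ fun z => (1 / 2 + z) / 2 + 1) = (fun z => Gamma ((1 / 2 + z) / 2 + 1)) := rfl
    rw [e] at this
    rw [this, digamma_def]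
    have h1 : HasDerivAt (fun z : ℂ => (1 / 2 + z) / 2 + 1) (1 / 2) z :=
      (((hasDerivAt_id z).const_add (1 / 2)).div_const 2).add_const 1
    rw [h1.deriv]; ring
  have l4 : logDeriv (fun z => riemannZeta (1 / 2 + z)) z = - LSeries (fun n => (ArithmeticFunction.vonMangoldt n : ℂ)) s := by
    have hL := ArithmeticFunction.LSeries_vonMangoldt_eq_deriv_riemannZeta_div (s := s) (by rw [hsre]; linarith)
    rw [hL, logDeriv_apply, deriv_comp_const_add]; ring
  have e1 : (1 / (z - 1 / 2)).re = (c - 1 / 2) / ((c - 1 / 2) ^ 2 + t ^ 2) := by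
    rw [one_div, inv_re, normSq_apply]; simp [hz]; ring
  rw [l1, l2, l3, l4] at hld
  rw [hld, (gamSum c t (by linarith)).tsum_eq]
  rw [add_re, add_re, add_re, e1, neg_re, ofReal_re, neg_re, div_ofNat_re, sub_re, kap, hs, hz]
  rw [show (1 / 2 + (c + t * I : ℂ)) = 1 / 2 + c + t * I by ring]
  ring

open Real (log exp cos sin sqrt)
open ArithmeticFunction (vonMangoldt)

lemma mLL {a b c : ℝ} (h : b ≤ c) (k : 0 ≤ a) : a * b ≤ a * c := mul_le_mul_of_nonneg_left h k

lemma mLR {a b c : ℝ} (h : b ≤ c) (k : 0 ≤ a) : b * a ≤ c * a := mul_le_mul_of_nonneg_right h k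

/-- Fourier kernel. -/
abbrev ek (t x : ℝ) : ℂ := Complex.exp (((t * x : ℝ) : ℂ) * Complex.I)

lemma ek_norm (t x : ℝ) : ‖ek t x‖ = 1 := Complex.norm_exp_ofReal_mul_I _

lemma ek_cont (t : ℝ) : Continuous (ek t) := by unfold ek; fun_prop

lemma ek_deriv (t x : ℝ) : HasDerivAt (ek t) (t * Complex.I * ek t x) x := by
  have h1 : HasDerivAt (fun x : ℝ => (((t * x : ℝ) : ℂ) * Complex.I)) (t * Complex.I) x := by
    have : HasDerivAt (fun x : ℝ => ((t * x : ℝ) : ℂ)) ((t * 1 : ℝ) : ℂ) x :=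
      ((hasDerivAt_id x).const_mul t).ofReal_comp
    simpa using this.mul_const Complex.I
  have := h1.cexp
  rw [mul_comm]; exact this

lemma ek_smooth (t : ℝ) : ContDiff ℝ 1 (ek t) := by
  unfold ek
  exact ((Complex.ofRealCLM.contDiff.comp (contDiff_const.mul contDiff_id)).mul contDiff_const).cexp

lemma ibpMain (u : ℝ → ℂ) (hu : ContDiff ℝ 1 u) (hc : HasCompactSupport u) (t : ℝ) :
    (∫ x in Set.Ioi 0, deriv u x * ek t x = -u 0 - t * Complex.I * ∫ x in Set.Ioi 0, u x * ek t x) ∧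
    (∫ x in Set.Iic 0, deriv u x * ek t x = u 0 - t * Complex.I * ∫ x in Set.Iic 0, u x * ek t x) := by
  have hd : deriv (fun x => u x * ek t x) = fun x => deriv u x * ek t x + t * Complex.I * (u x * ek t x) := by
    ext x
    have := ((hu.differentiable one_ne_zero x).hasDerivAt.mul (ek_deriv t x)).deriv
    rw [show (fun x => u x * ek t x) = u * ek t from rfl, this]; ring
  have hs : ContDiff ℝ 1 (fun x => u x * ek t x) := hu.mul (ek_smooth t)
  have hcs : HasCompactSupport (fun x => u x * ek t x) := hc.mul_right
  have i1 : Integrable (fun x => deriv u x * ek t x) :=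
    ((hu.continuous_deriv le_rfl).mul (ek_cont t)).integrable_of_hasCompactSupport hc.deriv.mul_right
  have i2 : Integrable (fun x => t * Complex.I * (u x * ek t x)) :=
    (hs.continuous.integrable_of_hasCompactSupport hcs).const_mul _
  have e1 := hcs.integral_Ioi_deriv_eq hs 0
  have e2 := hcs.integral_Iic_deriv_eq hs 0
  rw [hd, integral_add i1.integrableOn i2.integrableOn, integral_const_mul] at e1 e2
  have h0 : ek t 0 = 1 := by simp [ek]
  rw [h0, mul_one] at e1 e2
  exact ⟨by rw [← e1]; ring, by rw [← e2]; ring⟩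

lemma kBound (g : ℝ → ℂ) (hg : ContDiff ℝ 2 g) (hc : HasCompactSupport g) :
    ∃ C : ℝ, 0 < C ∧ ∀ t : ℝ, ‖∫ x, (exp |x| * g x : ℂ) * ek t x‖ ≤ C / (1 + t ^ 2) := by
  set u : ℝ → ℂ := fun x => exp x * g x with hu
  set v : ℝ → ℂ := fun x => exp (-x) * g x with hv
  have hus : ContDiff ℝ 2 u := (Complex.ofRealCLM.contDiff.comp Real.contDiff_exp).mul hg
  have hvs : ContDiff ℝ 2 v := (Complex.ofRealCLM.contDiff.comp (Real.contDiff_exp.comp contDiff_neg)).mul hg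
  have huc : HasCompactSupport u := hc.mul_left
  have hvc : HasCompactSupport v := hc.mul_left
  have hus1 : ContDiff ℝ 1 (deriv u) := hus.deriv' (n := 1)
  have hvs1 : ContDiff ℝ 1 (deriv v) := hvs.deriv' (n := 1)
  set h : ℝ → ℂ := fun x => exp |x| * g x with hh
  have hhc : Continuous h := by have := hg.continuous; fun_prop
  have hhs : HasCompactSupport h := hc.mul_left
  have hint : ∀ f : ℝ → ℂ, Continuous f → HasCompactSupport f → ∀ (t : ℝ) (s : Set ℝ), ‖∫ x in s, f x * ek t x‖ ≤ ∫ x, ‖f x‖ := by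
    intro f hf hfc t s
    refine (norm_integral_le_integral_norm _).trans ?_
    simp_rw [norm_mul, ek_norm, mul_one]
    exact setIntegral_le_integral (hf.integrable_of_hasCompactSupport hfc).norm (Eventually.of_forall fun x => norm_nonneg _)
  refine ⟨(∫ x, ‖h x‖) + (‖deriv u 0‖ + ‖deriv v 0‖ + (∫ x, ‖deriv (deriv u) x‖) + (∫ x, ‖deriv (deriv v) x‖)) + 1, by positivity, fun t => ?_⟩
  have hk : ∫ x, h x * ek t x = (∫ x in Set.Ioi 0, u x * ek t x) + ∫ x in Set.Iic 0, v x * ek t x := by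
    have hi : Integrable (fun x => h x * ek t x) :=
      (hhc.mul (ek_cont t)).integrable_of_hasCompactSupport hhs.mul_right
    have := integral_add_compl (μ := volume) (s := Set.Ioi (0:ℝ)) measurableSet_Ioi hi
    rw [← this, Set.compl_Ioi]
    congr 1
    · refine setIntegral_congr_fun measurableSet_Ioi fun x hx => ?_
      simp only [hh, hu, abs_of_pos hx.out]
    · refine setIntegral_congr_fun measurableSet_Iic fun x hx => ?_
      simp only [hh, hv, abs_of_nonpos hx.out]
  have a1 := (ibpMain u (hus.of_le (by norm_num)) huc t).1
  have a2 := (ibpMain (deriv u) hus1 huc.deriv t).1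
  have b1 := (ibpMain v (hvs.of_le (by norm_num)) hvc t).2
  have b2 := (ibpMain (deriv v) hvs1 hvc.deriv t).2
  have h0 : u 0 = v 0 := by simp [hu, hv]
  have key : (t : ℂ) ^ 2 * ∫ x, h x * ek t x = -(deriv u 0 - deriv v 0 + (∫ x in Set.Ioi 0, deriv (deriv u) x * ek t x) + ∫ x in Set.Iic 0, deriv (deriv v) x * ek t x) := by
    rw [hk, a2, b2, a1, b1, h0]
    linear_combination ((t:ℂ)^2 * ((∫ x in Set.Ioi 0, u x * ek t x) + ∫ x in Set.Iic 0, v x * ek t x)) * Complex.I_sq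
  have n1 : ‖∫ x, h x * ek t x‖ ≤ ∫ x, ‖h x‖ := by
    have := hint h hhc hhs t Set.univ; rwa [setIntegral_univ] at this
  have n2 : t ^ 2 * ‖∫ x, h x * ek t x‖ ≤ ‖deriv u 0‖ + ‖deriv v 0‖ + (∫ x, ‖deriv (deriv u) x‖) + (∫ x, ‖deriv (deriv v) x‖) := by
    have : ‖(t : ℂ) ^ 2 * ∫ x, h x * ek t x‖ = t ^ 2 * ‖∫ x, h x * ek t x‖ := by simp
    rw [← this, key, norm_neg]
    refine (norm_add_le _ _).trans (add_le_add ((norm_add_le _ _).trans (add_le_add (norm_sub_le _ _) ?_)) ?_)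
    · exact hint _ (hus1.continuous_deriv le_rfl) huc.deriv.deriv t _
    · exact hint _ (hvs1.continuous_deriv le_rfl) hvc.deriv.deriv t _
  rw [le_div_iff₀ (by positivity)]
  nlinarith

lemma fInv (h : ℝ → ℂ) (hh : Continuous h) (hi : Integrable h) (k : ℝ → ℂ)
    (hk : ∀ t, k t = ∫ x, h x * ek t x) (hki : Integrable k) (x : ℝ) :
    ∫ t, k t * ek (-t) x = 2 * π * h x := by
  have hp := Real.pi_pos
  have f1 : FourierTransformInv.fourierInv h = fun w => k (2 * π * w) := by
    ext w
    rw [Real.fourierInv_eq', hk]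
    refine integral_congr_ae (Eventually.of_forall fun v => ?_)
    simp only [smul_eq_mul, ek]
    rw [mul_comm]; congr 3; simp; ring
  have f2 : FourierTransform.fourier h = fun w => k (-(2 * π) * w) := by
    ext w
    rw [Real.fourier_real_eq_integral_exp_smul, hk]
    refine integral_congr_ae (Eventually.of_forall fun v => ?_)
    simp only [smul_eq_mul, ek]
    rw [mul_comm]; congr 3; ring
  have := congrFun (hh.fourier_fourierInv_eq hi (by rw [f2]; exact hki.comp_mul_left' (by linarith))) x
  rw [← this, f1, Real.fourier_real_eq_integral_exp_smul]
  have e := Measure.integral_comp_mul_left (fun t => k t * ek (-t) x) (2 * π)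
  have e2 : (∫ v : ℝ, Complex.exp (((-2 * π * v * x : ℝ):ℂ) * Complex.I) • k (2 * π * v)) = ∫ v : ℝ, k (2 * π * v) * ek (-(2 * π * v)) x := by
    refine integral_congr_ae (Eventually.of_forall fun v => ?_)
    simp only [smul_eq_mul, ek]
    rw [mul_comm]; congr 3; ring
  rw [e2, e, abs_of_pos (by positivity)]
  simp only [Complex.real_smul]
  push_cast
  have : (π : ℂ) ≠ 0 := by exact_mod_cast hp.ne'
  field_simp

lemma poissonFT (a : ℝ) (ha : 0 < a) (u : ℝ) :
    Integrable (fun x : ℝ => ((exp (-a * |x|) : ℝ) : ℂ)) ∧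
    ∫ x : ℝ, ((exp (-a * |x|) : ℝ) : ℂ) * ek u x = ((2 * (a / (a ^ 2 + u ^ 2)) : ℝ) : ℂ) := by
  have i0 : Integrable (fun x : ℝ => exp (-a * |x|)) := by
    rw [← integrableOn_univ, ← Set.Iic_union_Ioi (a := (0:ℝ))]
    refine IntegrableOn.union ?_ ?_
    · refine (integrableOn_exp_mul_Iic ha 0).congr_fun (fun x hx => ?_) measurableSet_Iic
      simp only [abs_of_nonpos hx.out]; congr 1; ring
    · refine (integrableOn_exp_mul_Ioi (neg_neg_of_pos ha) 0).congr_fun (fun x hx => ?_) measurableSet_Ioi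
      simp only [abs_of_pos hx.out]
  have i1 : Integrable (fun x : ℝ => ((exp (-a * |x|) : ℝ) : ℂ)) := i0.ofReal
  refine ⟨i1, ?_⟩
  have hi : Integrable (fun x : ℝ => ((exp (-a * |x|) : ℝ) : ℂ) * ek u x) :=
    i1.mul_bdd (c := 1) (ek_cont u).aestronglyMeasurable (Eventually.of_forall fun x => (ek_norm u x).le)
  rw [← integral_add_compl (μ := volume) (s := Set.Ioi (0:ℝ)) measurableSet_Ioi hi, Set.compl_Ioi]
  have e1 : ∫ x in Set.Ioi (0:ℝ), ((exp (-a * |x|) : ℝ) : ℂ) * ek u x = ∫ x : ℝ in Set.Ioi (0:ℝ), Complex.exp ((-a + u * Complex.I) * x) := by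
    refine setIntegral_congr_fun measurableSet_Ioi fun x hx => ?_
    simp only [abs_of_pos hx.out, ek]
    rw [Complex.ofReal_exp, ← Complex.exp_add]; congr 1; push_cast; ring
  have e2 : ∫ x in Set.Iic (0:ℝ), ((exp (-a * |x|) : ℝ) : ℂ) * ek u x = ∫ x : ℝ in Set.Iic (0:ℝ), Complex.exp ((a + u * Complex.I) * x) := by
    refine setIntegral_congr_fun measurableSet_Iic fun x hx => ?_
    simp only [abs_of_nonpos hx.out, ek]
    rw [Complex.ofReal_exp, ← Complex.exp_add]; congr 1; push_cast; ring
  rw [e1, e2, integral_exp_mul_complex_Ioi (by simpa using ha), integral_exp_mul_complex_Iic (by simpa using ha)]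
  have h1 : (-a + u * Complex.I : ℂ) ≠ 0 := fun h => by
    have := congrArg Complex.re h; simp at this; linarith
  have h2 : (a + u * Complex.I : ℂ) ≠ 0 := fun h => by
    have := congrArg Complex.re h; simp at this; linarith
  have h3 : ((a : ℂ) ^ 2 + u ^ 2) ≠ 0 := by
    exact_mod_cast (show a ^ 2 + u ^ 2 ≠ 0 by positivity)
  simp only [Complex.ofReal_zero, mul_zero, Complex.exp_zero]
  push_cast
  have h4 : (a + u * Complex.I : ℂ) * (-a + u * Complex.I) = -((a : ℂ) ^ 2 + u ^ 2) := by
    linear_combination (u:ℂ)^2 * Complex.I_sq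
  field_simp
  linear_combination (-2 * (a:ℂ)) * h4

lemma kPoisson (h : ℝ → ℂ) (hh : Continuous h) (hi : Integrable h) (k : ℝ → ℂ) 
    (hk : ∀ t, k t = ∫ x, h x * ek t x) (hki : Integrable k) (a : ℝ) (ha : 0 < a) (γ : ℝ) :
    ∫ t, k t * ((a / (a ^ 2 + (t - γ) ^ 2) : ℝ) : ℂ) = π * ∫ x, ((exp (-a * |x|) : ℝ) : ℂ) * (h x * ek γ x) := by
  have e1 : ∀ t, k t * ((a / (a ^ 2 + (t - γ) ^ 2) : ℝ) : ℂ) = (1 / 2) * ∫ x : ℝ, k t * (((exp (-a * |x|) : ℝ) : ℂ) * ek (γ - t) x) := by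
    intro t
    rw [integral_const_mul, (poissonFT a ha (γ - t)).2, show (γ - t) ^ 2 = (t - γ) ^ 2 by ring]; push_cast; ring
  simp_rw [e1]
  rw [integral_const_mul, integral_integral_swap]
  · have e2 : ∀ x : ℝ, ∫ t, k t * (((exp (-a * |x|) : ℝ) : ℂ) * ek (γ - t) x) = (2 * π) * (((exp (-a * |x|) : ℝ) : ℂ) * (h x * ek γ x)) := by
      intro x
      have : ∀ t, k t * (((exp (-a * |x|) : ℝ) : ℂ) * ek (γ - t) x) = (((exp (-a * |x|) : ℝ) : ℂ) * ek γ x) * (k t * ek (-t) x) := by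
        intro t
        have : ek (γ - t) x = ek γ x * ek (-t) x := by
          rw [ek, ek, ek, ← Complex.exp_add]; congr 1; push_cast; ring
        rw [this]; ring
      simp_rw [this]
      rw [integral_const_mul, fInv h hh hi k hk hki]; ring
    simp_rw [e2]
    rw [integral_const_mul]; ring
  · have := (hki.mul_prod (poissonFT a ha 0).1).mul_bdd (c := 1) (g := fun z : ℝ × ℝ => ek (γ - z.1) z.2)
      (by unfold ek; apply Continuous.aestronglyMeasurable; fun_prop) (Eventually.of_forall fun x => (ek_norm _ _).le)
    refine this.congr (Eventually.of_forall fun z => ?_)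
    simp only [Function.uncurry]; ring

lemma gamTermBound (k : ℕ) (t : ℝ) :
    0 ≤ 1 / (2 * k + 2 : ℝ) - (2 * k + 5 / 2 + 1) / ((2 * k + 5 / 2 + 1) ^ 2 + t ^ 2) ∧
    1 / (2 * k + 2 : ℝ) - (2 * k + 5 / 2 + 1) / ((2 * k + 5 / 2 + 1) ^ 2 + t ^ 2) ≤
      (1 + t ^ 2) ^ (1 / 4 : ℝ) * (2 * (1 / ((k:ℝ) + 1) ^ (5 / 4 : ℝ))) := by
  have hk : (0:ℝ) ≤ k := k.cast_nonneg
  set b : ℝ := 2 * k + 5 / 2 + 1 with hb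
  set X : ℝ := (3 / 2 * b + t ^ 2) / (b ^ 2 + t ^ 2) with hX
  have hb0 : 7 / 2 ≤ b := by rw [hb]; linarith
  have e : 1 / (2 * k + 2 : ℝ) - b / (b ^ 2 + t ^ 2) = X / (2 * k + 2) := by
    rw [hX]
    have : b ^ 2 + t ^ 2 ≠ 0 := by positivity
    have h2 : (2 * (k:ℝ) + 2) ≠ 0 := by positivity
    field_simp; rw [hb]; ring
  have hX0 : 0 ≤ X := by positivity
  have hX1 : X ≤ 1 := by rw [hX, div_le_one (by positivity)]; nlinarith
  have hX2 : X ≤ 2 * (1 + t ^ 2) / (k + 1) := by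
    rw [hX, div_le_div_iff₀ (by positivity) (by positivity)]
    have h1 : (3 / 2 * b + t ^ 2) * (k + 1) ≤ (3 / 2 * b + t ^ 2) * b := by gcongr; rw [hb]; linarith
    nlinarith [mul_nonneg (sq_nonneg t) (sq_nonneg t), mul_nonneg (sq_nonneg t) (show 0 ≤ b * (b - 1) by nlinarith), sq_nonneg b]
  have hX4 : X ≤ X ^ (1 / 4 : ℝ) := by
    rcases hX0.eq_or_lt with h | h
    · rw [← h]; positivity
    · calc X = X ^ (1:ℝ) := (Real.rpow_one X).symm
        _ ≤ _ := Real.rpow_le_rpow_of_exponent_ge h hX1 (by norm_num)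
  have h3 : X ^ (1 / 4 : ℝ) ≤ 2 * (1 + t ^ 2) ^ (1 / 4 : ℝ) / ((k:ℝ) + 1) ^ (1 / 4 : ℝ) := by
    refine (Real.rpow_le_rpow hX0 hX2 (by norm_num)).trans ?_
    rw [Real.div_rpow (by positivity) (by positivity), Real.mul_rpow (by positivity) (by positivity)]
    gcongr
    calc (2:ℝ) ^ (1 / 4 : ℝ) ≤ 2 ^ (1:ℝ) := Real.rpow_le_rpow_of_exponent_le (by norm_num) (by norm_num)
      _ = 2 := Real.rpow_one 2
  rw [e]
  refine ⟨by positivity, ?_⟩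
  have h5 : ((k:ℝ) + 1) ^ (5 / 4 : ℝ) = (k + 1) ^ (1 / 4 : ℝ) * (k + 1) := by
    rw [show (5 / 4 : ℝ) = 1 / 4 + 1 by norm_num, Real.rpow_add_one (by positivity)]
  rw [h5]
  calc X / (2 * k + 2) ≤ (2 * (1 + t ^ 2) ^ (1 / 4 : ℝ) / ((k:ℝ) + 1) ^ (1 / 4 : ℝ)) / (k + 1) := by
        refine div_le_div₀ (by positivity) (hX4.trans h3) (by positivity) (by linarith)
    _ = _ := by field_simp

lemma gamSer : Summable (fun k : ℕ => 2 * (1 / ((k:ℝ) + 1) ^ (5 / 4 : ℝ))) := by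
  have := (summable_nat_add_iff 1).2 (Real.summable_one_div_nat_rpow (p := 5 / 4).2 (by norm_num))
  simpa using this.mul_left 2

lemma vmSer (t : ℝ) : HasSum (fun n : ℕ => vonMangoldt n * (n : ℝ) ^ (-(3 / 2) : ℝ) * cos (t * log n))
    (LSeries (fun n => (vonMangoldt n : ℂ)) (1 / 2 + (1:ℝ) + t * Complex.I)).re := by
  have hs : 1 < (1 / 2 + (1:ℝ) + t * Complex.I : ℂ).re := by norm_num
  have h := ArithmeticFunction.LSeriesSummable_vonMangoldt hs
  have h2 := Complex.hasSum_re h.hasSum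
  refine h2.congr_fun fun n => ?_
  rcases Nat.eq_zero_or_pos n with rfl | hn
  · simp
  · rw [LSeries.term_of_ne_zero hn.ne']
    have hn0 : (0:ℝ) < n := by exact_mod_cast hn
    rw [div_eq_mul_inv (_ : ℂ), ← Complex.cpow_neg, Complex.re_ofReal_mul, mul_assoc]
    congr 1
    rw [← Complex.ofReal_natCast, Complex.cpow_def_of_ne_zero (by exact_mod_cast hn0.ne'), ← Complex.ofReal_log hn0.le, Real.rpow_def_of_pos hn0,
      show ((log n : ℝ) : ℂ) * -(1 / 2 + (1:ℝ) + t * Complex.I) = ((log n * -(3 / 2) : ℝ) : ℂ) + ((-(t * log n) : ℝ) : ℂ) * Complex.I by push_cast; ring,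
      Complex.exp_add, ← Complex.ofReal_exp, Complex.re_ofReal_mul, Complex.exp_ofReal_mul_I_re, Real.cos_neg]

lemma vmSer0 : Summable (fun n : ℕ => vonMangoldt n * (n : ℝ) ^ (-(3 / 2) : ℝ)) := by
  have := (vmSer 0).summable
  simpa using this

lemma logDeriv_cont (hRH : RiemannHypothesis) : Continuous (fun t : ℝ => (logDeriv xiF ((1:ℝ) + t * Complex.I)).re) := by
  have h0 : ∀ t : ℝ, xiF ((1:ℝ) + t * Complex.I) ≠ 0 := fun t h => by
    have := xiF_zero_re hRH _ h; simp at this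
  have hc : Continuous (fun t : ℝ => (((1:ℝ):ℂ) + t * Complex.I)) := by fun_prop
  have hd : Continuous (deriv xiF) := (xiF_diff.contDiff (n := 1)).continuous_deriv le_rfl
  refine Complex.continuous_re.comp ?_
  simp_rw [logDeriv_apply]
  exact (hd.comp hc).div (xiF_diff.continuous.comp hc) h0

lemma ordsCountable : {γ : ℝ | riemannZeta (1 / 2 + γ * Complex.I) = 0}.Countable := by
  refine (Set.countable_iUnion fun n : ℕ => (ordsFinite n).countable).mono fun γ hγ => ?_
  obtain ⟨n, hn⟩ := exists_nat_ge |γ|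
  exact Set.mem_iUnion.2 ⟨n, hn, hγ⟩

lemma EF (hRH : RiemannHypothesis) (g : ℝ → ℂ) (hg : ContDiff ℝ 2 g) (hc : HasCompactSupport g) :
    ∃ G P : ℂ, HasSum (fun k : ℕ => g 0 / (k + 1) - ∫ x, ((exp (-(2 * k + 5 / 2) * |x|) : ℝ) : ℂ) * g x) G ∧
    HasSum (fun n : ℕ => ((vonMangoldt n / sqrt n : ℝ) : ℂ) * (g (log n) + g (-log n))) P ∧
    HasSum (fun γ : ℝ => (ordMult γ : ℂ) * ∫ x, g x * ek γ x)
      ((∫ x, ((exp (|x| / 2) : ℝ) : ℂ) * g x) + 2 * kap * g 0 + G - P) := by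
  obtain ⟨C, hC, hkb⟩ := kBound g hg hc
  set h : ℝ → ℂ := fun x => exp |x| * g x with hh
  set k : ℝ → ℂ := fun t => ∫ x, h x * ek t x with hk
  have hhc : Continuous h := by have := hg.continuous; fun_prop
  have hhs : HasCompactSupport h := hc.mul_left
  have hhi : Integrable h := hhc.integrable_of_hasCompactSupport hhs
  have hkc : Continuous k := by
    refine continuous_of_dominated (bound := fun x => ‖h x‖) ?_ ?_ hhi.norm ?_
    · intro t; exact (hhc.mul (ek_cont t)).aestronglyMeasurable
    · intro t; exact Eventually.of_forall fun x => by rw [norm_mul, ek_norm, mul_one]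
    · refine Eventually.of_forall fun x => ?_
      unfold ek; fun_prop
  have hmeas : ∀ f : ℝ → ℂ, Continuous f → AEStronglyMeasurable (fun t => k t * f t) volume := fun f hf =>
    (hkc.mul hf).aestronglyMeasurable
  have i34 : Integrable (fun t : ℝ => C * ((1:ℝ) + t ^ 2) ^ (-3 / 4 : ℝ)) := by
    have := integrable_rpow_neg_one_add_norm_sq (E := ℝ) (μ := volume) (r := 3 / 2) (by norm_num)
    refine Integrable.const_mul ?_ C
    refine this.congr (Eventually.of_forall fun t => ?_)
    simp only [Real.norm_eq_abs, sq_abs]; norm_num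
  have iq : Integrable (fun t : ℝ => ‖k t‖ * (1 + t ^ 2) ^ (1 / 4 : ℝ)) := by
    refine i34.mono' (hkc.norm.mul ?_).aestronglyMeasurable (Eventually.of_forall fun t => ?_)
    · exact (by fun_prop : Continuous fun t : ℝ => 1 + t ^ 2).rpow_const fun t => Or.inr (by norm_num)
    · have h1 : (0:ℝ) < 1 + t ^ 2 := by positivity
      rw [norm_mul, norm_norm, Real.norm_of_nonneg (by positivity)]
      calc ‖k t‖ * (1 + t ^ 2) ^ (1 / 4 : ℝ) ≤ C / (1 + t ^ 2) * (1 + t ^ 2) ^ (1 / 4 : ℝ) := by gcongr; exact hkb t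
        _ = C * (1 + t ^ 2) ^ (-3 / 4 : ℝ) := by
          rw [show (-3 / 4 : ℝ) = 1 / 4 - 1 by norm_num, Real.rpow_sub_one h1.ne']; ring
  have hki : Integrable k := by
    refine iq.mono' hkc.aestronglyMeasurable (Eventually.of_forall fun t => ?_)
    exact le_mul_of_one_le_right (norm_nonneg _) (Real.one_le_rpow (by nlinarith [sq_nonneg t]) (by norm_num))
  have hpi : (π : ℂ) ≠ 0 := by exact_mod_cast Real.pi_ne_zero
  have hP := kPoisson h hhc hhi k (fun t => rfl) hki
  have hI := fInv h hhc hhi k (fun t => rfl) hki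
  have hk0 : ∫ t, k t = 2 * π * g 0 := by
    have := hI 0
    simpa [ek, hh] using this
  have hPc : ∀ a : ℝ, 0 < a → ∀ γ : ℝ, Continuous (fun t : ℝ => ((a / (a ^ 2 + (t - γ) ^ 2) : ℝ) : ℂ)) := by
    intro a ha γ
    refine Complex.continuous_ofReal.comp (Continuous.div (by fun_prop) (by fun_prop) fun t => by positivity)
  have hPi : ∀ a : ℝ, 0 < a → Integrable (fun t : ℝ => k t * ((a / (a ^ 2 + t ^ 2) : ℝ) : ℂ)) := by
    intro a ha
    refine hki.mul_bdd (c := 1 / a) (by simpa using (hPc a ha 0).aestronglyMeasurable) (Eventually.of_forall fun t => ?_)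
    rw [Complex.norm_real, Real.norm_of_nonneg (by positivity), div_le_div_iff₀ (by positivity) ha]
    nlinarith [sq_nonneg t]
  -- gamma
  set Gk : ℕ → ℝ → ℝ := fun j t => 1 / (2 * j + 2 : ℝ) - (2 * j + 5 / 2 + 1) / ((2 * j + 5 / 2 + 1) ^ 2 + t ^ 2) with hGk
  set Gs : ℝ → ℝ := fun t => ∑' j, Gk j t with hGs
  have gs : ∀ t, Summable (fun j => Gk j t) := fun t =>
    Summable.of_nonneg_of_le (fun j => (gamTermBound j t).1) (fun j => (gamTermBound j t).2) (gamSer.mul_left _)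
  have hGkc : ∀ j, Continuous (Gk j) := fun j => by
    refine continuous_const.sub (Continuous.div (by fun_prop) (by fun_prop) fun t => by positivity)
  have hG : HasSum (fun j => ∫ t, k t * (Gk j t : ℂ)) (∫ t, k t * (Gs t : ℂ)) := by
    refine hasSum_integral_of_dominated_convergence (fun j t => ‖k t‖ * ((1 + t ^ 2) ^ (1 / 4 : ℝ) * (2 * (1 / ((j:ℝ) + 1) ^ (5 / 4 : ℝ)))))
      (fun j => hmeas _ (Complex.continuous_ofReal.comp (hGkc j))) (fun j => Eventually.of_forall fun t => ?_)
      (Eventually.of_forall fun t => (gamSer.mul_left _).mul_left _) ?_ (Eventually.of_forall fun t => ?_)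
    · rw [norm_mul, Complex.norm_real, Real.norm_of_nonneg (gamTermBound j t).1]
      exact mLL (gamTermBound j t).2 (norm_nonneg _)
    · refine (iq.mul_const (∑' j : ℕ, (2 * (1 / ((j:ℝ) + 1) ^ (5 / 4 : ℝ))))).congr (Eventually.of_forall fun t => ?_)
      simp only
      rw [tsum_mul_left (f := fun j : ℕ => (1 + t ^ 2) ^ (1 / 4 : ℝ) * (2 * (1 / ((j:ℝ) + 1) ^ (5 / 4 : ℝ)))), tsum_mul_left (f := fun j : ℕ => 2 * (1 / ((j:ℝ) + 1) ^ (5 / 4 : ℝ))), mul_assoc]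
    · exact (Complex.hasSum_ofReal.2 (gs t).hasSum).mul_left _
  have hGsb : ∀ t, 0 ≤ Gs t ∧ Gs t ≤ (1 + t ^ 2) ^ (1 / 4 : ℝ) * ∑' j : ℕ, (2 * (1 / ((j:ℝ) + 1) ^ (5 / 4 : ℝ))) := fun t =>
    ⟨tsum_nonneg fun j => (gamTermBound j t).1, by
      rw [← tsum_mul_left]; exact (gs t).tsum_le_tsum (fun j => (gamTermBound j t).2) (gamSer.mul_left _)⟩
  -- primes
  set Ls : ℝ → ℝ := fun t => (LSeries (fun n => (vonMangoldt n : ℂ)) (1 / 2 + (1:ℝ) + t * Complex.I)).re with hLs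
  have hL : HasSum (fun n : ℕ => ∫ t, k t * ((vonMangoldt n * (n : ℝ) ^ (-(3 / 2) : ℝ) * cos (t * log n) : ℝ) : ℂ)) (∫ t, k t * (Ls t : ℂ)) := by
    refine hasSum_integral_of_dominated_convergence (fun n t => ‖k t‖ * (vonMangoldt n * (n : ℝ) ^ (-(3 / 2) : ℝ)))
      (fun n => hmeas _ (by fun_prop)) (fun n => Eventually.of_forall fun t => ?_)
      (Eventually.of_forall fun t => vmSer0.mul_left _) ?_ (Eventually.of_forall fun t => ?_)
    · have h1 : 0 ≤ vonMangoldt n * (n : ℝ) ^ (-(3 / 2) : ℝ) :=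
        mul_nonneg ArithmeticFunction.vonMangoldt_nonneg (by positivity)
      rw [norm_mul, Complex.norm_real, norm_mul, Real.norm_of_nonneg h1, Real.norm_eq_abs]
      exact mLL (mul_le_of_le_one_right h1 (Real.abs_cos_le_one _)) (norm_nonneg _)
    · simp_rw [tsum_mul_left]; exact hki.norm.mul_const _
    · exact (Complex.hasSum_ofReal.2 (vmSer t)).mul_left _
  have hLsb : ∀ t, |Ls t| ≤ ∑' n : ℕ, vonMangoldt n * (n : ℝ) ^ (-(3 / 2) : ℝ) := by
    intro t
    rw [← Real.norm_eq_abs, show Ls t = _ from (vmSer t).tsum_eq.symm]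
    refine tsum_of_norm_bounded vmSer0.hasSum fun n => ?_
    have h1 : 0 ≤ vonMangoldt n * (n : ℝ) ^ (-(3 / 2) : ℝ) :=
        mul_nonneg ArithmeticFunction.vonMangoldt_nonneg (by positivity)
    rw [norm_mul, Real.norm_of_nonneg h1, Real.norm_eq_abs]
    exact mul_le_of_le_one_right h1 (Real.abs_cos_le_one _)
  -- zeros
  set H : ℝ → ℝ := fun t => (logDeriv xiF ((1:ℝ) + t * Complex.I)).re with hH
  have hHc : Continuous H := logDeriv_cont hRH
  have hHe : ∀ t, H t = (1 - 1 / 2) / ((1 - 1 / 2) ^ 2 + t ^ 2) + kap + Gs t - Ls t := fun t =>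
    xiF_logDeriv 1 t (by norm_num)
  have hms : Measurable (fun t => Gs t - Ls t) := by
    have : (fun t => Gs t - Ls t) = fun t => H t - (1 - 1 / 2) / ((1 - 1 / 2) ^ 2 + t ^ 2) - kap := by
      ext t; rw [hHe]; ring
    rw [this]; exact (hHc.measurable.sub (by fun_prop)).sub_const _
  set B1 := ∑' j : ℕ, (2 * (1 / ((j:ℝ) + 1) ^ (5 / 4 : ℝ)))
  set B2 := ∑' n : ℕ, vonMangoldt n * (n : ℝ) ^ (-(3 / 2) : ℝ)
  have hHi : Integrable (fun t => k t * (H t : ℂ)) := by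
    refine ((iq.mul_const B1).add (hki.norm.mul_const (2 + |kap| + B2))).mono' (hmeas _ (Complex.continuous_ofReal.comp hHc)) (Eventually.of_forall fun t => ?_)
    rw [norm_mul, Complex.norm_real, Real.norm_eq_abs]
    have hb : |H t| ≤ (1 + t ^ 2) ^ (1 / 4 : ℝ) * B1 + (2 + |kap| + B2) := by
      have h1 : 0 ≤ (1 - 1 / 2) / ((1 - 1 / 2) ^ 2 + t ^ 2 : ℝ) ∧ (1 - 1 / 2) / ((1 - 1 / 2) ^ 2 + t ^ 2 : ℝ) ≤ 2 :=
        ⟨by norm_num; positivity, by rw [div_le_iff₀ (by norm_num; positivity)]; nlinarith [sq_nonneg t]⟩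
      have h2 := hGsb t
      have h3 := abs_le.1 (hLsb t)
      have h4 := abs_le.1 (le_refl |kap|)
      rw [hHe, abs_le]
      constructor <;> linarith [h1.1, h1.2, h2.1, h2.2, h3.1, h3.2, h4.1, h4.2]
    calc _ ≤ ‖k t‖ * ((1 + t ^ 2) ^ (1 / 4 : ℝ) * B1 + (2 + |kap| + B2)) := by gcongr
      _ = _ := by simp only [Pi.add_apply]; ring
  have hLc : Continuous Ls := by
    have : Ls = fun t => ∑' n : ℕ, vonMangoldt n * (n : ℝ) ^ (-(3 / 2) : ℝ) * cos (t * log n) := by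
      ext t; exact (vmSer t).tsum_eq.symm
    rw [this]
    refine continuous_tsum (fun n => by fun_prop) vmSer0 fun n t => ?_
    have h1 : 0 ≤ vonMangoldt n * (n : ℝ) ^ (-(3 / 2) : ℝ) :=
        mul_nonneg ArithmeticFunction.vonMangoldt_nonneg (by positivity)
    rw [norm_mul, Real.norm_of_nonneg h1, Real.norm_eq_abs]
    exact mul_le_of_le_one_right h1 (Real.abs_cos_le_one _)
  have hLi : Integrable (fun t => k t * (Ls t : ℂ)) := 
    hki.mul_bdd (c := B2) (Complex.continuous_ofReal.comp hLc).aestronglyMeasurable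
      (Eventually.of_forall fun t => by simpa using hLsb t)
  set Z := {γ : ℝ | riemannZeta (1 / 2 + γ * Complex.I) = 0} with hZ
  have hcnt : Countable Z := ordsCountable.to_subtype
  have hZsupp : ∀ f : ℝ → ℂ, Function.support (fun γ : ℝ => (ordMult γ : ℂ) * f γ) ⊆ Z := by
    intro f γ hγ
    by_contra hn
    have h0 : ordMult γ = 0 := (xiF_order γ).2.2.2 hn
    exact hγ (by simp [h0])
  have hPS : ∀ t, HasSum (fun γ : Z => (ordMult γ:ℝ) * (1 / (1 ^ 2 + (t - γ) ^ 2))) (H t) := by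
    intro t
    have := poissonSum hRH 1 t one_pos
    refine (hasSum_subtype_iff_of_support_subset (f := fun γ : ℝ => (ordMult γ:ℝ) * (1 / (1 ^ 2 + (t - γ) ^ 2))) ?_).2 this
    intro γ hγ
    by_contra hn
    have h0 : ordMult γ = 0 := (xiF_order γ).2.2.2 hn
    exact hγ (by simp [h0])
  have hz : HasSum (fun γ : Z => ∫ t, k t * (((ordMult γ:ℝ) * (1 / (1 ^ 2 + (t - γ) ^ 2)) : ℝ) : ℂ)) (∫ t, k t * (H t : ℂ)) := by
    refine hasSum_integral_of_dominated_convergence (fun γ t => ‖k t‖ * ((ordMult γ:ℝ) * (1 / (1 ^ 2 + (t - γ) ^ 2))))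
      (fun γ => hmeas _ ?_) (fun γ => Eventually.of_forall fun t => ?_)
      (Eventually.of_forall fun t => (hPS t).summable.mul_left _) ?_ (Eventually.of_forall fun t => ?_)
    · have := hPc 1 one_pos γ
      simp_rw [Complex.ofReal_mul]
      exact continuous_const.mul this
    · rw [norm_mul, Complex.norm_real, Real.norm_of_nonneg (by positivity)]
    · simp_rw [tsum_mul_left, (hPS _).tsum_eq]
      refine hHi.norm.congr (Eventually.of_forall fun t => ?_)
      have : 0 ≤ H t := (hPS t).nonneg fun γ => by positivity
      simp only [norm_mul, Complex.norm_real, Real.norm_of_nonneg this]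
    · exact (Complex.hasSum_ofReal.2 (hPS t)).mul_left _
  have hz2 : HasSum (fun γ : ℝ => (ordMult γ : ℂ) * ∫ x, g x * ek γ x) ((∫ t, k t * (H t : ℂ)) / π) := by
    rw [← hasSum_subtype_iff_of_support_subset (hZsupp _)]
    refine (hz.div_const (π:ℂ)).congr_fun fun γ => ?_
    have e := hP 1 one_pos γ
    have e1 : ∀ t, k t * (((ordMult γ:ℝ) * (1 / (1 ^ 2 + (t - γ) ^ 2)) : ℝ) : ℂ) = (ordMult γ : ℂ) * (k t * ((1 / (1 ^ 2 + (t - γ) ^ 2) : ℝ) : ℂ)) := by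
      intro t; push_cast; ring
    simp_rw [e1]
    rw [integral_const_mul, e]
    simp only [Function.comp]
    have e3 : ∀ x, ((exp (-1 * |x|) : ℝ) : ℂ) * (h x * ek γ x) = g x * ek γ x := by
      intro x
      rw [hh, ← mul_assoc, ← mul_assoc, ← Complex.ofReal_mul, ← Real.exp_add]; simp
    simp_rw [e3]; field_simp
  have eexp : ∀ a : ℝ, ∀ x, ((exp (-a * |x|) : ℝ) : ℂ) * (h x * ek 0 x) = ((exp (-(a - 1) * |x|) : ℝ) : ℂ) * g x := by
    intro a x
    rw [hh]; simp only [ek, zero_mul, Complex.ofReal_zero, Complex.exp_zero, mul_one]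
    rw [← mul_assoc, ← Complex.ofReal_mul, ← Real.exp_add]; congr 4; ring
  have hGsi : Integrable (fun t => k t * (Gs t : ℂ)) := by
    refine (((hHi.sub (hPi (1 - 1 / 2) (by norm_num))).sub (hki.mul_const (kap:ℂ))).add hLi).congr (Eventually.of_forall fun t => ?_)
    simp only [Pi.add_apply, Pi.sub_apply, hHe]; push_cast; ring
  refine ⟨(∫ t, k t * (Gs t : ℂ)) / π, (∫ t, k t * (Ls t : ℂ)) / π, ?_, ?_, ?_⟩
  · refine (hG.div_const (π:ℂ)).congr_fun fun j => ?_
    have e1 : ∀ t, k t * (Gk j t : ℂ) = k t * ((1 / (2 * j + 2 : ℝ) : ℝ) : ℂ) - k t * (((2 * j + 5 / 2 + 1) / ((2 * j + 5 / 2 + 1) ^ 2 + t ^ 2) : ℝ) : ℂ) := by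
      intro t; rw [hGk]; push_cast; ring
    have e := hP (2 * j + 5 / 2 + 1) (by positivity) 0
    simp_rw [sub_zero, eexp] at e
    simp_rw [e1]
    rw [integral_sub (hki.mul_const _) (hPi _ (by positivity)), integral_mul_const, hk0, e]
    have hj : (2 * (j:ℂ) + 2) ≠ 0 := by exact_mod_cast (show 2 * j + 2 ≠ 0 by omega)
    have hj' : ((j:ℂ) + 1) ≠ 0 := by exact_mod_cast (show j + 1 ≠ 0 by omega)
    rw [show (2 * (j:ℝ) + 5 / 2 + 1 - 1) = 2 * j + 5 / 2 by ring]
    push_cast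
    field_simp
  · refine (hL.div_const (π:ℂ)).congr_fun fun n => ?_
    rcases Nat.eq_zero_or_pos n with rfl | hn
    · simp
    have hn0 : (0:ℝ) < n := by exact_mod_cast hn
    set x := log n with hx
    have hx0 : 0 ≤ x := Real.log_nonneg (by exact_mod_cast hn)
    have e1 : ∀ t, k t * ((vonMangoldt n * (n : ℝ) ^ (-(3 / 2) : ℝ) * cos (t * x) : ℝ) : ℂ)
        = ((vonMangoldt n * (n : ℝ) ^ (-(3 / 2) : ℝ) / 2 : ℝ) : ℂ) * (k t * ek (-t) x + k t * ek (-t) (-x)) := by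
      intro t
      have : ((cos (t * x) : ℝ) : ℂ) = (ek (-t) x + ek (-t) (-x)) / 2 := by
        rw [Complex.ofReal_cos, Complex.cos, add_comm, ek, ek]; congr 3 <;> push_cast <;> ring
      rw [Complex.ofReal_mul _ (cos _), this]; push_cast; ring
    have hie : ∀ y, Integrable (fun t => k t * ek (-t) y) := fun y =>
      hki.mul_bdd (c := 1) (by unfold ek; apply Continuous.aestronglyMeasurable; fun_prop) (Eventually.of_forall fun x => (ek_norm _ _).le)
    simp_rw [e1]
    rw [integral_const_mul, integral_add (hie _) (hie _), hI, hI, hh]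
    simp only [abs_neg, abs_of_nonneg hx0]
    rw [hx, Real.exp_log hn0]
    have h32 : (n:ℝ) ^ (-(3 / 2) : ℝ) = 1 / (n * sqrt n) := by
      rw [Real.rpow_neg hn0.le, show (3 / 2 : ℝ) = 1 + 1 / 2 by norm_num, Real.rpow_add hn0, Real.rpow_one, ← Real.sqrt_eq_rpow, one_div]
    rw [h32]
    have h1 : (n:ℂ) ≠ 0 := by exact_mod_cast hn.ne'
    have h2 : ((sqrt n : ℝ) : ℂ) ≠ 0 := by exact_mod_cast (Real.sqrt_pos.2 hn0).ne'
    push_cast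
    field_simp
  · convert hz2 using 1
    have e1 : ∀ t, k t * (H t : ℂ) = k t * (((1 - 1 / 2) / ((1 - 1 / 2) ^ 2 + t ^ 2) : ℝ) : ℂ) + k t * (kap : ℂ) + k t * (Gs t : ℂ) - k t * (Ls t : ℂ) := by
      intro t; rw [hHe]; push_cast; ring
    have i1 := hPi (1 - 1 / 2) (by norm_num)
    have i2 := hki.mul_const (kap : ℂ)
    have i12 : Integrable (fun t => k t * (((1 - 1 / 2) / ((1 - 1 / 2) ^ 2 + t ^ 2) : ℝ) : ℂ) + k t * (kap : ℂ)) := i1.add i2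
    have i3 : Integrable (fun t => k t * (((1 - 1 / 2) / ((1 - 1 / 2) ^ 2 + t ^ 2) : ℝ) : ℂ) + k t * (kap : ℂ) + k t * (Gs t : ℂ)) := i12.add hGsi
    simp_rw [e1]
    rw [integral_sub i3 hLi, integral_add i12 hGsi, integral_add i1 i2, integral_mul_const, hk0]
    have e := hP (1 - 1 / 2) (by norm_num) 0
    simp_rw [sub_zero, eexp] at e
    rw [e]
    have : ∀ x : ℝ, (-(1 - 1 / 2 - 1) * |x| : ℝ) = |x| / 2 := fun x => by ring
    simp_rw [this]
    field_simp

/-- Smooth even nonnegative compactly supported kernels. -/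
def GoodK (r : ℝ) (f : ℝ → ℝ) : Prop :=
  ContDiff ℝ 2 f ∧ (∀ x, 0 ≤ f x) ∧ (∀ x, f (-x) = f x) ∧ (∀ x, r ≤ |x| → f x = 0)

lemma GoodK.supp {r : ℝ} {f : ℝ → ℝ} (h : GoodK r f) : HasCompactSupport f :=
  HasCompactSupport.intro (isCompact_Icc (a := -r) (b := r)) fun x hx => h.2.2.2 x (by
    by_contra hn
    exact hx (abs_le.1 (not_le.1 hn).le))

lemma GoodK.int {r : ℝ} {f : ℝ → ℝ} (h : GoodK r f) : Integrable f :=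
  h.1.continuous.integrable_of_hasCompactSupport h.supp

/-- Self-convolution. -/
def cv (f : ℝ → ℝ) (x : ℝ) : ℝ := ∫ y, f y * f (x - y)

lemma cv_good {r : ℝ} {f : ℝ → ℝ} (h : GoodK r f) : GoodK (2 * r) (cv f) := by
  refine ⟨?_, fun x => integral_nonneg fun y => mul_nonneg (h.2.1 _) (h.2.1 _), fun x => ?_, fun x hx => ?_⟩
  · have := h.supp.contDiff_convolution_right (n := 2) (μ := volume) (ContinuousLinearMap.mul ℝ ℝ) h.int.locallyIntegrable h.1
    exact this
  · rw [cv, ← integral_neg_eq_self]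
    refine integral_congr_ae (Eventually.of_forall fun y => ?_)
    simp only
    rw [h.2.2.1, show -x - -y = -(x - y) by ring, h.2.2.1]
  · rw [cv]
    refine integral_eq_zero_of_ae (Eventually.of_forall fun y => ?_)
    simp only [Pi.zero_apply]
    rcases le_total r |y| with h1 | h1
    · rw [h.2.2.2 y h1, zero_mul]
    · rw [h.2.2.2 (x - y), mul_zero]
      have := abs_sub_abs_le_abs_sub x y
      linarith

lemma cv_ft {r : ℝ} {f : ℝ → ℝ} (h : GoodK r f) (t : ℝ) :
    ∫ x, (cv f x : ℂ) * ek t x = (∫ x, (f x : ℂ) * ek t x) ^ 2 := by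
  have hi : Integrable (fun x => (f x : ℂ) * ek t x) :=
    h.int.ofReal.mul_bdd (c := 1) (ek_cont t).aestronglyMeasurable (Eventually.of_forall fun x => (ek_norm t x).le)
  have := integral_convolution (μ := volume) (ν := volume) (ContinuousLinearMap.mul ℝ ℂ) hi hi
  rw [sq]
  refine Eq.trans ?_ this
  refine integral_congr_ae (Eventually.of_forall fun x => ?_)
  simp only [convolution, ContinuousLinearMap.mul_apply', cv]
  rw [← integral_complex_ofReal, ← integral_mul_const]
  refine integral_congr_ae (Eventually.of_forall fun y => ?_)
  simp only
  have : ek t x = ek t y * ek t (x - y) := by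
    rw [ek, ek, ek, ← Complex.exp_add]; congr 1; push_cast; ring
  rw [this]; push_cast; ring

lemma GoodK.ftReal {r : ℝ} {f : ℝ → ℝ} (h : GoodK r f) (t : ℝ) :
    ∫ x, (f x : ℂ) * ek t x = ((∫ x, f x * cos (t * x) : ℝ) : ℂ) := by
  have hi : Integrable (fun x => (f x : ℂ) * ek t x) :=
    h.int.ofReal.mul_bdd (c := 1) (ek_cont t).aestronglyMeasurable (Eventually.of_forall fun x => (ek_norm t x).le)
  have e : ∫ x, (f x : ℂ) * ek t x = ∫ x, (f x : ℂ) * ek t (-x) := by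
    rw [← integral_neg_eq_self]
    refine integral_congr_ae (Eventually.of_forall fun y => ?_)
    simp only; rw [h.2.2.1]
  have hi2 : Integrable (fun x => (f x : ℂ) * ek t (-x)) := by
    refine (hi.comp_neg).congr (Eventually.of_forall fun y => ?_)
    simp only; rw [h.2.2.1]
  have e2 : ∫ x, (f x : ℂ) * ek t x = (1 / 2) * ((∫ x, (f x : ℂ) * ek t x) + ∫ x, (f x : ℂ) * ek t (-x)) := by
    rw [← e]; ring
  rw [e2, ← integral_add hi hi2, ← integral_const_mul, ← integral_complex_ofReal]
  refine integral_congr_ae (Eventually.of_forall fun x => ?_)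
  have : ((cos (t * x) : ℝ) : ℂ) = (ek t x + ek t (-x)) / 2 := by
    rw [Complex.ofReal_cos, Complex.cos, ek, ek]; congr 3; push_cast; ring
  simp only [Complex.ofReal_mul]
  rw [this]; ring

/-- Base bump. -/
def bmp : ContDiffBump (0 : ℝ) := ⟨1 / 4, 1 / 2, by norm_num, by norm_num⟩

lemma bmp_good : GoodK (1 / 2) bmp := by
  refine ⟨bmp.contDiff, bmp.nonneg', bmp.neg, fun x hx => bmp.zero_of_le_dist ?_⟩
  simpa [bmp] using hx

/-- The kernel `β`. -/
def bet : ℝ → ℝ := cv bmp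
/-- `β ⋆ β`. -/
def bet2 : ℝ → ℝ := cv bet

lemma bet_good : GoodK 1 bet := by have := cv_good bmp_good; norm_num at this; exact this

/-- Fourier transform of `β`. -/
def w0 (t : ℝ) : ℝ := ∫ x, bet x * cos (t * x)

lemma bet_ft (t : ℝ) : ∫ x, (bet x : ℂ) * ek t x = (w0 t : ℂ) := bet_good.ftReal t
lemma bet2_ft (t : ℝ) : ∫ x, (bet2 x : ℂ) * ek t x = ((w0 t ^ 2 : ℝ) : ℂ) := by
  rw [show bet2 = cv bet from rfl, cv_ft bet_good, bet_ft]; push_cast; rfl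

lemma w0_nonneg (t : ℝ) : 0 ≤ w0 t := by
  have h := bet_ft t
  rw [show bet = cv bmp from rfl, cv_ft bmp_good, bmp_good.ftReal] at h
  have h2 : (∫ x, bmp x * cos (t * x)) ^ 2 = w0 t := by exact_mod_cast h
  rw [← h2]; positivity


lemma bet_pos0 : 0 < bet 0 := by
  have h : ∀ y, bmp y * bmp (0 - y) = bmp y * bmp y := fun y => by rw [zero_sub, bmp.neg]
  rw [bet, cv]; simp_rw [h]
  have hc : Continuous fun y => bmp y * bmp y := bmp.continuous.mul bmp.continuous
  refine (integral_pos_iff_support_of_nonneg (fun y => mul_self_nonneg _) (hc.integrable_of_hasCompactSupport (bmp_good.supp.mul_right))).2 ?_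
  refine (hc.isOpen_support).measure_pos _ ⟨0, ?_⟩
  have : bmp (0:ℝ) = 1 := bmp.one_of_mem_closedBall (by simp [bmp])
  simp [this]

lemma betB_pos : 0 < bet2 0 := by
  have h : ∀ y, bet y * bet (0 - y) = bet y * bet y := fun y => by rw [zero_sub, bet_good.2.2.1]
  rw [bet2, cv]; simp_rw [h]
  have hc : Continuous fun y => bet y * bet y := bet_good.1.continuous.mul bet_good.1.continuous
  refine (integral_pos_iff_support_of_nonneg (fun y => mul_self_nonneg _) (hc.integrable_of_hasCompactSupport (bet_good.supp.mul_right))).2 ?_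
  refine (hc.isOpen_support).measure_pos _ ⟨0, ?_⟩
  simp [bet_pos0.ne']

lemma betInt_pos : 0 < ∫ x, bet x :=
  (integral_pos_iff_support_of_nonneg bet_good.2.1 bet_good.int).2
    ((bet_good.1.continuous.isOpen_support).measure_pos _ ⟨0, bet_pos0.ne'⟩)

lemma w0_lower : ∃ c : ℝ, 0 < c ∧ ∀ t, |t| ≤ 1 → c ≤ w0 t := by
  refine ⟨cos 1 * ∫ x, bet x, mul_pos Real.cos_one_pos betInt_pos, fun t ht => ?_⟩
  rw [w0, ← integral_const_mul]
  refine integral_mono (bet_good.int.const_mul _) ?_ fun x => ?_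
  · exact bet_good.int.mul_bdd (c := 1) (by apply Continuous.aestronglyMeasurable; fun_prop) (Eventually.of_forall fun x => Real.abs_cos_le_one _)
  · simp only
    rcases le_total 1 |x| with h | h
    · rw [bet_good.2.2.2 x h]; simp
    · rw [mul_comm]
      refine mLL ?_ (bet_good.2.1 x)
      rw [← Real.cos_abs (t * x)]
      refine Real.cos_le_cos_of_nonneg_of_le_pi (abs_nonneg _) (by linarith [Real.pi_gt_three]) ?_
      rw [abs_mul]; nlinarith [abs_nonneg t, abs_nonneg x]

lemma w0_upper : ∃ C : ℝ, 0 < C ∧ ∀ t, w0 t ≤ C / (1 + t ^ 2) := by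
  set u : ℝ → ℂ := fun x => (bet x : ℂ) with hu
  have hus : ContDiff ℝ 2 u := Complex.ofRealCLM.contDiff.comp bet_good.1
  have huc : HasCompactSupport u := bet_good.supp.comp_left (g := fun x : ℝ => (x : ℂ)) (by simp)
  have hus1 : ContDiff ℝ 1 (deriv u) := hus.deriv' (n := 1)
  have hi : ∀ f : ℝ → ℂ, Continuous f → HasCompactSupport f → ∀ t : ℝ, (∫ x, f x * ek t x) = (∫ x in Set.Ioi 0, f x * ek t x) + ∫ x in Set.Iic 0, f x * ek t x := by
    intro f hf hfc t
    have : Integrable (fun x => f x * ek t x) := (hf.mul (ek_cont t)).integrable_of_hasCompactSupport hfc.mul_right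
    rw [← Set.compl_Ioi, integral_add_compl measurableSet_Ioi this]
  have hn : ∀ f : ℝ → ℂ, ∀ t, ‖∫ x, f x * ek t x‖ ≤ ∫ x, ‖f x‖ := by
    intro f t
    refine (norm_integral_le_integral_norm _).trans ?_
    simp_rw [norm_mul, ek_norm, mul_one]; exact le_rfl
  refine ⟨(∫ x, ‖u x‖) + (∫ x, ‖deriv (deriv u) x‖) + 1, by positivity, fun t => ?_⟩
  have a1 := ibpMain u (hus.of_le (by norm_num)) huc t
  have a2 := ibpMain (deriv u) hus1 huc.deriv t
  have e : (t:ℂ) ^ 2 * (w0 t : ℂ) = - ∫ x, deriv (deriv u) x * ek t x := by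
    rw [← bet_ft, hi u hus.continuous huc, hi _ (hus1.continuous_deriv le_rfl) huc.deriv.deriv, a2.1, a2.2, a1.1, a1.2]
    linear_combination ((t:ℂ)^2 * ((∫ x in Set.Ioi 0, u x * ek t x) + ∫ x in Set.Iic 0, u x * ek t x)) * Complex.I_sq
  have h1 : w0 t ≤ ∫ x, ‖u x‖ := by
    have := hn u t
    rw [bet_ft, Complex.norm_real, Real.norm_of_nonneg (w0_nonneg t)] at this; exact this
  have h2 : t ^ 2 * w0 t ≤ ∫ x, ‖deriv (deriv u) x‖ := by
    have := hn (deriv (deriv u)) t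
    rw [← norm_neg, ← e] at this
    rw [norm_mul, norm_pow, Complex.norm_real, Complex.norm_real, Real.norm_of_nonneg (w0_nonneg t), Real.norm_eq_abs, sq_abs] at this
    exact this
  rw [le_div_iff₀ (by positivity)]; nlinarith

lemma GoodK.lip {r : ℝ} {f : ℝ → ℝ} (h : GoodK r f) : ∃ C : ℝ, 0 < C ∧ (∀ x, f x ≤ C) ∧ ∀ x y, |f x - f y| ≤ C * |x - y| := by
  obtain ⟨K, hK⟩ := ContDiff.lipschitzWith_of_hasCompactSupport h.supp h.1 (by norm_num)
  obtain ⟨M, hM⟩ := h.supp.exists_bound_of_continuous h.1.continuous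
  refine ⟨K + |M| + 1, by positivity, fun x => ?_, fun x y => ?_⟩
  · have h1 := (le_abs_self _).trans (hM x)
    have := le_abs_self M
    have := K.coe_nonneg
    linarith
  · have := hK.dist_le_mul x y
    rw [Real.dist_eq, Real.dist_eq] at this
    refine this.trans (mLR ?_ (abs_nonneg _))
    have := abs_nonneg M; linarith

lemma expAbsInt (b : ℝ) (hb : 0 < b) : Integrable (fun x : ℝ => exp (-b * |x|)) ∧ ∫ x : ℝ, exp (-b * |x|) = 2 / b := by
  obtain ⟨h1, h2⟩ := poissonFT b hb 0
  have h3 : Integrable (fun x : ℝ => exp (-b * |x|)) := h1.re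
  refine ⟨h3, ?_⟩
  simp only [ek, zero_mul, Complex.ofReal_zero, Complex.exp_zero, mul_one] at h2
  rw [integral_complex_ofReal] at h2
  have := Complex.ofReal_inj.1 h2
  rw [this]; field_simp; ring

lemma expAbsBound (b : ℝ) (hb : 0 < b) (g : ℝ → ℂ) (M : ℝ) (hM : ∀ x, ‖g x‖ ≤ M) :
    ‖∫ x, ((exp (-b * |x|) : ℝ) : ℂ) * g x‖ ≤ 2 * M / b := by
  obtain ⟨h1, h2⟩ := expAbsInt b hb
  refine (norm_integral_le_of_norm_le (h1.mul_const M) (Eventually.of_forall fun x => ?_)).trans ?_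
  · rw [norm_mul, Complex.norm_real, Real.norm_of_nonneg (Real.exp_pos _).le]
    exact mLL (hM x) (Real.exp_pos _).le
  · rw [integral_mul_const, h2]; exact le_of_eq (by ring)

lemma gammaTerm (b : ℝ) (hb : 0 < b) (g : ℝ → ℂ) (hg : Continuous g) (hc : HasCompactSupport g) (M1 : ℝ)
    (hM : ∀ x, ‖g x - g 0‖ ≤ M1 * |x|) :
    ‖(∫ x, ((exp (-b * |x|) : ℝ) : ℂ) * g x) - 2 / b * g 0‖ ≤ 8 * M1 / b ^ 2 := by
  obtain ⟨h1, h2⟩ := expAbsInt b hb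
  obtain ⟨h3, h4⟩ := expAbsInt (b / 2) (by positivity)
  have e : (2 / b * g 0 : ℂ) = ∫ x : ℝ, ((exp (-b * |x|) : ℝ) : ℂ) * g 0 := by
    rw [integral_mul_const, integral_complex_ofReal, h2]; push_cast; rfl
  have hM1 : 0 ≤ M1 := by simpa using (norm_nonneg _).trans (hM 1)
  have hi : Integrable (fun x => ((exp (-b * |x|) : ℝ) : ℂ) * g x) :=
    Continuous.integrable_of_hasCompactSupport (by fun_prop) hc.mul_left
  have hi2 : Integrable (fun x => ((exp (-b * |x|) : ℝ) : ℂ) * g 0) := h1.ofReal.mul_const _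
  rw [e, ← integral_sub hi hi2]
  refine (norm_integral_le_of_norm_le (h3.mul_const (M1 * (2 / b))) (Eventually.of_forall fun x => ?_)).trans ?_
  · rw [← mul_sub, norm_mul, Complex.norm_real, Real.norm_of_nonneg (Real.exp_pos _).le]
    have e1 : exp (-b * |x|) = exp (-(b / 2) * |x|) * exp (-(b / 2) * |x|) := by
      rw [← Real.exp_add]; ring_nf
    have e2 : exp (-(b / 2) * |x|) * |x| ≤ 2 / b := by
      have := Real.add_one_le_exp (b / 2 * |x|)
      rw [neg_mul, Real.exp_neg, inv_mul_le_iff₀ (Real.exp_pos _), mul_div_assoc', le_div_iff₀ hb]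
      nlinarith
    rw [e1, mul_assoc]
    refine mLL ?_ (Real.exp_pos _).le
    calc _ ≤ exp (-(b / 2) * |x|) * (M1 * |x|) := mLL (hM x) (Real.exp_pos _).le
      _ = M1 * (exp (-(b / 2) * |x|) * |x|) := by ring
      _ ≤ _ := mLL e2 hM1
  · rw [integral_mul_const, h4]; exact le_of_eq (by field_simp; ring)

lemma gammaTail (g : ℝ → ℂ) (hg : Continuous g) (hc : HasCompactSupport g) (M0 M1 : ℝ) (h0 : ‖g 0‖ ≤ M0)
    (hM : ∀ x, ‖g x - g 0‖ ≤ M1 * |x|) (G : ℂ)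
    (hG : HasSum (fun k : ℕ => g 0 / (k + 1) - ∫ x, ((exp (-(2 * k + 5 / 2) * |x|) : ℝ) : ℂ) * g x) G)
    (K : ℕ) (hK : 1 ≤ K) :
    ‖G - g 0 * ((∑ k ∈ Finset.range K, 1 / ((k : ℝ) + 1) : ℝ) : ℂ)‖ ≤
      (∑ k ∈ Finset.range K, ‖∫ x, ((exp (-(2 * k + 5 / 2) * |x|) : ℝ) : ℂ) * g x‖) + (M0 + 2 * M1) / K := by
  have hM1 : 0 ≤ M1 := by simpa using (norm_nonneg _).trans (hM 1)
  have hM0 : 0 ≤ M0 := (norm_nonneg _).trans h0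
  set I : ℕ → ℂ := fun k => ∫ x, ((exp (-(2 * k + 5 / 2) * |x|) : ℝ) : ℂ) * g x with hI
  have hterm : ∀ k : ℕ, ‖g 0 / (k + 1) - I k‖ ≤ (M0 + 2 * M1) * (1 / ((k : ℝ) + 1) ^ 2) := by
    intro k
    have hb : (0:ℝ) < 2 * k + 5 / 2 := by positivity
    have h1 := gammaTerm _ hb g hg hc M1 hM
    have e : g 0 / (k + 1) - I k = g 0 * ((1 / ((k:ℝ) + 1) - 2 / (2 * k + 5 / 2) : ℝ) : ℂ) - (I k - 2 / ((2 * k + 5 / 2 : ℝ) : ℂ) * g 0) := by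
      push_cast; ring
    rw [e]
    refine (norm_sub_le _ _).trans ?_
    have hk : (0:ℝ) < k + 1 := by positivity
    have h2 : ‖g 0 * ((1 / ((k:ℝ) + 1) - 2 / (2 * k + 5 / 2) : ℝ) : ℂ)‖ ≤ M0 * (1 / ((k : ℝ) + 1) ^ 2) := by
      rw [norm_mul, Complex.norm_real, Real.norm_eq_abs]
      refine mul_le_mul h0 ?_ (abs_nonneg _) hM0
      have : 1 / ((k:ℝ) + 1) - 2 / (2 * k + 5 / 2) = 1 / 2 / ((k + 1) * (2 * k + 5 / 2)) := by
        field_simp; ring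
      rw [this, abs_of_pos (by positivity), div_le_div_iff₀ (by positivity) (by positivity)]
      nlinarith
    have h3 : 8 * M1 / (2 * k + 5 / 2 : ℝ) ^ 2 ≤ 2 * M1 * (1 / ((k : ℝ) + 1) ^ 2) := by
      rw [mul_one_div, div_le_div_iff₀ (by positivity) (by positivity)]
      have : 4 * ((k:ℝ) + 1) ^ 2 ≤ (2 * k + 5 / 2) ^ 2 := by nlinarith
      nlinarith
    linarith [h1]
  have hs := (hasSum_nat_add_iff' K).2 hG
  have hb : ∀ n : ℕ, ∑ i ∈ Finset.range n, 1 / (((i + K : ℕ) : ℝ) + 1) ^ 2 ≤ 1 / K - 1 / ((n : ℝ) + K) := by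
    have hKp : (1:ℝ) ≤ K := by exact_mod_cast hK
    intro n
    induction n with
    | zero => simp
    | succ n ih =>
      rw [Finset.sum_range_succ]
      have : 1 / (((n + K : ℕ) : ℝ) + 1) ^ 2 ≤ 1 / ((n : ℝ) + K) - 1 / (((n + 1 : ℕ) : ℝ) + K) := by
        push_cast
        have hp : (0:ℝ) < n + K := by positivity
        rw [div_sub_div _ _ (by positivity) (by positivity), div_le_div_iff₀ (by positivity) (by positivity)]
        nlinarith
      linarith
  have hlim : ‖G - ∑ i ∈ Finset.range K, (g 0 / (i + 1) - I i)‖ ≤ (M0 + 2 * M1) / K := by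
    refine le_of_tendsto hs.tendsto_sum_nat.norm (Eventually.of_forall fun n => ?_)
    refine (norm_sum_le_of_le _ fun i _ => hterm (i + K)).trans ?_
    rw [← Finset.mul_sum, div_eq_mul_one_div]
    refine mLL ((hb n).trans ?_) (by positivity)
    have : (0:ℝ) ≤ 1 / ((n : ℝ) + K) := by positivity
    linarith
  have e : G - g 0 * ((∑ k ∈ Finset.range K, 1 / ((k : ℝ) + 1) : ℝ) : ℂ) =
      (G - ∑ i ∈ Finset.range K, (g 0 / (i + 1) - I i)) - ∑ i ∈ Finset.range K, I i := by
    rw [Finset.sum_sub_distrib]; push_cast; rw [Finset.mul_sum]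
    simp only [mul_one_div]; ring
  rw [e]
  refine (norm_sub_le _ _).trans ?_
  linarith [norm_sum_le (Finset.range K) I]

lemma expGeom (x : ℝ) (hx : 0 < x) (n : ℕ) : ∑ k ∈ Finset.range n, exp (-(2 * k + 5 / 2) * x) ≤ 1 / (2 * x) := by
  have h : ∀ k : ℕ, exp (-(2 * k + 5 / 2) * x) = exp (-(5 / 2) * x) * (exp (-2 * x)) ^ k := by
    intro k; rw [← Real.exp_nat_mul, ← Real.exp_add]; ring_nf
  simp_rw [h]
  rw [← Finset.mul_sum]
  have hlt : exp (-2 * x) < 1 := by rw [Real.exp_lt_one_iff]; linarith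
  have h0 := (Real.exp_pos (-2 * x)).le
  have h1 : ∑ i ∈ Finset.range n, exp (-2 * x) ^ i ≤ (1 - exp (-2 * x))⁻¹ := by
    rw [← tsum_geometric_of_lt_one h0 hlt]
    exact (summable_geometric_of_lt_one h0 hlt).sum_le_tsum _ fun i _ => by positivity
  have h2 : exp (-(5 / 2) * x) ≤ exp (-2 * x) := Real.exp_le_exp.2 (by linarith)
  have h3 : 2 * x + 1 ≤ exp (2 * x) := Real.add_one_le_exp _
  have h4 : exp (-2 * x) * exp (2 * x) = 1 := by rw [← Real.exp_add]; simp
  calc _ ≤ exp (-2 * x) * (1 - exp (-2 * x))⁻¹ := by gcongr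
    _ ≤ _ := by
      rw [← div_eq_mul_inv, div_le_div_iff₀ (by linarith) (by linarith)]
      nlinarith [Real.exp_pos (-2 * x)]

lemma gammaFar (g : ℝ → ℂ) (hg : Continuous g) (hc : HasCompactSupport g) (a : ℝ) (ha : 0 < a)
    (hs : ∀ x, |x| < a → g x = 0) (G : ℂ)
    (hG : HasSum (fun k : ℕ => g 0 / (k + 1) - ∫ x, ((exp (-(2 * k + 5 / 2) * |x|) : ℝ) : ℂ) * g x) G) :
    ‖G‖ ≤ 1 / (2 * a) * ∫ x, ‖g x‖ := by
  have hi : ∀ k : ℕ, Integrable (fun x => ((exp (-(2 * k + 5 / 2) * |x|) : ℝ) : ℂ) * g x) := fun k =>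
    Continuous.integrable_of_hasCompactSupport (by fun_prop) hc.mul_left
  refine le_of_tendsto hG.tendsto_sum_nat.norm (Eventually.of_forall fun n => ?_)
  simp only [hs 0 (by simpa using ha), zero_div, zero_sub, Finset.sum_neg_distrib, norm_neg]
  rw [← integral_finsetSum _ fun k _ => hi k, ← integral_const_mul]
  refine norm_integral_le_of_norm_le (((hg.integrable_of_hasCompactSupport hc).norm).const_mul _) (Eventually.of_forall fun x => ?_)
  rw [← Finset.sum_mul, norm_mul]
  by_cases hx : |x| < a
  · simp [hs x hx]
  · push Not at hx
    refine mLR ?_ (norm_nonneg _)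
    rw [← Complex.ofReal_sum, Complex.norm_real, Real.norm_of_nonneg (Finset.sum_nonneg fun i _ => (Real.exp_pos _).le)]
    refine (expGeom |x| (ha.trans_le hx) n).trans ?_
    gcongr

lemma harm_le (K : ℕ) (hK : 1 ≤ K) : log K ≤ ∑ k ∈ Finset.range K, 1 / ((k : ℝ) + 1) ∧
    ∑ k ∈ Finset.range K, 1 / ((k : ℝ) + 1) ≤ 1 + log K := by
  have e : (∑ k ∈ Finset.range K, 1 / ((k : ℝ) + 1)) = ((harmonic K : ℚ) : ℝ) := by
    rw [harmonic]; push_cast; simp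
  rw [e]
  refine ⟨(Real.log_le_log (by positivity) (by push_cast; linarith)).trans (log_add_one_le_harmonic K) , harmonic_le_one_add_log K⟩

/-- `log p / p` on primes. -/
def cP (n : ℕ) : ℝ := if n.Prime then log n / n else 0

lemma sumLog (N : ℕ) : ∑ n ∈ Finset.Ioc 0 N, vonMangoldt n * ((N / n : ℕ) : ℝ) = log (N.factorial) := by
  rw [← ArithmeticFunction.sum_Ioc_mul_zeta_eq_sum, ArithmeticFunction.vonMangoldt_mul_zeta]
  simp only [ArithmeticFunction.log_apply]
  induction N with
  | zero => simp
  | succ n ih =>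
    rw [Finset.sum_Ioc_succ_top (Nat.zero_le n), ih, Nat.factorial_succ, Nat.cast_mul, Real.log_mul (by positivity) (by positivity)]
    ring

lemma mertU : ∃ C : ℝ, 0 < C ∧ ∀ N : ℕ, 1 ≤ N → ∑ n ∈ Finset.Ioc 0 N, vonMangoldt n / n ≤ log N + C := by
  refine ⟨log 4 + 4, by positivity, fun N hN => ?_⟩
  have hNp : (0:ℝ) < N := by exact_mod_cast hN
  have h1 := sumLog N
  have h2 := Chebyshev.psi_le_const_mul_self (x := N) hNp.le
  rw [Chebyshev.psi, Nat.floor_natCast] at h2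
  have h3 : log (N.factorial) ≤ N * log N := by
    rw [← Real.log_pow]; exact Real.log_le_log (by positivity) (by exact_mod_cast Nat.factorial_le_pow N)
  have h4 : N * ∑ n ∈ Finset.Ioc 0 N, vonMangoldt n / n ≤
      (∑ n ∈ Finset.Ioc 0 N, vonMangoldt n * ((N / n : ℕ) : ℝ)) + ∑ n ∈ Finset.Ioc 0 N, vonMangoldt n := by
    rw [Finset.mul_sum, ← Finset.sum_add_distrib]
    refine Finset.sum_le_sum fun n hn => ?_
    have hn0 : 0 < n := (Finset.mem_Ioc.1 hn).1
    have : (N : ℝ) / n ≤ ((N / n : ℕ) : ℝ) + 1 := by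
      have := Nat.lt_floor_add_one ((N : ℝ) / n)
      rw [Nat.floor_div_natCast, Nat.floor_natCast] at this; exact this.le
    have hv : 0 ≤ vonMangoldt n := ArithmeticFunction.vonMangoldt_nonneg
    calc _ = vonMangoldt n * ((N : ℝ) / n) := by ring
      _ ≤ vonMangoldt n * (((N / n : ℕ) : ℝ) + 1) := by gcongr
      _ = _ := by ring
  have h5 : N * ∑ n ∈ Finset.Ioc 0 N, vonMangoldt n / n ≤ N * (log N + (log 4 + 4)) := by linarith
  exact le_of_mul_le_mul_left h5 hNp

lemma mertL (N : ℕ) (hN : 1 ≤ N) : log N - 1 ≤ ∑ n ∈ Finset.Ioc 0 N, vonMangoldt n / n := by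
  have hNp : (0:ℝ) < N := by exact_mod_cast hN
  have h1 := sumLog N
  have h3 := Stirling.le_log_factorial_stirling (n := N) (by omega)
  have h4 : (∑ n ∈ Finset.Ioc 0 N, vonMangoldt n * ((N / n : ℕ) : ℝ)) ≤ N * ∑ n ∈ Finset.Ioc 0 N, vonMangoldt n / n := by
    rw [Finset.mul_sum]
    refine Finset.sum_le_sum fun n hn => ?_
    have hv : 0 ≤ vonMangoldt n := ArithmeticFunction.vonMangoldt_nonneg
    calc _ ≤ vonMangoldt n * ((N : ℝ) / n) := by gcongr; exact Nat.cast_div_le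
      _ = _ := by ring
  have h6 : 0 ≤ log N := Real.log_nonneg (by exact_mod_cast hN)
  have h7 : 0 ≤ log (2 * π) := Real.log_nonneg (by linarith [Real.pi_gt_three])
  have h5 : N * (log N - 1) ≤ N * ∑ n ∈ Finset.Ioc 0 N, vonMangoldt n / n := by linarith
  exact le_of_mul_le_mul_left h5 hNp

lemma mertP : ∃ C : ℝ, 0 < C ∧ ∀ t : ℝ, 1 ≤ t → |∑ n ∈ Finset.Icc 0 ⌊t⌋₊, cP n - log t| ≤ C := by
  obtain ⟨C, hC, hU⟩ := mertU
  have hs := ArithmeticFunction.vonMangoldt.summable_residueClass_non_primes_div (q := 1) (a := 0)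
  have e : (fun n : ℕ ↦ (if n.Prime then 0 else ArithmeticFunction.vonMangoldt.residueClass (0 : ZMod 1) n) / (n:ℝ)) =
      fun n : ℕ => vonMangoldt n / n - cP n := by
    funext n
    have h1 : ArithmeticFunction.vonMangoldt.residueClass (0 : ZMod 1) n = vonMangoldt n := by
      rw [ArithmeticFunction.vonMangoldt.residueClass, Set.indicator_of_mem]; exact Subsingleton.elim _ _
    rw [h1, cP]; split_ifs with h
    · rw [ArithmeticFunction.vonMangoldt_apply_prime h]; simp
    · simp
  rw [e] at hs
  have hnn : ∀ n : ℕ, 0 ≤ vonMangoldt n / n - cP n := by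
    intro n; rw [cP]; split_ifs with h
    · rw [ArithmeticFunction.vonMangoldt_apply_prime h]; simp
    · have : 0 ≤ vonMangoldt n := ArithmeticFunction.vonMangoldt_nonneg
      simp; positivity
  set D := ∑' n : ℕ, (vonMangoldt n / n - cP n)
  have hD : 0 ≤ D := tsum_nonneg hnn
  refine ⟨C + D + 2, by positivity, fun t ht => ?_⟩
  have hN : 1 ≤ ⌊t⌋₊ := (Nat.one_le_floor_iff _).2 ht
  set N := ⌊t⌋₊
  have hNp : (1:ℝ) ≤ N := by exact_mod_cast hN
  have e2 : ∑ n ∈ Finset.Icc 0 N, cP n = ∑ n ∈ Finset.Ioc 0 N, cP n := by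
    rw [← Finset.Icc_erase_left]; exact (Finset.sum_erase _ (by simp [cP])).symm
  have h1 := hs.sum_le_tsum (Finset.Ioc 0 N) fun i _ => hnn i
  have h0 := Finset.sum_nonneg fun i (_ : i ∈ Finset.Ioc 0 N) => hnn i
  rw [Finset.sum_sub_distrib] at h1 h0
  have hl1 : log N ≤ log t := Real.log_le_log (by positivity) (Nat.floor_le (by linarith))
  have hl2 : log t ≤ log N + 1 := by
    have : t ≤ N * exp 1 := by
      have h3 := (Nat.lt_floor_add_one t).le
      have := Real.add_one_le_exp 1
      nlinarith
    calc _ ≤ log (N * exp 1) := Real.log_le_log (by linarith) this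
      _ = _ := by rw [Real.log_mul (by positivity) (by positivity), Real.log_exp]
  rw [e2, abs_le]
  constructor <;> linarith [hU N hN, mertL N hN]

lemma zeroSum (hRH : RiemannHypothesis) : ∃ C : ℝ, 0 < C ∧ ∀ T : ℝ, 2 ≤ T →
    Summable (fun γ : ℝ => (ordMult γ : ℝ) * (1 / (1 + (γ / T) ^ 2))) ∧
    ∑' γ : ℝ, (ordMult γ : ℝ) * (1 / (1 + (γ / T) ^ 2)) ≤ C * T * log T := by
  refine ⟨(1 + |kap| + 1 / 2) / log 2 + 1, by positivity, fun T hT => ?_⟩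
  have h := (poissonSum hRH T 0 (by linarith)).mul_left T
  have h' : HasSum (fun γ : ℝ => (ordMult γ : ℝ) * (1 / (1 + (γ / T) ^ 2))) (T * (logDeriv xiF (T + (0:ℝ) * Complex.I)).re) := by
    refine h.congr_fun fun γ => ?_
    field_simp; ring
  refine ⟨h'.summable, ?_⟩
  rw [h'.tsum_eq, xiF_logDeriv T 0 (by linarith)]
  have h1 : (T - 1 / 2) / ((T - 1 / 2) ^ 2 + 0 ^ 2) ≤ 1 := by
    rw [div_le_one (by nlinarith)]; nlinarith
  have h2 : 0 ≤ (LSeries (fun n => (vonMangoldt n : ℂ)) (1 / 2 + T + (0:ℝ) * Complex.I)).re := by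
    have hs : 1 < (1 / 2 + T + (0:ℝ) * Complex.I : ℂ).re := by norm_num; linarith
    have h := ArithmeticFunction.LSeriesSummable_vonMangoldt hs
    refine (Complex.hasSum_re h.hasSum).nonneg fun n => ?_
    rcases Nat.eq_zero_or_pos n with rfl | hn
    · simp
    rw [LSeries.term_of_ne_zero hn.ne']
    rw [show (1 / 2 + T + (0:ℝ) * Complex.I : ℂ) = ((1 / 2 + T : ℝ) : ℂ) by push_cast; ring, ← Complex.ofReal_natCast, ← Complex.ofReal_cpow n.cast_nonneg, ← Complex.ofReal_div, Complex.ofReal_re]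
    exact div_nonneg ArithmeticFunction.vonMangoldt_nonneg (by positivity)
  have h3 : ∑' k : ℕ, (1 / (2 * k + 2 : ℝ) - (2 * k + 5 / 2 + T) / ((2 * k + 5 / 2 + T) ^ 2 + 0 ^ 2)) ≤ 1 / 2 + log T := by
    set J := ⌈T⌉₊
    have hJ : T ≤ J := Nat.le_ceil T
    have hJ2 : (J : ℝ) < T + 1 := Nat.ceil_lt_add_one (by linarith)
    have hJ1 : 1 ≤ J := by exact_mod_cast (show (1:ℝ) ≤ J by linarith)
    have hsm := (gamSum T 0 (by linarith)).tendsto_sum_nat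
    rw [← (gamSum T 0 (by linarith)).tsum_eq] at hsm
    refine le_of_tendsto hsm (Eventually.of_forall fun n => ?_)
    have ht : ∀ k : ℕ, 1 / (2 * k + 2 : ℝ) - (2 * k + 5 / 2 + T) / ((2 * k + 5 / 2 + T) ^ 2 + 0 ^ 2) ≤
        1 / 2 * (1 / ((k:ℝ) + 1)) - 1 / 2 * (1 / (((J + k : ℕ) : ℝ) + 1)) := by
      intro k
      have hb : (0:ℝ) < 2 * k + 5 / 2 + T := by positivity
      have e1 : (2 * k + 5 / 2 + T) / ((2 * k + 5 / 2 + T) ^ 2 + 0 ^ 2) = 1 / (2 * k + 5 / 2 + T) := by field_simp; ring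
      have e2 : 1 / 2 * (1 / ((k:ℝ) + 1)) = 1 / (2 * k + 2) := by field_simp
      have e3 : 1 / 2 * (1 / (((J + k : ℕ) : ℝ) + 1)) = 1 / (2 * (J + k) + 2) := by push_cast; field_simp
      have e4 : 1 / (2 * (J + k) + 2 : ℝ) ≤ 1 / (2 * k + 5 / 2 + T) := one_div_le_one_div_of_le hb (by linarith)
      rw [e1, e2, e3]; linarith
    refine (Finset.sum_le_sum fun k _ => ht k).trans ?_
    rw [Finset.sum_sub_distrib, ← Finset.mul_sum, ← Finset.mul_sum]
    have a1 := Finset.sum_range_add (fun k : ℕ => 1 / ((k:ℝ) + 1)) J n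
    have a2 : ∑ k ∈ Finset.range n, 1 / ((k:ℝ) + 1) ≤ ∑ k ∈ Finset.range (J + n), 1 / ((k:ℝ) + 1) :=
      Finset.sum_le_sum_of_subset_of_nonneg (Finset.range_mono (by omega)) fun i _ _ => by positivity
    have a3 := (harm_le J hJ1).2
    have a4 : log J ≤ 2 * log T := by
      rw [show 2 * log T = log (T ^ 2) by rw [Real.log_pow]; norm_num]
      exact Real.log_le_log (by positivity) (by nlinarith)
    linarith
  have hl : log 2 ≤ log T := Real.log_le_log (by norm_num) hT
  have hl2 : 0 < log 2 := Real.log_pos (by norm_num)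
  have h5 : 1 + |kap| + 1 / 2 ≤ (1 + |kap| + 1 / 2) / log 2 * log T := by
    rw [div_mul_eq_mul_div, le_div_iff₀ hl2]
    exact mLL hl (by positivity)
  have h6 := le_abs_self kap
  rw [show ((1 + |kap| + 1 / 2) / log 2 + 1) * T * log T = T * (((1 + |kap| + 1 / 2) / log 2) * log T + log T) by ring]
  exact mLL (by linarith) (by linarith)

/-- Cauchy weight. -/
def Wt (T t : ℝ) : ℝ := 1 / (1 + (t / T) ^ 2)

lemma Wt_pos (T t : ℝ) : 0 < Wt T t := by unfold Wt; positivity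

lemma Wt_cont (T : ℝ) : Continuous (Wt T) := by
  unfold Wt
  exact continuous_const.div (by fun_prop) fun t => by positivity

lemma Wt_int (T : ℝ) (hT : 0 < T) : Integrable (Wt T) := by
  have := integrable_inv_one_add_sq.comp_div hT.ne'
  refine this.congr (Eventually.of_forall fun t => ?_)
  simp [Wt]

lemma Wt_ft (T : ℝ) (hT : 0 < T) (x : ℝ) : ∫ t, (Wt T t : ℂ) * ek (-t) x = ((π * T * exp (-T * |x|) : ℝ) : ℂ) := by
  have hk : ∀ t, (Wt T t : ℂ) = ((T / 2 : ℝ) : ℂ) * ((2 * (T / (T ^ 2 + t ^ 2)) : ℝ) : ℂ) := by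
    intro t; rw [← Complex.ofReal_mul]; congr 1; unfold Wt; field_simp
  have hi : Integrable (fun t : ℝ => ((2 * (T / (T ^ 2 + t ^ 2)) : ℝ) : ℂ)) := by
    refine ((Wt_int T hT).ofReal.const_mul (((T / 2 : ℝ) : ℂ)⁻¹)).congr (Eventually.of_forall fun t => ?_)
    have h0 : ((T / 2 : ℝ) : ℂ) ≠ 0 := by exact_mod_cast (by positivity : T / 2 ≠ 0)
    change _ * (Wt T t : ℂ) = _
    rw [hk t, inv_mul_cancel_left₀ h0]
  have := fInv (fun x => ((exp (-T * |x|) : ℝ) : ℂ)) (by fun_prop) (poissonFT T hT 0).1 _ (fun t => (poissonFT T hT t).2.symm) hi x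
  simp_rw [hk, mul_assoc]
  rw [integral_const_mul, this]; push_cast; ring

lemma quadForm {ι : Type*} (s : Finset ι) (b x : ι → ℝ) (T : ℝ) (hT : 0 < T) :
    ∫ t, Wt T t * ‖∑ q ∈ s, (b q : ℂ) * ek (-t) (x q)‖ ^ 2 =
      π * T * ∑ q ∈ s, ∑ r ∈ s, b q * b r * exp (-T * |x q - x r|) := by
  rw [← Complex.ofReal_inj, ← integral_complex_ofReal]
  have e : ∀ t, ((Wt T t * ‖∑ q ∈ s, (b q : ℂ) * ek (-t) (x q)‖ ^ 2 : ℝ) : ℂ) =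
      ∑ q ∈ s, ∑ r ∈ s, ((b q * b r : ℝ) : ℂ) * ((Wt T t : ℂ) * ek (-t) (x q - x r)) := by
    intro t
    rw [Complex.ofReal_mul, Complex.ofReal_pow, ← Complex.mul_conj', map_sum, Finset.sum_mul_sum, Finset.mul_sum]
    refine Finset.sum_congr rfl fun q _ => ?_
    rw [Finset.mul_sum]
    refine Finset.sum_congr rfl fun r _ => ?_
    have h1 : (starRingEnd ℂ) (ek (-t) (x r)) = ek (-t) (-x r) := by
      unfold ek; rw [← Complex.exp_conj, map_mul, Complex.conj_ofReal, Complex.conj_I]; push_cast; ring_nf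
    have h2 : ek (-t) (x q - x r) = ek (-t) (x q) * ek (-t) (-x r) := by
      unfold ek; rw [← Complex.exp_add]; push_cast; ring_nf
    rw [map_mul, Complex.conj_ofReal, h1, h2]; push_cast; ring
  simp_rw [e]
  have hi : ∀ y : ℝ, Integrable (fun t => (Wt T t : ℂ) * ek (-t) y) := fun y => by
    refine (Wt_int T hT).ofReal.mul_bdd (c := 1) (Continuous.aestronglyMeasurable (by unfold ek; fun_prop)) (Eventually.of_forall fun t => (ek_norm _ _).le)
  rw [integral_finsetSum _ fun q _ => integrable_finsetSum _ fun r _ => (hi _).const_mul _]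
  simp_rw [fun q => integral_finsetSum s fun r _ => (hi (x q - x r)).const_mul ((b q * b r : ℝ) : ℂ), integral_const_mul, Wt_ft T hT]
  push_cast
  rw [Finset.mul_sum]
  refine Finset.sum_congr rfl fun q _ => ?_
  rw [Finset.mul_sum]
  refine Finset.sum_congr rfl fun r _ => ?_
  ring

lemma log_gap (a b K : ℕ) (ha : 0 < a) (hb : 0 < b) (h : a ≠ b) (ha' : a ≤ K) (hb' : b ≤ K) : 1 / (K : ℝ) ≤ |log a - log b| := by
  wlog hab : a < b generalizing a b
  · rw [abs_sub_comm]; exact this b a hb ha h.symm hb' ha' (by omega)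
  have hap : (0:ℝ) < a := by exact_mod_cast ha
  have hbp : (0:ℝ) < b := by exact_mod_cast hb
  have h1 : 1 - ((b:ℝ) / a)⁻¹ ≤ log (b / a) := Real.one_sub_inv_le_log_of_pos (by positivity)
  rw [Real.log_div hbp.ne' hap.ne', inv_div] at h1
  have h2 : 1 / (b:ℝ) ≤ 1 - a / b := by
    rw [le_sub_iff_add_le, ← add_div, div_le_one hbp]; exact_mod_cast (by omega : 1 + a ≤ b)
  have h3 : 1 / (K : ℝ) ≤ 1 / b := one_div_le_one_div_of_le hbp (by exact_mod_cast hb')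
  rw [abs_sub_comm]
  exact (h3.trans (h2.trans h1)).trans (le_abs_self _)

lemma lamConv (N M : ℕ) (hM : 0 < M) (hMN : M ≤ N ^ 2) :
    ∑ r ∈ (Finset.Ioc 0 N ×ˢ Finset.Ioc 0 N) with r.1 * r.2 = M, vonMangoldt r.1 * vonMangoldt r.2 ≤ (2 * log N) ^ 2 := by
  have hl : log M ≤ 2 * log N := by
    rw [show 2 * log N = log ((N:ℝ) ^ 2) by rw [Real.log_pow]; norm_num]
    exact Real.log_le_log (by positivity) (by exact_mod_cast hMN)
  have hl0 : 0 ≤ log M := Real.log_natCast_nonneg M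
  have hv : ∀ n : ℕ, 0 ≤ vonMangoldt n := fun n => ArithmeticFunction.vonMangoldt_nonneg
  have h1 : ∑ r ∈ (Finset.Ioc 0 N ×ˢ Finset.Ioc 0 N) with r.1 * r.2 = M, vonMangoldt r.1 * vonMangoldt r.2 ≤
      ∑ r ∈ M.divisorsAntidiagonal, vonMangoldt r.1 * vonMangoldt r.2 := by
    refine Finset.sum_le_sum_of_subset_of_nonneg (fun r hr => ?_) fun r _ _ => mul_nonneg (hv _) (hv _)
    rw [Finset.mem_filter] at hr
    exact Nat.mem_divisorsAntidiagonal.2 ⟨hr.2, hM.ne'⟩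
  refine h1.trans ?_
  have h2 : ∑ r ∈ M.divisorsAntidiagonal, vonMangoldt r.1 * vonMangoldt r.2 ≤
      ∑ r ∈ M.divisorsAntidiagonal, vonMangoldt r.1 * log M := by
    refine Finset.sum_le_sum fun r hr => mLL ?_ (hv _)
    obtain ⟨he, _⟩ := Nat.mem_divisorsAntidiagonal.1 hr
    have h0 : 0 < r.2 := Nat.pos_of_ne_zero fun h => by rw [h] at he; omega
    refine ArithmeticFunction.vonMangoldt_le_log.trans (Real.log_le_log (by exact_mod_cast h0) ?_)
    exact_mod_cast Nat.le_of_dvd hM ⟨r.1, by rw [← he]; ring⟩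
  refine h2.trans ?_
  rw [← Finset.sum_mul, Nat.sum_divisorsAntidiagonal (fun i _ => vonMangoldt i), ArithmeticFunction.vonMangoldt_sum]
  nlinarith

lemma fourth (N : ℕ) (hN : 1 ≤ N) (a : ℕ → ℝ) (A : ℝ) (hA : 0 ≤ A) (ha0 : ∀ n, 0 ≤ a n)
    (ha : ∀ n, a n ≤ A * (vonMangoldt n / sqrt n)) (T : ℝ) (hT : 0 < T) :
    ∫ t, Wt T t * ‖∑ n ∈ Finset.Ioc 0 N, (a n : ℂ) * ek (-t) (log n)‖ ^ 4 ≤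
      π * T * (A ^ 4 * ((2 * log N) ^ 2 * (∑ n ∈ Finset.Ioc 0 N, vonMangoldt n / n) ^ 2
        + log N ^ 4 * N ^ 6 / T)) := by
  have hv : ∀ n : ℕ, 0 ≤ vonMangoldt n := fun n => ArithmeticFunction.vonMangoldt_nonneg
  have hNp : (1:ℝ) ≤ N := by exact_mod_cast hN
  set R := Finset.Ioc 0 N with hR
  set s := R ×ˢ R with hs
  set b : ℕ × ℕ → ℝ := fun q => a q.1 * a q.2 with hb
  set x : ℕ × ℕ → ℝ := fun q => log q.1 + log q.2 with hx
  have e : ∀ t, Wt T t * ‖∑ n ∈ R, (a n : ℂ) * ek (-t) (log n)‖ ^ 4 = Wt T t * ‖∑ q ∈ s, (b q : ℂ) * ek (-t) (x q)‖ ^ 2 := by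
    intro t
    have : ∑ q ∈ s, (b q : ℂ) * ek (-t) (x q) = (∑ n ∈ R, (a n : ℂ) * ek (-t) (log n)) ^ 2 := by
      rw [sq, Finset.sum_mul_sum, hs, Finset.sum_product]
      refine Finset.sum_congr rfl fun i _ => Finset.sum_congr rfl fun j _ => ?_
      have h2 : ek (-t) (log i + log j) = ek (-t) (log i) * ek (-t) (log j) := by
        unfold ek; rw [← Complex.exp_add]; push_cast; ring_nf
      simp only [hb, hx, h2]; push_cast; ring
    rw [this, norm_pow]; ring
  simp_rw [e]
  rw [quadForm s b x T hT]
  refine mLL ?_ (by positivity)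
  have hb0 : ∀ q, 0 ≤ b q := fun q => mul_nonneg (ha0 _) (ha0 _)
  have hmem : ∀ q ∈ s, 0 < q.1 ∧ 0 < q.2 ∧ q.1 ≤ N ∧ q.2 ≤ N := fun q hq => by
    simp only [hs, hR, Finset.mem_product, Finset.mem_Ioc] at hq; omega
  have hpt : ∀ q ∈ s, ∀ r ∈ s, b q * b r * exp (-T * |x q - x r|) ≤
      (if r.1 * r.2 = q.1 * q.2 then b q * b r else 0) + b q * b r * (N ^ 2 / T) := by
    intro q hq r hr
    obtain ⟨q1, q2, q3, q4⟩ := hmem q hq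
    obtain ⟨r1, r2, r3, r4⟩ := hmem r hr
    have hbb := mul_nonneg (hb0 q) (hb0 r)
    split_ifs with h
    · have h1 : exp (-T * |x q - x r|) ≤ 1 := Real.exp_le_one_iff.2 (by nlinarith [abs_nonneg (x q - x r)])
      have h2 : 0 ≤ b q * b r * (N ^ 2 / T) := by positivity
      nlinarith
    · rw [zero_add]
      refine mLL ?_ hbb
      have hg := log_gap (q.1 * q.2) (r.1 * r.2) (N ^ 2) (by positivity) (by positivity) (fun h' => h h'.symm) (by nlinarith) (by nlinarith)
      push_cast at hg
      rw [Real.log_mul (by positivity) (by positivity), Real.log_mul (by positivity) (by positivity)] at hg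
      change _ ≤ |x q - x r| at hg
      have hpos : 0 < |x q - x r| := lt_of_lt_of_le (by positivity) hg
      have h1 := Real.add_one_le_exp (T * |x q - x r|)
      rw [neg_mul, Real.exp_neg, inv_le_comm₀ (Real.exp_pos _) (by positivity), inv_div]
      have h3 : T / (N:ℝ) ^ 2 ≤ T * |x q - x r| := by
        rw [div_eq_mul_one_div]; exact mLL hg hT.le
      linarith
  refine (Finset.sum_le_sum fun q hq => Finset.sum_le_sum fun r hr => hpt q hq r hr).trans ?_
  simp_rw [Finset.sum_add_distrib]
  rw [mul_add]
  refine add_le_add ?_ ?_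
  · have hbv : ∀ q ∈ s, b q ≤ A ^ 2 * (vonMangoldt q.1 * vonMangoldt q.2 / sqrt (q.1 * q.2 : ℕ)) := by
      intro q _
      calc b q ≤ (A * (vonMangoldt q.1 / sqrt q.1)) * (A * (vonMangoldt q.2 / sqrt q.2)) :=
            mul_le_mul (ha _) (ha _) (ha0 _) ((ha0 _).trans (ha _))
        _ = _ := by rw [Nat.cast_mul, Real.sqrt_mul (by positivity)]; field_simp
    have hd : ∀ q ∈ s, (∑ r ∈ s, if r.1 * r.2 = q.1 * q.2 then b q * b r else 0) ≤
        A ^ 4 * (2 * log N) ^ 2 * (vonMangoldt q.1 / q.1 * (vonMangoldt q.2 / q.2)) := by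
      intro q hq
      obtain ⟨q1, q2, q3, q4⟩ := hmem q hq
      have hM : (0:ℝ) < ((q.1 * q.2 : ℕ) : ℝ) := by exact_mod_cast Nat.mul_pos q1 q2
      rw [← Finset.sum_filter, ← Finset.mul_sum]
      have h1 : ∑ r ∈ s with r.1 * r.2 = q.1 * q.2, b r ≤ A ^ 2 / sqrt (q.1 * q.2 : ℕ) * (2 * log N) ^ 2 := by
        refine le_trans ?_ (mLL (lamConv N (q.1 * q.2) (Nat.mul_pos q1 q2) (by nlinarith)) (by positivity))
        rw [Finset.mul_sum]
        refine Finset.sum_le_sum fun r hr => ?_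
        rw [Finset.mem_filter] at hr
        have := hbv r hr.1
        rw [hr.2] at this
        exact this.trans (le_of_eq (by ring))
      have h2 := mul_le_mul (hbv q hq) h1 (Finset.sum_nonneg fun r _ => hb0 r) ((hb0 q).trans (hbv q hq))
      refine h2.trans (le_of_eq ?_)
      have h3 := Real.mul_self_sqrt hM.le
      have h4 : sqrt (q.1 * q.2 : ℕ) ≠ 0 := (Real.sqrt_pos.2 hM).ne'
      have h5 : (q.1:ℝ) ≠ 0 := by positivity
      have h6 : (q.2:ℝ) ≠ 0 := by positivity
      field_simp
      rw [sq (sqrt _), h3]; push_cast; ring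
    refine (Finset.sum_le_sum hd).trans (le_of_eq ?_)
    rw [← Finset.mul_sum, hs, Finset.sum_product, sq (Finset.sum _ _), Finset.sum_mul_sum]; ring
  · simp_rw [← Finset.sum_mul, ← Finset.mul_sum]
    rw [← Finset.sum_mul, ← sq]
    have h1 : ∑ q ∈ s, b q = (∑ n ∈ R, a n) ^ 2 := by
      rw [sq, Finset.sum_mul_sum, hs, Finset.sum_product]
    have h2 : ∑ n ∈ R, a n ≤ N * (A * log N) := by
      have : ∀ n ∈ R, a n ≤ A * log N := by
        intro n hn
        rw [hR, Finset.mem_Ioc] at hn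
        have hn1 : (1:ℝ) ≤ n := by exact_mod_cast hn.1
        refine (ha n).trans (mLL ?_ hA)
        refine (div_le_self (hv n) (Real.one_le_sqrt.2 hn1)).trans ?_
        exact ArithmeticFunction.vonMangoldt_le_log.trans (Real.log_le_log (by positivity) (by exact_mod_cast hn.2))
      refine (Finset.sum_le_card_nsmul _ _ _ this).trans (le_of_eq ?_)
      simp [hR]
    have h3 : 0 ≤ ∑ n ∈ R, a n := Finset.sum_nonneg fun n _ => ha0 n
    rw [h1]
    calc ((∑ n ∈ R, a n) ^ 2) ^ 2 * (N ^ 2 / T) ≤ ((N * (A * log N)) ^ 2) ^ 2 * (N ^ 2 / T) := by gcongr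
      _ = _ := by field_simp

lemma halfBound (v : ℝ → ℂ) (Y A : ℝ) (hY : 0 ≤ Y) (hv : ∀ x, 0 < x → x ≤ Y → ‖v x‖ ≤ A) (hz : ∀ x, Y < x → v x = 0) (t : ℝ) :
    ‖∫ x in Set.Ioi 0, v x * ek t x‖ ≤ A * Y := by
  rw [setIntegral_eq_of_subset_of_forall_diff_eq_zero (s := Set.Ioc 0 Y) measurableSet_Ioi Set.Ioc_subset_Ioi_self]
  · refine (norm_setIntegral_le_of_norm_le_const (C := A) measure_Ioc_lt_top fun x hx => ?_).trans (le_of_eq ?_)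
    · rw [norm_mul, ek_norm, mul_one]; exact hv x hx.1 hx.2
    · rw [Real.volume_real_Ioc_of_le hY, sub_zero]
  · intro x hx
    rw [hz x (by by_contra h; exact hx.2 ⟨hx.1, not_lt.1 h⟩), zero_mul]

lemma poleBound : ∃ C : ℝ, 0 < C ∧ ∀ Y : ℝ, 1 ≤ Y → ∀ t : ℝ,
    ‖∫ x, ((exp (|x| / 2) : ℝ) : ℂ) * (((bet (x / Y) / Y : ℝ) : ℂ) * ek (-t) x)‖ ≤ C * (exp (Y / 2) / (1 + |t|)) := by
  obtain ⟨Cb, hCb, hb1, hb2⟩ := bet_good.lip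
  refine ⟨12 * Cb, by positivity, fun Y hY t => ?_⟩
  have hY0 : 0 < Y := by linarith
  set uR : ℝ → ℝ := fun x => exp (x / 2) * (bet (x / Y) / Y) with huR
  set u : ℝ → ℂ := fun x => (uR x : ℂ) with hu
  have hz : ∀ x, Y ≤ |x| → uR x = 0 := fun x hx => by
    have : bet (x / Y) = 0 := bet_good.2.2.2 _ (by rw [abs_div, abs_of_pos hY0, le_div_iff₀ hY0]; linarith)
    simp [huR, this]
  have hcb : ContDiff ℝ 1 uR := by
    refine ContDiff.mul (Real.contDiff_exp.comp (contDiff_id.div_const _)) (ContDiff.div_const ((bet_good.1.of_le (by norm_num)).comp (contDiff_id.div_const _)) _)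
  have hcu : ContDiff ℝ 1 u := Complex.ofRealCLM.contDiff.comp hcb
  have hsu : HasCompactSupport u := HasCompactSupport.intro (isCompact_Icc (a := -Y) (b := Y)) fun x hx => by
    have : uR x = 0 := hz x (by by_contra hn; exact hx (abs_le.1 (not_le.1 hn).le))
    simp [hu, this]
  set A : ℝ := 2 * (Cb / Y) * exp (Y / 2) with hA
  have hA0 : 0 < A := by positivity
  have hbn := bet_good.2.1
  have hb : ∀ x, x ≤ Y → ‖u x‖ ≤ A := fun x hx => by
    rw [hu]; simp only
    rw [Complex.norm_real, Real.norm_of_nonneg (mul_nonneg (Real.exp_pos _).le (div_nonneg (hbn _) hY0.le)), hA]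
    have h1 : exp (x / 2) ≤ exp (Y / 2) := Real.exp_le_exp.2 (by linarith)
    calc _ ≤ exp (Y / 2) * (Cb / Y) := mul_le_mul h1 (div_le_div_of_nonneg_right (hb1 _) hY0.le) (div_nonneg (hbn _) hY0.le) (Real.exp_pos _).le
      _ ≤ _ := by nlinarith [Real.exp_pos (Y / 2), div_pos hCb hY0, mul_pos (Real.exp_pos (Y / 2)) (div_pos hCb hY0)]
  have hd : ∀ x, x ≤ Y → ‖deriv u x‖ ≤ A := fun x hx => by
    have hdb : ∀ y, |deriv bet y| ≤ Cb := fun y => by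
      have := norm_deriv_le_of_lip' (f := bet) (x₀ := y) hCb.le (Eventually.of_forall fun z => hb2 z y)
      exact this
    have h1 : HasDerivAt (fun x : ℝ => exp (x / 2)) (exp (x / 2) * (1 / 2)) x := ((hasDerivAt_id x).div_const 2).exp
    have h2 : HasDerivAt (fun x : ℝ => bet (x / Y) / Y) (deriv bet (x / Y) * (1 / Y) / Y) x := by
      have h3 : HasDerivAt bet (deriv bet (x / Y)) (x / Y) := (bet_good.1.differentiable (by norm_num) _).hasDerivAt
      exact (h3.comp x ((hasDerivAt_id x).div_const Y)).div_const Y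
    have h4 := (h1.mul h2).ofReal_comp
    rw [show deriv u x = _ from h4.deriv, Complex.norm_real, Real.norm_eq_abs]
    have h5 : exp (x / 2) ≤ exp (Y / 2) := Real.exp_le_exp.2 (by linarith)
    have h6 : |deriv bet (x / Y) * (1 / Y) / Y| ≤ Cb / Y := by
      rw [abs_div, abs_mul, abs_of_pos hY0, abs_of_pos (by positivity : 0 < 1 / Y)]
      refine div_le_div_of_nonneg_right ?_ hY0.le
      exact (mul_le_of_le_one_right (abs_nonneg _) (by rw [div_le_one hY0]; exact hY)).trans (hdb _)
    have h7 : bet (x / Y) / Y ≤ Cb / Y := div_le_div_of_nonneg_right (hb1 _) hY0.le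
    have h8 : 0 ≤ bet (x / Y) / Y := div_nonneg (hbn _) hY0.le
    refine (abs_add_le _ _).trans ?_
    rw [abs_mul, abs_of_nonneg h8, abs_of_pos (by positivity : 0 < exp (x / 2) * (1 / 2)), abs_mul, abs_of_pos (Real.exp_pos (x / 2)), hA]
    have h9 : exp (x / 2) * (1 / 2) * (bet (x / Y) / Y) ≤ exp (Y / 2) * (Cb / Y) :=
      mul_le_mul (by linarith [Real.exp_pos (x / 2)]) h7 h8 (Real.exp_pos _).le
    have h10 : exp (x / 2) * |deriv bet (x / Y) * (1 / Y) / Y| ≤ exp (Y / 2) * (Cb / Y) :=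
      mul_le_mul h5 h6 (abs_nonneg _) (Real.exp_pos _).le
    linarith
  have hz1 : ∀ x, Y < x → u x = 0 := fun x hx => by
    have : uR x = 0 := hz x (hx.le.trans (le_abs_self x))
    simp [hu, this]
  have hz2 : ∀ x, Y < x → deriv u x = 0 := fun x hx => by
    have : u =ᶠ[nhds x] fun _ => (0:ℂ) := by filter_upwards [Ioi_mem_nhds hx] with y hy using hz1 y hy
    rw [this.deriv_eq, deriv_const]
  have key : ∀ τ : ℝ, (1 + |τ|) * ‖∫ x in Set.Ioi 0, u x * ek τ x‖ ≤ 3 * (A * Y) := fun τ => by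
    have k1 := halfBound u Y A hY0.le (fun x _ hx => hb x hx) hz1 τ
    have k2 := halfBound (deriv u) Y A hY0.le (fun x _ hx => hd x hx) hz2 τ
    rw [(ibpMain u hcu hsu τ).1] at k2
    have k3 : |τ| * ‖∫ x in Set.Ioi 0, u x * ek τ x‖ = ‖(τ : ℂ) * Complex.I * ∫ x in Set.Ioi 0, u x * ek τ x‖ := by
      simp
    have k4 := norm_sub_le (-u 0) (-u 0 - τ * Complex.I * ∫ x in Set.Ioi 0, u x * ek τ x)
    rw [sub_sub_cancel, norm_neg] at k4
    have k5 := hb 0 hY0.le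
    nlinarith
  have hi : Integrable (fun x => ((exp (|x| / 2) : ℝ) : ℂ) * (((bet (x / Y) / Y : ℝ) : ℂ) * ek (-t) x)) := by
    refine Continuous.integrable_of_hasCompactSupport ?_ ?_
    · have := bet_good.1.continuous; have := ek_cont (-t); fun_prop
    · refine HasCompactSupport.intro (isCompact_Icc (a := -Y) (b := Y)) fun x hx => ?_
      have : bet (x / Y) = 0 := bet_good.2.2.2 _ (by
        rw [abs_div, abs_of_pos hY0, le_div_iff₀ hY0]; by_contra hn; exact hx (abs_le.1 (by linarith)))
      simp [this]
  rw [← intervalIntegral.integral_Iic_add_Ioi hi.integrableOn hi.integrableOn (b := 0)]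
  have e1 : ∫ x in Set.Ioi 0, ((exp (|x| / 2) : ℝ) : ℂ) * (((bet (x / Y) / Y : ℝ) : ℂ) * ek (-t) x) = ∫ x in Set.Ioi 0, u x * ek (-t) x := by
    refine setIntegral_congr_fun measurableSet_Ioi fun x hx => ?_
    simp only [hu, huR]; rw [abs_of_pos hx]; push_cast; ring
  have e2 : ∫ x in Set.Iic 0, ((exp (|x| / 2) : ℝ) : ℂ) * (((bet (x / Y) / Y : ℝ) : ℂ) * ek (-t) x) = ∫ x in Set.Ioi 0, u x * ek t x := by
    rw [← neg_zero, ← integral_comp_neg_Iic, neg_zero]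
    refine setIntegral_congr_fun measurableSet_Iic fun x hx => ?_
    simp only [hu, huR]; rw [abs_of_nonpos hx, show -x / Y = -(x / Y) by ring, bet_good.2.2.1]
    unfold ek; push_cast; ring_nf
  rw [e1, e2]
  refine (norm_add_le _ _).trans ?_
  have k1 := key t
  have k2 := key (-t)
  rw [abs_neg] at k2
  have hAY : A * Y = 2 * Cb * exp (Y / 2) := by rw [hA]; field_simp
  rw [mul_div_assoc', le_div_iff₀ (by positivity)]
  nlinarith

/-- Dirichlet polynomial coefficients. -/
def aY (Y : ℝ) (n : ℕ) : ℝ := vonMangoldt n / sqrt n * (bet (log n / Y) / Y)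

lemma ek_sub_one (t x : ℝ) : ‖ek t x - 1‖ ≤ |t| * |x| := by
  have := Real.norm_exp_I_mul_ofReal_sub_one_le (x := t * x)
  rwa [mul_comm Complex.I, Real.norm_eq_abs, abs_mul] at this

lemma MmBound (hRH : RiemannHypothesis) : ∃ C : ℝ, 0 < C ∧ ∀ Y : ℝ, 1 ≤ Y → ∀ t : ℝ, ∀ F : Finset ℝ,
    ∑ γ ∈ F, (ordMult γ : ℝ) * w0 (Y * (γ - t)) ≤ C * (1 + log (2 + |t|) / Y + exp (Y / 2) / (1 + |t|))
      + 2 * ‖∑ n ∈ Finset.Ioc 0 ⌊exp Y⌋₊, (aY Y n : ℂ) * ek (-t) (log n)‖ := by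
  obtain ⟨Cb, hCb, hb1, hb2⟩ := bet_good.lip
  obtain ⟨Cp, hCp, hpole⟩ := poleBound
  refine ⟨Cp + 2 * |kap| * Cb + 5 * Cb, by positivity, fun Y hY t F => ?_⟩
  have hY0 : 0 < Y := by linarith
  have hbn := bet_good.2.1
  set g : ℝ → ℂ := fun x => ((bet (x / Y) / Y : ℝ) : ℂ) * ek (-t) x with hg
  have hz : ∀ x, Y ≤ |x| → g x = 0 := fun x hx => by
    have : bet (x / Y) = 0 := bet_good.2.2.2 _ (by rw [abs_div, abs_of_pos hY0, le_div_iff₀ hY0]; linarith)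
    simp [hg, this]
  have hgs : ContDiff ℝ 2 g := by
    refine ContDiff.mul (Complex.ofRealCLM.contDiff.comp (ContDiff.div_const (bet_good.1.comp (contDiff_id.div_const _)) _)) ?_
    unfold ek
    exact ((Complex.ofRealCLM.contDiff.comp (contDiff_const.mul contDiff_id)).mul contDiff_const).cexp
  have hgc : HasCompactSupport g := HasCompactSupport.intro (isCompact_Icc (a := -Y) (b := Y)) fun x hx =>
    hz x (by by_contra hn; exact hx (abs_le.1 (not_le.1 hn).le))
  obtain ⟨G, P, hG, hP, hZ⟩ := EF hRH g hgs hgc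
  have gn : ∀ x, ‖g x‖ ≤ Cb / Y := fun x => by
    rw [hg]; simp only
    rw [norm_mul, ek_norm, mul_one, Complex.norm_real, Real.norm_of_nonneg (div_nonneg (hbn _) hY0.le)]
    exact div_le_div_of_nonneg_right (hb1 _) hY0.le
  have g1 : ∀ x, ‖g x - g 0‖ ≤ (Cb / Y * (1 + |t|)) * |x| := fun x => by
    have e : g x - g 0 = ((bet (x / Y) / Y - bet (0 / Y) / Y : ℝ) : ℂ) * ek (-t) x + ((bet (0 / Y) / Y : ℝ) : ℂ) * (ek (-t) x - 1) := by
      rw [hg]; simp only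
      have : ek (-t) 0 = 1 := by simp [ek]
      rw [this]; push_cast; ring
    rw [e]
    refine (norm_add_le _ _).trans ?_
    rw [norm_mul, norm_mul, ek_norm, mul_one, Complex.norm_real, Complex.norm_real, Real.norm_eq_abs, Real.norm_of_nonneg (div_nonneg (hbn _) hY0.le), ← sub_div, abs_div, abs_of_pos hY0]
    have h1 := hb2 (x / Y) (0 / Y)
    rw [← sub_div, sub_zero, abs_div, abs_of_pos hY0] at h1
    have h2 := ek_sub_one (-t) x
    rw [abs_neg] at h2
    have h3 : |bet (x / Y) - bet (0 / Y)| / Y ≤ Cb / Y * |x| := by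
      calc _ ≤ (Cb * (|x| / Y)) / Y := div_le_div_of_nonneg_right h1 hY0.le
        _ = (Cb / Y * |x|) * (1 / Y) := by field_simp
        _ ≤ _ := mul_le_of_le_one_right (by positivity) (by rw [div_le_one hY0]; exact hY)
    have h4 : bet (0 / Y) / Y * ‖ek (-t) x - 1‖ ≤ Cb / Y * (|t| * |x|) :=
      mul_le_mul (div_le_div_of_nonneg_right (hb1 _) hY0.le) h2 (norm_nonneg _) (by positivity)
    linarith
  -- gamma part
  set K := ⌈1 + |t|⌉₊ with hK
  have hKl : 1 + |t| ≤ K := Nat.le_ceil _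
  have hKu : (K:ℝ) < 1 + |t| + 1 := Nat.ceil_lt_add_one (by positivity)
  have hK1 : 1 ≤ K := by exact_mod_cast (show (1:ℝ) ≤ K by linarith [abs_nonneg t])
  have hKp : (0:ℝ) < K := by exact_mod_cast hK1
  have hh := harm_le K hK1
  set H : ℝ := ∑ k ∈ Finset.range K, 1 / ((k : ℝ) + 1) with hH
  have hH0 : 0 ≤ H := Finset.sum_nonneg fun i _ => by positivity
  have hlogK : log K ≤ log (2 + |t|) := Real.log_le_log hKp (by linarith)
  have hGt := gammaTail g hgs.continuous hgc (Cb / Y) _ (gn 0) g1 G hG K hK1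
  have hI : ∑ k ∈ Finset.range K, ‖∫ x, ((exp (-(2 * k + 5 / 2) * |x|) : ℝ) : ℂ) * g x‖ ≤ Cb / Y * H := by
    rw [hH, Finset.mul_sum]
    refine Finset.sum_le_sum fun k _ => (expAbsBound _ (by positivity) g _ gn).trans ?_
    rw [mul_one_div, div_le_div_iff₀ (by positivity) (by positivity)]
    nlinarith [div_pos hCb hY0]
  have hGb : ‖G‖ ≤ 5 * Cb * (1 + log (2 + |t|) / Y) := by
    have h1 : ‖G‖ ≤ ‖G - g 0 * (H : ℂ)‖ + ‖g 0 * (H : ℂ)‖ := by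
      have := norm_add_le (G - g 0 * (H : ℂ)) (g 0 * (H : ℂ)); rwa [sub_add_cancel] at this
    have h2 : ‖g 0 * (H : ℂ)‖ ≤ Cb / Y * H := by
      rw [norm_mul, Complex.norm_real, Real.norm_of_nonneg hH0]; exact mLR (gn 0) hH0
    have h3 : (Cb / Y + 2 * (Cb / Y * (1 + |t|))) / K ≤ 3 * (Cb / Y) := by
      rw [div_le_iff₀ hKp]
      nlinarith [div_pos hCb hY0, abs_nonneg t, mul_nonneg (div_pos hCb hY0).le (sub_nonneg.2 hKl), mul_nonneg (div_pos hCb hY0).le (abs_nonneg t)]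
    have h4 : Cb / Y * H ≤ Cb / Y * (1 + log (2 + |t|)) := mLL (by linarith) (by positivity)
    have h5 : Cb / Y ≤ Cb := div_le_self hCb.le hY
    have h6 : Cb / Y * log (2 + |t|) = Cb * (log (2 + |t|) / Y) := by ring
    have h7 : 0 ≤ Cb * (log (2 + |t|) / Y) := by
      have : 0 ≤ log (2 + |t|) := Real.log_nonneg (by linarith [abs_nonneg t])
      positivity
    linarith
  -- primes
  have hPb : ‖P‖ ≤ 2 * ‖∑ n ∈ Finset.Ioc 0 ⌊exp Y⌋₊, (aY Y n : ℂ) * ek (-t) (log n)‖ := by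
    have hf : ∀ n ∉ Finset.Ioc 0 ⌊exp Y⌋₊, ((vonMangoldt n / sqrt n : ℝ) : ℂ) * (g (log n) + g (-log n)) = 0 := by
      intro n hn
      rcases Nat.eq_zero_or_pos n with rfl | h0
      · simp
      · have h1 : ⌊exp Y⌋₊ < n := by
          by_contra h; exact hn (Finset.mem_Ioc.2 ⟨h0, by omega⟩)
        have h2 : exp Y < n := (Nat.floor_lt (Real.exp_pos _).le).1 h1
        have h3 : Y ≤ log n := (Real.lt_log_iff_exp_lt (by positivity)).2 h2 |>.le
        rw [hz _ (h3.trans (le_abs_self _)), hz _ (by rw [abs_neg]; exact h3.trans (le_abs_self _))]; simp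
    have h1 := hP.unique (hasSum_sum_of_ne_finset_zero hf)
    set D := ∑ n ∈ Finset.Ioc 0 ⌊exp Y⌋₊, (aY Y n : ℂ) * ek (-t) (log n) with hD
    have h2 : P = D + (starRingEnd ℂ) D := by
      rw [h1, hD, map_sum, ← Finset.sum_add_distrib]
      refine Finset.sum_congr rfl fun n _ => ?_
      have h3 : (starRingEnd ℂ) (ek (-t) (log n)) = ek (-t) (-log n) := by
        unfold ek; rw [← Complex.exp_conj, map_mul, Complex.conj_ofReal, Complex.conj_I]; push_cast; ring_nf
      rw [map_mul, Complex.conj_ofReal, h3, hg]; simp only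
      rw [show -log n / Y = -(log n / Y) by ring, bet_good.2.2.1, aY]; push_cast; ring
    rw [h2]
    refine (norm_add_le _ _).trans ?_
    rw [RCLike.norm_conj]; linarith
  -- zeros
  have hft : ∀ γ : ℝ, ∫ x, g x * ek γ x = (w0 (Y * (γ - t)) : ℂ) := by
    intro γ
    have e1 : ∀ x, g x * ek γ x = (fun y => ((1 / Y : ℝ) : ℂ) * ((bet y : ℂ) * ek (Y * (γ - t)) y)) (x / Y) := by
      intro x
      have h2 : ek (Y * (γ - t)) (x / Y) = ek (-t) x * ek γ x := by
        unfold ek; rw [← Complex.exp_add]; congr 1; rw [show Y * (γ - t) * (x / Y) = (γ - t) * x by field_simp]; push_cast; ring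
      simp only [hg, h2]; push_cast; ring
    simp_rw [e1]
    rw [Measure.integral_comp_div (fun y => ((1 / Y : ℝ) : ℂ) * ((bet y : ℂ) * ek (Y * (γ - t)) y)), integral_const_mul, bet_ft, abs_of_pos hY0, Complex.real_smul]
    push_cast
    have : (Y:ℂ) ≠ 0 := by exact_mod_cast hY0.ne'
    field_simp
  simp_rw [hft] at hZ
  have hZr := Complex.hasSum_re hZ
  have hle := sum_le_hasSum F (fun γ _ => by
    have : ((ordMult γ : ℂ) * (w0 (Y * (γ - t)) : ℂ)).re = (ordMult γ : ℝ) * w0 (Y * (γ - t)) := by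
      rw [← Complex.ofReal_natCast, ← Complex.ofReal_mul, Complex.ofReal_re]
    rw [this]; exact mul_nonneg (Nat.cast_nonneg _) (w0_nonneg _)) hZr
  have he : ∀ γ : ℝ, ((ordMult γ : ℂ) * (w0 (Y * (γ - t)) : ℂ)).re = (ordMult γ : ℝ) * w0 (Y * (γ - t)) := fun γ => by
    rw [← Complex.ofReal_natCast, ← Complex.ofReal_mul, Complex.ofReal_re]
  simp_rw [he] at hle
  refine hle.trans ((Complex.re_le_norm _).trans ?_)
  have hp := hpole Y hY t
  set pl := ∫ x, ((exp (|x| / 2) : ℝ) : ℂ) * g x with hpl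
  have hk : ‖2 * (kap : ℂ) * g 0‖ ≤ 2 * |kap| * Cb := by
    rw [norm_mul, norm_mul, Complex.norm_real, Complex.norm_two, Real.norm_eq_abs]
    exact mLL ((gn 0).trans (div_le_self hCb.le hY)) (by positivity)
  have hsum : ‖pl + 2 * kap * g 0 + G - P‖ ≤ ‖pl‖ + ‖2 * (kap : ℂ) * g 0‖ + ‖G‖ + ‖P‖ := by
    refine (norm_sub_le _ _).trans ?_
    have := norm_add_le (pl + 2 * kap * g 0) G
    have := norm_add_le pl (2 * kap * g 0)
    linarith
  have hlg : 0 ≤ log (2 + |t|) / Y := div_nonneg (Real.log_nonneg (by linarith [abs_nonneg t])) hY0.le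
  have hex : 0 ≤ exp (Y / 2) / (1 + |t|) := by positivity
  have hq1 : 0 ≤ |kap| * Cb * (log (2 + |t|) / Y) := by positivity
  have hq2 : 0 ≤ |kap| * Cb * (exp (Y / 2) / (1 + |t|)) := by positivity
  have hq3 : 0 ≤ Cp * (log (2 + |t|) / Y) := by positivity
  have hq4 : 0 ≤ Cb * (exp (Y / 2) / (1 + |t|)) := by positivity
  have hfin : ‖pl‖ + ‖2 * (kap : ℂ) * g 0‖ + ‖G‖ + ‖P‖ ≤ _ := add_le_add (add_le_add (add_le_add hp hk) hGb) hPb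
  refine (hsum.trans hfin).trans ?_
  nlinarith

lemma four3 (a b c : ℝ) : (a + b + c) ^ 4 ≤ 27 * (a ^ 4 + b ^ 4 + c ^ 4) := by
  have h1 : (a + b + c) ^ 2 ≤ 3 * (a ^ 2 + b ^ 2 + c ^ 2) := by nlinarith [sq_nonneg (a - b), sq_nonneg (a - c), sq_nonneg (b - c)]
  have h2 : ((a + b + c) ^ 2) ^ 2 ≤ (3 * (a ^ 2 + b ^ 2 + c ^ 2)) ^ 2 := pow_le_pow_left₀ (sq_nonneg _) h1 2
  nlinarith [sq_nonneg (a ^ 2 - b ^ 2), sq_nonneg (a ^ 2 - c ^ 2), sq_nonneg (b ^ 2 - c ^ 2)]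

lemma logW (s : ℝ) : 1 / (1 + s ^ 2) * (9 + 8 * log (2 + |s|)) ^ 4 ≤ 2 * 73 ^ 4 * (1 + ‖s‖ ^ 2) ^ (-(3 / 2 : ℝ) / 2) := by
  have hp : 0 < 2 + |s| := by positivity
  have h1 : log (2 + |s|) ≤ 8 * (2 + |s|) ^ (1 / 8 : ℝ) := by
    have := Real.log_le_rpow_div hp.le (show (0:ℝ) < 1 / 8 by norm_num)
    linarith
  have h0 : 0 ≤ log (2 + |s|) := Real.log_nonneg (by linarith [abs_nonneg s])
  have h2 : 1 ≤ (2 + |s|) ^ (1 / 8 : ℝ) := Real.one_le_rpow (by linarith [abs_nonneg s]) (by norm_num)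
  have h3 : (9 + 8 * log (2 + |s|)) ^ 4 ≤ (73 * (2 + |s|) ^ (1 / 8 : ℝ)) ^ 4 := pow_le_pow_left₀ (by positivity) (by linarith) 4
  have h4 : ((2 + |s|) ^ (1 / 8 : ℝ)) ^ 4 = (2 + |s|) ^ (1 / 2 : ℝ) := by
    rw [← Real.rpow_natCast, ← Real.rpow_mul hp.le]; norm_num
  have hq : 0 < 1 + s ^ 2 := by positivity
  have h5 : (2 + |s|) ^ (1 / 2 : ℝ) ≤ 2 * (1 + s ^ 2) ^ (1 / 4 : ℝ) := by
    have e : 2 * (1 + s ^ 2) ^ (1 / 4 : ℝ) = (16 * (1 + s ^ 2)) ^ (1 / 4 : ℝ) := by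
      rw [Real.mul_rpow (by norm_num) hq.le, show (16:ℝ) = 2 ^ (4:ℝ) by norm_num, ← Real.rpow_mul (by norm_num)]; norm_num
    have e2 : (2 + |s|) ^ (1 / 2 : ℝ) = ((2 + |s|) ^ 2) ^ (1 / 4 : ℝ) := by
      rw [← Real.rpow_natCast (2 + |s|), ← Real.rpow_mul hp.le]; norm_num
    rw [e, e2]
    refine Real.rpow_le_rpow (by positivity) ?_ (by norm_num)
    nlinarith [sq_abs s, sq_nonneg (|s| - 1), abs_nonneg s, sq_nonneg s]
  rw [mul_pow, h4] at h3
  have h6 : (1 + ‖s‖ ^ 2) ^ (-(3 / 2 : ℝ) / 2) = (1 + s ^ 2) ^ (1 / 4 : ℝ) / (1 + s ^ 2) := by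
    rw [Real.norm_eq_abs, sq_abs, show -(3 / 2 : ℝ) / 2 = 1 / 4 - 1 by norm_num, Real.rpow_sub_one hq.ne']
  rw [h6, one_div, inv_mul_le_iff₀ hq]
  calc _ ≤ _ := h3
    _ ≤ 73 ^ 4 * (2 * (1 + s ^ 2) ^ (1 / 4 : ℝ)) := by gcongr
    _ = _ := by field_simp

lemma HInt (hRH : RiemannHypothesis) : ∃ C : ℝ, 0 < C ∧ ∀ T : ℝ, 8 ≤ log T → 0 < T → ∃ H : ℝ → ℝ,
    (∀ t, 0 ≤ H t) ∧ Integrable (fun t => Wt T t * H t ^ 3) ∧ ∫ t, Wt T t * H t ^ 3 ≤ C * T ∧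
    ∀ t, ∀ F : Finset ℝ, ∑ γ ∈ F, (ordMult γ : ℝ) * w0 (log T / 8 * (γ - t)) ≤ H t := by
  obtain ⟨C, hC, hM⟩ := MmBound hRH
  obtain ⟨Cb, hCb, hb1, -⟩ := bet_good.lip
  obtain ⟨Cm, hCm, hmert⟩ := mertU
  have hbn := bet_good.2.1
  have hJi : Integrable (fun s : ℝ => (1 + ‖s‖ ^ 2) ^ (-(3 / 2 : ℝ) / 2)) := integrable_rpow_neg_one_add_norm_sq (by simp; norm_num)
  set J := ∫ s : ℝ, (1 + ‖s‖ ^ 2) ^ (-(3 / 2 : ℝ) / 2) with hJ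
  have hJ0 : 0 ≤ J := integral_nonneg fun s => by positivity
  refine ⟨π + 27 * (C ^ 4 * (2 * 73 ^ 4) * J + C ^ 4 * π + 16 * (π * (Cb ^ 4 * (4 * (1 + Cm) ^ 2 + 1)))), by positivity, fun T hL hT => ?_⟩
  set L := log T with hLd
  set Y := L / 8 with hY
  have hY1 : 1 ≤ Y := by rw [hY]; linarith
  have hY0 : 0 < Y := by linarith
  have hTe : exp (8 * Y) = T := by rw [hY, show 8 * (L / 8) = L by ring, hLd, Real.exp_log hT]
  have hT1 : 1 ≤ T := by rw [← hTe]; exact Real.one_le_exp (by positivity)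
  set N := ⌊exp Y⌋₊ with hN
  have hN1 : 1 ≤ N := Nat.le_floor (by simpa using Real.one_le_exp hY0.le)
  have hNe : (N:ℝ) ≤ exp Y := Nat.floor_le (Real.exp_pos _).le
  have hNp : (0:ℝ) < N := by exact_mod_cast hN1
  have hlN : log N ≤ Y := by rw [Real.log_le_iff_le_exp hNp]; exact hNe
  have hlN0 : 0 ≤ log N := Real.log_nonneg (by exact_mod_cast hN1)
  set D : ℝ → ℂ := fun t => ∑ n ∈ Finset.Ioc 0 N, (aY Y n : ℂ) * ek (-t) (log n) with hD
  have hDc : Continuous D := by rw [hD]; unfold ek; fun_prop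
  have hDb : ∀ t, ‖D t‖ ≤ ∑ n ∈ Finset.Ioc 0 N, |aY Y n| := fun t => by
    refine (norm_sum_le _ _).trans (Finset.sum_le_sum fun n _ => ?_)
    rw [norm_mul, ek_norm, mul_one, Complex.norm_real, Real.norm_eq_abs]
  have hl0 : ∀ t : ℝ, 0 ≤ log (2 + |t|) := fun t => Real.log_nonneg (by linarith [abs_nonneg t])
  set a : ℝ → ℝ := fun t => C * (1 + log (2 + |t|) / Y) with ha
  set b : ℝ → ℝ := fun t => C * (exp (Y / 2) / (1 + |t|)) with hb
  have ha0 : ∀ t, 0 ≤ a t := fun t => by have := hl0 t; rw [ha]; positivity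
  have hb0 : ∀ t, 0 ≤ b t := fun t => by rw [hb]; positivity
  set H : ℝ → ℝ := fun t => a t + b t + 2 * ‖D t‖ with hH
  have hH0 : ∀ t, 0 ≤ H t := fun t => by have := ha0 t; have := hb0 t; rw [hH]; positivity
  have hHc : Continuous H := by
    have h1 : ∀ t : ℝ, 2 + |t| ≠ 0 := fun t => by positivity
    have h2 : ∀ t : ℝ, 1 + |t| ≠ 0 := fun t => by positivity
    rw [hH, ha, hb]
    refine ((continuous_const.mul (continuous_const.add ((Continuous.log (by fun_prop) h1).div_const _))).add (continuous_const.mul (continuous_const.div (by fun_prop) h2))).add (continuous_const.mul hDc.norm)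
  have hWa : ∀ t, Wt T t * a t ^ 4 ≤ C ^ 4 * (2 * 73 ^ 4) * (1 + ‖t / T‖ ^ 2) ^ (-(3 / 2 : ℝ) / 2) := fun t => by
    have h1 : log (2 + |t|) ≤ L + log (2 + |t / T|) := by
      rw [hLd, ← Real.log_mul hT.ne' (by positivity)]
      refine Real.log_le_log (by positivity) ?_
      rw [mul_add, abs_div, abs_of_pos hT, mul_div_cancel₀ _ hT.ne']; linarith
    have h2 : 1 + log (2 + |t|) / Y ≤ 9 + 8 * log (2 + |t / T|) := by
      have : log (2 + |t|) / Y ≤ 8 + 8 * log (2 + |t / T|) := by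
        rw [div_le_iff₀ hY0]; nlinarith [mul_nonneg (hl0 (t / T)) (sub_nonneg.2 hY1), hl0 (t / T)]
      linarith
    have h3 : a t ^ 4 ≤ C ^ 4 * (9 + 8 * log (2 + |t / T|)) ^ 4 := by
      rw [ha, ← mul_pow]
      exact pow_le_pow_left₀ (ha0 t) (mLL h2 hC.le) 4
    calc _ ≤ Wt T t * (C ^ 4 * (9 + 8 * log (2 + |t / T|)) ^ 4) := mLL h3 (Wt_pos _ _).le
      _ = C ^ 4 * (1 / (1 + (t / T) ^ 2) * (9 + 8 * log (2 + |t / T|)) ^ 4) := by unfold Wt; ring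
      _ ≤ _ := by rw [mul_assoc]; exact mLL (logW _) (by positivity)
  have hW1 : ∀ t, Wt T t ≤ 1 := fun t => by unfold Wt; rw [div_le_one (by positivity)]; linarith [sq_nonneg (t / T)]
  have hWb : ∀ t, Wt T t * b t ^ 4 ≤ C ^ 4 * T * Wt 1 t := fun t => by
    have h1 : exp (Y / 2) ^ 4 ≤ T := by
      rw [← Real.exp_nat_mul, ← hTe]; exact Real.exp_le_exp.2 (by push_cast; linarith)
    have h2 : 1 / (1 + |t|) ^ 4 ≤ Wt 1 t := by
      unfold Wt; refine one_div_le_one_div_of_le (by positivity) ?_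
      rw [div_one, ← sq_abs t]
      have := abs_nonneg t
      nlinarith [pow_nonneg this 3, pow_nonneg this 4, pow_nonneg this 2]
    calc _ ≤ 1 * b t ^ 4 := mLR (hW1 t) (pow_nonneg (hb0 t) _)
      _ = C ^ 4 * exp (Y / 2) ^ 4 * (1 / (1 + |t|) ^ 4) := by simp only [hb]; rw [mul_pow, div_pow]; field_simp
      _ ≤ _ := mul_le_mul (mLL h1 (by positivity)) h2 (by positivity) (by positivity)
  set Φ : ℝ → ℝ := fun t => Wt T t + 27 * (C ^ 4 * (2 * 73 ^ 4) * (1 + ‖t / T‖ ^ 2) ^ (-(3 / 2 : ℝ) / 2) + C ^ 4 * T * Wt 1 t + 16 * (Wt T t * ‖D t‖ ^ 4)) with hΦ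
  have hle : ∀ t, Wt T t * H t ^ 3 ≤ Φ t := fun t => by
    have h1 : H t ^ 3 ≤ 1 + H t ^ 4 := by
      have := hH0 t
      rcases le_total (H t) 1 with h | h
      · linarith [pow_le_one₀ this h (n := 3), pow_nonneg this 4]
      · linarith [pow_le_pow_right₀ h (show 3 ≤ 4 by norm_num)]
    have h2 := four3 (a t) (b t) (2 * ‖D t‖)
    have h3 : H t ^ 3 ≤ 1 + 27 * (a t ^ 4 + b t ^ 4 + (2 * ‖D t‖) ^ 4) := by linarith
    have h4 := mLL h3 (Wt_pos T t).le
    have := hWa t; have := hWb t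
    rw [hΦ]; simp only; nlinarith
  have hi1 := Wt_int T hT
  have hi2 : Integrable (fun t : ℝ => (1 + ‖t / T‖ ^ 2) ^ (-(3 / 2 : ℝ) / 2)) := hJi.comp_div hT.ne'
  have hi3 := Wt_int 1 one_pos
  have hi4 : Integrable (fun t => Wt T t * ‖D t‖ ^ 4) := by
    refine hi1.mul_bdd (c := (∑ n ∈ Finset.Ioc 0 N, |aY Y n|) ^ 4) (hDc.norm.pow 4).aestronglyMeasurable (ae_of_all _ fun t => ?_)
    rw [norm_pow, norm_norm]; exact pow_le_pow_left₀ (norm_nonneg _) (hDb t) 4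
  have hi5 : Integrable (fun t => C ^ 4 * (2 * 73 ^ 4) * (1 + ‖t / T‖ ^ 2) ^ (-(3 / 2 : ℝ) / 2) + C ^ 4 * T * Wt 1 t) := ((hi2.const_mul (C ^ 4 * (2 * 73 ^ 4))).add (hi3.const_mul (C ^ 4 * T)))
  have hΦi : Integrable Φ := hi1.add ((hi5.add (hi4.const_mul 16)).const_mul 27)
  have hHi : Integrable (fun t => Wt T t * H t ^ 3) := hΦi.mono' ((Wt_cont T).mul (hHc.pow 3)).aestronglyMeasurable (ae_of_all _ fun t => by
    rw [Real.norm_of_nonneg (mul_nonneg (Wt_pos _ _).le (pow_nonneg (hH0 t) _))]; exact hle t)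
  refine ⟨H, hH0, hHi, ?_, fun t F => ?_⟩
  · refine (integral_mono hHi hΦi hle).trans ?_
    have eW : ∀ S : ℝ, 0 < S → ∫ t, Wt S t = π * S := fun S hS => by
      have : ∀ t, Wt S t = (fun s : ℝ => (1 + s ^ 2)⁻¹) (t / S) := fun t => by simp [Wt]
      simp_rw [this]; rw [Measure.integral_comp_div (fun s : ℝ => (1 + s ^ 2)⁻¹), integral_univ_inv_one_add_sq, abs_of_pos hS, smul_eq_mul, mul_comm]
    have e2 : ∫ t : ℝ, (1 + ‖t / T‖ ^ 2) ^ (-(3 / 2 : ℝ) / 2) = T * J := by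
      rw [Measure.integral_comp_div (fun s : ℝ => (1 + ‖s‖ ^ 2) ^ (-(3 / 2 : ℝ) / 2)), abs_of_pos hT, smul_eq_mul]
    have e3 : ∫ t, Wt T t * ‖D t‖ ^ 4 ≤ π * T * (Cb ^ 4 * (4 * (1 + Cm) ^ 2 + 1)) := by
      have h := fourth N hN1 (aY Y) (Cb / Y) (by positivity) (fun n => mul_nonneg (div_nonneg ArithmeticFunction.vonMangoldt_nonneg (Real.sqrt_nonneg _)) (div_nonneg (hbn _) hY0.le))
        (fun n => by
          rw [aY, mul_comm]
          exact mLR (div_le_div_of_nonneg_right (hb1 _) hY0.le) (div_nonneg ArithmeticFunction.vonMangoldt_nonneg (Real.sqrt_nonneg _))) T hT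
      refine h.trans (mLL ?_ (by positivity))
      have hs0 : 0 ≤ ∑ n ∈ Finset.Ioc 0 N, vonMangoldt n / (n:ℝ) := Finset.sum_nonneg fun n _ => div_nonneg ArithmeticFunction.vonMangoldt_nonneg (Nat.cast_nonneg _)
      have hs : ∑ n ∈ Finset.Ioc 0 N, vonMangoldt n / (n:ℝ) ≤ Y * (1 + Cm) := by
        have := hmert N hN1; nlinarith
      have hn6 : (N:ℝ) ^ 6 / T ≤ 1 := by
        rw [div_le_one hT, ← hTe]
        refine (pow_le_pow_left₀ hNp.le hNe 6).trans ?_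
        rw [← Real.exp_nat_mul]; exact Real.exp_le_exp.2 (by push_cast; linarith)
      have h1 : (2 * log N) ^ 2 * (∑ n ∈ Finset.Ioc 0 N, vonMangoldt n / (n:ℝ)) ^ 2 ≤ (2 * Y) ^ 2 * (Y * (1 + Cm)) ^ 2 := by gcongr
      have h2 : log N ^ 4 * (N:ℝ) ^ 6 / T ≤ Y ^ 4 * 1 := by
        rw [mul_div_assoc]; gcongr
      calc _ ≤ (Cb / Y) ^ 4 * ((2 * Y) ^ 2 * (Y * (1 + Cm)) ^ 2 + Y ^ 4 * 1) := by gcongr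
        _ = _ := by field_simp; ring
    have hint : ∫ t, Φ t = π * T + 27 * (C ^ 4 * (2 * 73 ^ 4) * (T * J) + C ^ 4 * T * (π * 1) + 16 * ∫ t, Wt T t * ‖D t‖ ^ 4) := by
      have k1 : ∫ t, Φ t = (∫ t, Wt T t) + ∫ t, 27 * _ := integral_add hi1 ((hi5.add (hi4.const_mul 16)).const_mul 27)
      rw [k1, integral_const_mul, integral_add hi5 (hi4.const_mul 16), integral_add (hi2.const_mul _) (hi3.const_mul _), integral_const_mul, integral_const_mul, integral_const_mul, e2, eW T hT, eW 1 one_pos]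
    rw [hint]
    nlinarith
  · have := hM Y hY1 t F
    rw [hH, ha, hb]; simp only; linarith

lemma cluster (hRH : RiemannHypothesis) : ∃ C : ℝ, 0 < C ∧ ∀ T : ℝ, 8 ≤ log T → 0 < T → ∀ F : Finset ℝ,
    ∑ γ ∈ F, (ordMult γ : ℝ) * Wt T γ * (∑ γ' ∈ F.filter (fun γ' => |γ' - γ| ≤ 4 / log T), (ordMult γ' : ℝ)) ^ 2 ≤ C * T * log T := by
  obtain ⟨C, hC, hH⟩ := HInt hRH
  obtain ⟨c, hc, hw⟩ := w0_lower
  refine ⟨2 * C / c ^ 3, by positivity, fun T hL hT F => ?_⟩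
  obtain ⟨H, hH0, hHi, hHb, hHs⟩ := hH T hL hT
  set L := log T with hLd
  have hL0 : 0 < L := by linarith
  have hT1 : 1 ≤ T := by
    by_contra h; have := Real.log_nonpos hT.le (not_le.1 h).le; linarith
  set n : ℝ → ℝ := fun γ => ∑ γ' ∈ F.filter (fun γ' => |γ' - γ| ≤ 4 / L), (ordMult γ' : ℝ) with hn
  have hn0 : ∀ γ, 0 ≤ n γ := fun γ => Finset.sum_nonneg fun _ _ => Nat.cast_nonneg _
  have key : ∀ (t : ℝ) (S : Finset ℝ), (∀ γ ∈ S, |γ - t| ≤ 5 / L) → c * ∑ γ ∈ S, (ordMult γ : ℝ) ≤ H t := fun t S hS => by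
    refine le_trans ?_ (hHs t S)
    rw [Finset.mul_sum]
    refine Finset.sum_le_sum fun γ hγ => ?_
    rw [mul_comm]
    refine mLL (hw _ ?_) (Nat.cast_nonneg _)
    rw [abs_mul, abs_of_pos (by positivity)]
    calc L / 8 * |γ - t| ≤ L / 8 * (5 / L) := mLL (hS γ hγ) (by positivity)
      _ = 5 / 8 := by field_simp
      _ ≤ 1 := by norm_num
  have hnt : ∀ γ t, |t - γ| ≤ 1 / L → n γ ≤ H t / c := fun γ t h => by
    rw [le_div_iff₀ hc, mul_comm]
    refine key t _ fun γ' hγ' => ?_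
    have h1 := (Finset.mem_filter.1 hγ').2
    have h2 := abs_sub_le γ' γ t
    rw [abs_sub_comm γ t] at h2
    have : (5:ℝ) / L = 4 / L + 1 / L := by ring
    linarith
  have hW : ∀ γ t, |t - γ| ≤ 1 / L → Wt T γ ≤ 4 * Wt T t := fun γ t h => by
    have h1 : |t - γ| ≤ 1 := h.trans (by rw [div_le_one hL0]; linarith)
    have h2 : (t - γ) ^ 2 ≤ 1 := by rw [← sq_abs]; exact pow_le_one₀ (abs_nonneg _) h1
    unfold Wt
    rw [mul_one_div, div_le_div_iff₀ (by positivity) (by positivity), div_pow, div_pow]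
    have h3 : t ^ 2 / T ^ 2 ≤ 2 * (γ ^ 2 / T ^ 2) + 2 := by
      rw [div_le_iff₀ (by positivity), add_mul, mul_assoc, div_mul_cancel₀ _ (by positivity)]
      nlinarith [sq_nonneg (t - 2 * γ)]
    have : 0 ≤ γ ^ 2 / T ^ 2 := by positivity
    linarith
  set I : ℝ → Set ℝ := fun γ => Set.Icc (γ - 1 / L) (γ + 1 / L) with hI
  have hmem : ∀ γ t, t ∈ I γ ↔ |t - γ| ≤ 1 / L := fun γ t => by
    rw [hI, abs_le]; simp only [Set.mem_Icc]; constructor <;> rintro ⟨h1, h2⟩ <;> constructor <;> linarith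
  have hi : ∀ γ, Integrable (fun t => (ordMult γ : ℝ) * Wt T γ * n γ ^ 2 * (I γ).indicator (fun _ => (1:ℝ)) t) := fun γ =>
    Integrable.const_mul (IntegrableOn.integrable_indicator (integrableOn_const (by simp [hI])) measurableSet_Icc) _
  have hpt : ∀ t, ∑ γ ∈ F, (ordMult γ : ℝ) * Wt T γ * n γ ^ 2 * (I γ).indicator (fun _ => (1:ℝ)) t ≤ 4 / c ^ 3 * (Wt T t * H t ^ 3) := fun t => by
    have h1 : ∑ γ ∈ F, (ordMult γ : ℝ) * Wt T γ * n γ ^ 2 * (I γ).indicator (fun _ => (1:ℝ)) t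
        ≤ ∑ γ ∈ F.filter (fun γ => |t - γ| ≤ 1 / L), (4 * Wt T t * (H t / c) ^ 2) * (ordMult γ : ℝ) := by
      rw [Finset.sum_filter]
      refine Finset.sum_le_sum fun γ _ => ?_
      by_cases h : |t - γ| ≤ 1 / L
      · rw [if_pos h, Set.indicator_of_mem ((hmem γ t).2 h), mul_one, mul_assoc, mul_comm]
        refine mLR ?_ (Nat.cast_nonneg _)
        exact mul_le_mul (hW γ t h) (pow_le_pow_left₀ (hn0 _) (hnt γ t h) 2) (sq_nonneg _) (by have := Wt_pos T t; positivity)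
      · rw [if_neg h, Set.indicator_of_notMem (fun h' => h ((hmem γ t).1 h')), mul_zero]
    rw [← Finset.mul_sum] at h1
    have h2 := key t (F.filter (fun γ => |t - γ| ≤ 1 / L)) fun γ hγ => by
      have := (Finset.mem_filter.1 hγ).2
      rw [abs_sub_comm]; refine this.trans (div_le_div_of_nonneg_right (by norm_num) hL0.le)
    rw [mul_comm, ← le_div_iff₀ hc] at h2
    have hp := Wt_pos T t
    refine h1.trans ((mLL h2 (by positivity)).trans (le_of_eq ?_))
    field_simp
  have h1 : ∀ γ, ∫ t, (ordMult γ : ℝ) * Wt T γ * n γ ^ 2 * (I γ).indicator (fun _ => (1:ℝ)) t = (ordMult γ : ℝ) * Wt T γ * n γ ^ 2 * (2 / L) := fun γ => by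
    rw [integral_const_mul, integral_indicator measurableSet_Icc]
    simp only [integral_const, hI, smul_eq_mul, mul_one, MeasurableSet.univ, measureReal_restrict_apply, Set.univ_inter]
    rw [Measure.real, Real.volume_Icc, ENNReal.toReal_ofReal (by ring_nf; positivity)]; ring
  have h2 := integral_mono (integrable_finset_sum F fun γ _ => hi γ) (hHi.const_mul _) hpt
  rw [integral_finset_sum F fun γ _ => hi γ, integral_const_mul] at h2
  simp_rw [h1] at h2
  rw [← Finset.sum_mul, ← le_div_iff₀ (by positivity)] at h2
  refine h2.trans ?_
  rw [div_le_iff₀ (by positivity)]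
  calc _ ≤ 4 / c ^ 3 * (C * T) := mLL hHb (by positivity)
    _ = _ := by field_simp; ring

/-- The constant of the theorem. -/
def lm : ℝ := 60729 / 100000

lemma trigB (d : ℝ) (hd : |d| ≤ 1) : |cos d - (1 - d ^ 2 / 2 + d ^ 4 / 24 - d ^ 6 / 720 + d ^ 8 / 40320)| ≤ |d| ^ 10 / 3000000
    ∧ |sin d - (d - d ^ 3 / 6 + d ^ 5 / 120 - d ^ 7 / 5040 + d ^ 9 / 362880)| ≤ |d| ^ 10 / 3000000 := by
  have hx : ‖(d : ℂ) * Complex.I‖ = |d| := by simp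
  have h := Complex.exp_bound (x := (d : ℂ) * Complex.I) (by rw [hx]; exact hd) (n := 10) (by norm_num)
  rw [hx, Complex.exp_mul_I, ← Complex.ofReal_cos, ← Complex.ofReal_sin] at h
  have h' : |d| ^ 10 * (((10:ℕ).succ : ℝ) * (((10:ℕ).factorial : ℝ) * ((10:ℕ):ℝ))⁻¹) ≤ |d| ^ 10 / 3000000 := by
    rw [div_eq_mul_inv]
    refine mLL ?_ (by positivity)
    norm_num [Nat.factorial]
  have e : ((cos d : ℂ) + (sin d : ℂ) * Complex.I) - ∑ m ∈ Finset.range 10, ((d : ℂ) * Complex.I) ^ m / (m.factorial : ℂ)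
      = ((cos d - (1 - d ^ 2 / 2 + d ^ 4 / 24 - d ^ 6 / 720 + d ^ 8 / 40320) : ℝ) : ℂ) + ((sin d - (d - d ^ 3 / 6 + d ^ 5 / 120 - d ^ 7 / 5040 + d ^ 9 / 362880) : ℝ) : ℂ) * Complex.I := by
    have i3 : Complex.I ^ 3 = -Complex.I := Complex.I_pow_three
    have i4 : Complex.I ^ 4 = 1 := Complex.I_pow_four
    simp only [Finset.sum_range_succ, Finset.sum_range_zero, mul_pow]
    rw [show Complex.I ^ 5 = Complex.I by rw [show 5 = 4 + 1 by norm_num, pow_add, i4]; ring, show Complex.I ^ 6 = -1 by rw [show 6 = 4 + 2 by norm_num, pow_add, i4, Complex.I_sq]; ring,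
      show Complex.I ^ 7 = -Complex.I by rw [show 7 = 4 + 3 by norm_num, pow_add, i4, i3]; ring, show Complex.I ^ 8 = 1 by rw [show 8 = 4 + 4 by norm_num, pow_add, i4]; ring,
      show Complex.I ^ 9 = Complex.I by rw [show 9 = 4 + 4 + 1 by norm_num, pow_add, pow_add, i4]; ring, i3, i4, Complex.I_sq]
    norm_num [Nat.factorial]
    ring
  rw [e] at h
  have h2 := h.trans h'
  constructor
  · refine le_trans ?_ h2
    refine le_trans (le_of_eq ?_) (Complex.abs_re_le_norm _)
    simp only [Complex.add_re, Complex.re_ofReal_mul, Complex.ofReal_re, Complex.I_re, mul_zero, add_zero]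
  · refine le_trans ?_ h2
    refine le_trans (le_of_eq ?_) (Complex.abs_im_le_norm _)
    simp only [Complex.add_im, Complex.im_ofReal_mul, Complex.ofReal_im, Complex.I_im, mul_one, zero_add]

lemma numer : 1 + 3 / 1000000 ≤ lm * (1 + 2 * (1 / 2 - lm / 3 + 1 / (2 * π) * (sin (2 * π * lm) / (2 * π * lm) ^ 2 - cos (2 * π * lm) / (2 * π * lm)))) := by
  have hp1 := Real.pi_gt_d20
  have hp2 := Real.pi_lt_d20
  set d := π * (2 * lm - 1) with hd
  have hd1 : 0.67412295 ≤ d := by rw [hd, lm]; linarith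
  have hd2 : d ≤ 0.67412296 := by rw [hd, lm]; linarith
  have hc : 2 * π * lm = d + π := by rw [hd]; ring
  have hcl : 2 * π * lm ≤ 3.815716 := by rw [lm]; linarith
  have hcg : 3.815715 ≤ 2 * π * lm := by rw [lm]; linarith
  rw [hc, Real.sin_add_pi, Real.cos_add_pi, ← hc]
  have hd0 : 0 ≤ d := by linarith
  obtain ⟨hC, hS⟩ := trigB d (by rw [abs_of_nonneg hd0]; linarith)
  rw [abs_of_nonneg hd0] at hC hS
  have p : ∀ n : ℕ, (0.67412295:ℝ) ^ n ≤ d ^ n ∧ d ^ n ≤ (0.67412296:ℝ) ^ n := fun n => ⟨pow_le_pow_left₀ (by norm_num) hd1 n, pow_le_pow_left₀ hd0 hd2 n⟩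
  have hCl : 0.781254 ≤ cos d := by
    have h1 := (abs_le.1 hC).1
    have h2 := (p 2).2; have h4 := (p 4).1; have h6 := (p 6).2; have h8 := (p 8).1; have h10 := (p 10).2
    norm_num at h2 h4 h6 h8 h10 ⊢
    linarith
  have hSu : sin d ≤ 0.624213 := by
    have h1 := (abs_le.1 hS).2
    have h3 := (p 3).1; have h5 := (p 5).2; have h7 := (p 7).1; have h9 := (p 9).2; have h10 := (p 10).2
    norm_num at h3 h5 h7 h9 h10 ⊢
    linarith
  set c := 2 * π * lm with hcd
  have hc0 : 0 < c := by linarith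
  have k1 : 0.2047463 ≤ cos d / c := by rw [le_div_iff₀ hc0]; nlinarith
  have k2 : sin d / c ^ 2 ≤ 0.0428731 := by rw [div_le_iff₀ (by positivity)]; nlinarith
  have k3 : 0.1618732 ≤ -sin d / c ^ 2 - -cos d / c := by rw [neg_div, neg_div]; linarith
  have k4 : 0.15915494 ≤ 1 / (2 * π) := by rw [le_div_iff₀ (by positivity)]; nlinarith
  have k5 := mul_le_mul k4 k3 (by norm_num) (by positivity)
  have hl : lm = 60729 / 100000 := rfl
  rw [hl] at *
  norm_num at k5 ⊢
  linarith

/-- Fourier transform of the Selberg minorant on `[0,1]`. -/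
def Rh (a : ℝ) : ℝ := 1 - a + sin (2 * π * a) / (2 * π)

lemma Rh_cont : Continuous Rh := by unfold Rh; fun_prop

lemma Rh_deriv (a : ℝ) : HasDerivAt Rh (-1 + cos (2 * π * a)) a := by
  have h1 : HasDerivAt (fun a : ℝ => 2 * π * a) (2 * π) a := by simpa using (hasDerivAt_id a).const_mul (2 * π)
  have h2 := ((hasDerivAt_id a).const_sub 1).add (h1.sin.div_const (2 * π))
  refine HasDerivAt.congr_deriv h2 ?_
  rw [mul_div_assoc, div_self (by positivity), mul_one]

lemma Rh_bd {a : ℝ} (h0 : 0 ≤ a) (h1 : a ≤ 1) : 0 ≤ Rh a ∧ Rh a ≤ 1 := by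
  have hp : 0 < 2 * π := by positivity
  constructor
  · have h2 := Real.sin_le (x := 2 * π * (1 - a)) (mul_nonneg hp.le (by linarith))
    have h3 : sin (2 * π * (1 - a)) = -sin (2 * π * a) := by
      rw [show 2 * π * (1 - a) = 2 * π - 2 * π * a by ring, Real.sin_two_pi_sub]
    rw [h3] at h2
    have : -(1 - a) ≤ sin (2 * π * a) / (2 * π) := by rw [le_div_iff₀ hp]; linarith
    unfold Rh; linarith
  · have h2 := Real.sin_le (x := 2 * π * a) (mul_nonneg hp.le h0)
    have : sin (2 * π * a) / (2 * π) ≤ a := by rw [div_le_iff₀ hp]; linarith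
    unfold Rh; linarith

lemma Rh_lip (a b : ℝ) : |Rh a - Rh b| ≤ 2 * |a - b| := by
  have := Convex.norm_image_sub_le_of_norm_hasDerivWithin_le (f := Rh) (f' := fun a => -1 + cos (2 * π * a)) (C := 2) (s := Set.univ) (x := b) (y := a)
    (fun x _ => (Rh_deriv x).hasDerivWithinAt) (fun x _ => by
      rw [Real.norm_eq_abs, abs_le]; constructor <;> linarith [Real.neg_one_le_cos (2 * π * x), Real.cos_le_one (2 * π * x)]) convex_univ trivial trivial
  simpa using this

/-- The pairing kernel. -/
def Qk (k : ℝ) : ℝ := ∫ a in (0:ℝ)..1, 2 * Rh a * cos (k * a)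

lemma Qk_le_one (k : ℝ) : Qk k ≤ 1 := by
  have h1 : ∫ a in (0:ℝ)..1, 2 * Rh a = 1 := by
    have : ∀ a ∈ Set.uIcc (0:ℝ) 1, HasDerivAt (fun a => 2 * a - a ^ 2 - cos (2 * π * a) / (2 * π ^ 2)) (2 * Rh a) a := fun a _ => by
      have h1 : HasDerivAt (fun a : ℝ => 2 * π * a) (2 * π) a := by simpa using (hasDerivAt_id a).const_mul (2 * π)
      refine HasDerivAt.congr_deriv ((((hasDerivAt_id a).const_mul 2).sub (hasDerivAt_pow 2 a)).sub (h1.cos.div_const (2 * π ^ 2))) ?_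
      unfold Rh; field_simp; ring
    rw [intervalIntegral.integral_eq_sub_of_hasDerivAt this ((continuous_const.mul Rh_cont).intervalIntegrable _ _)]
    simp; ring
  rw [← h1]
  refine intervalIntegral.integral_mono_on zero_le_one (Continuous.intervalIntegrable (by have := Rh_cont; fun_prop) _ _) (Continuous.intervalIntegrable (by have := Rh_cont; fun_prop) _ _) fun a ha => ?_
  exact mul_le_of_le_one_right (by linarith [(Rh_bd ha.1 ha.2).1]) (Real.cos_le_one _)

lemma Qk_nonpos (k : ℝ) (hk : 2 * π < |k|) : Qk k ≤ 0 := by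
  have hp : 0 < π := Real.pi_pos
  have hk0 : k ≠ 0 := fun h => by rw [h, abs_zero] at hk; linarith
  have hkk : (2 * π) ^ 2 < k ^ 2 := by rw [← sq_abs k]; exact pow_lt_pow_left₀ hk (by positivity) (by norm_num)
  have h1 : 2 * π + k ≠ 0 := fun h => by have : k = -(2 * π) := by linarith
                                         rw [this] at hkk; linarith
  have h2 : 2 * π - k ≠ 0 := fun h => by have : k = 2 * π := by linarith
                                         rw [this] at hkk; linarith
  have hd : ∀ a ∈ Set.uIcc (0:ℝ) 1, HasDerivAt (fun a => 2 * ((1 - a) * sin (k * a) / k - cos (k * a) / k ^ 2)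
      - (cos ((2 * π + k) * a) / (2 * π + k) + cos ((2 * π - k) * a) / (2 * π - k)) / (2 * π)) (2 * Rh a * cos (k * a)) a := fun a _ => by
    have hc : ∀ c : ℝ, HasDerivAt (fun a : ℝ => c * a) c a := fun c => by simpa using (hasDerivAt_id a).const_mul c
    have := (((((hasDerivAt_id a).const_sub 1).mul (hc k).sin).div_const k).sub ((hc k).cos.div_const (k ^ 2))).const_mul 2 |>.sub
      ((((hc (2 * π + k)).cos.div_const (2 * π + k)).add ((hc (2 * π - k)).cos.div_const (2 * π - k))).div_const (2 * π))
    refine HasDerivAt.congr_deriv this ?_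
    have e1 : sin ((2 * π + k) * a) + sin ((2 * π - k) * a) = 2 * sin (2 * π * a) * cos (k * a) := by
      rw [add_mul, sub_mul, Real.sin_add, Real.sin_sub]; ring
    have e2 : (-sin ((2 * π + k) * a) * (2 * π + k) / (2 * π + k) + -sin ((2 * π - k) * a) * (2 * π - k) / (2 * π - k)) = - (2 * sin (2 * π * a) * cos (k * a)) := by
      rw [mul_div_cancel_right₀ _ h1, mul_div_cancel_right₀ _ h2, ← e1]; ring
    rw [e2]; unfold Rh; simp only [id]; field_simp; ring
  unfold Qk
  rw [intervalIntegral.integral_eq_sub_of_hasDerivAt hd (Continuous.intervalIntegrable (by have := Rh_cont; fun_prop) _ _)]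
  have e3 : cos (2 * π + k) = cos k := by rw [add_comm, Real.cos_add_two_pi]
  have e4 : cos (2 * π - k) = cos k := Real.cos_two_pi_sub k
  simp only [mul_one, mul_zero, e3, e4, Real.cos_zero, Real.sin_zero, sub_self, zero_mul, zero_div]
  have h3 : (2 * π + k) * (2 * π - k) < 0 := by nlinarith
  have e5 : 2 * (0 - cos k / k ^ 2) - (cos k / (2 * π + k) + cos k / (2 * π - k)) / (2 * π) - (2 * (0 - 1 / k ^ 2) - (1 / (2 * π + k) + 1 / (2 * π - k)) / (2 * π))
      = (1 - cos k) * (8 * π ^ 2) / k ^ 2 / ((2 * π + k) * (2 * π - k)) := by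
    field_simp; ring
  rw [e5]
  exact div_nonpos_of_nonneg_of_nonpos (div_nonneg (mul_nonneg (by linarith [Real.cos_le_one k]) (by positivity)) (sq_nonneg _)) h3.le

lemma normSqCos (F : Finset ℝ) (p : ℝ → ℝ) (v : ℝ) : ‖∑ γ ∈ F, (p γ : ℂ) * ek γ v‖ ^ 2 = ∑ γ ∈ F, ∑ γ' ∈ F, p γ * p γ' * cos ((γ - γ') * v) := by
  rw [← Complex.ofReal_inj, Complex.ofReal_pow, ← Complex.mul_conj', map_sum, Finset.sum_mul_sum]
  apply Complex.ext
  · simp only [Complex.re_sum, Complex.ofReal_re]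
    refine Finset.sum_congr rfl fun q _ => Finset.sum_congr rfl fun r _ => ?_
    have h1 : (starRingEnd ℂ) (ek r v) = ek (-r) v := by
      unfold ek; rw [← Complex.exp_conj, map_mul, Complex.conj_ofReal, Complex.conj_I]; push_cast; ring_nf
    have h2 : ek (q - r) v = ek q v * ek (-r) v := by
      unfold ek; rw [← Complex.exp_add]; push_cast; ring_nf
    rw [map_mul, Complex.conj_ofReal, h1, mul_mul_mul_comm, ← h2, ← Complex.ofReal_mul, Complex.re_ofReal_mul, ek, Complex.exp_ofReal_mul_I_re]
  · rw [Complex.ofReal_im, ← Finset.sum_mul_sum, ← map_sum, Complex.mul_conj]; exact Complex.ofReal_im _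

lemma pairUpper (F : Finset ℝ) (m w : ℝ → ℝ) (hm : ∀ γ, 0 ≤ m γ) (hw : ∀ γ, 0 ≤ w γ) (κ : ℝ) (hκ : 0 < κ) :
    ∫ a in (0:ℝ)..1, 2 * Rh a * ‖∑ γ ∈ F, ((m γ * w γ : ℝ) : ℂ) * ek γ (κ * a)‖ ^ 2 ≤
      ∑ γ ∈ F, m γ * w γ ^ 2 * ∑ γ' ∈ F.filter (fun γ' => |γ' - γ| ≤ 2 * π / κ), m γ' := by
  have hc := Rh_cont
  simp_rw [normSqCos F (fun γ => m γ * w γ), Finset.mul_sum]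
  have hi : ∀ q r : ℝ, IntervalIntegrable (fun a => 2 * Rh a * (m q * w q * (m r * w r) * cos ((q - r) * (κ * a)))) volume 0 1 := fun q r =>
    Continuous.intervalIntegrable (by fun_prop) _ _
  rw [intervalIntegral.integral_finset_sum fun q _ => Continuous.intervalIntegrable (by fun_prop) _ _]
  simp_rw [fun q => intervalIntegral.integral_finset_sum (s := F) fun r _ => hi q r]
  have e : ∀ q r : ℝ, ∫ a in (0:ℝ)..1, 2 * Rh a * (m q * w q * (m r * w r) * cos ((q - r) * (κ * a))) = m q * w q * (m r * w r) * Qk ((q - r) * κ) := fun q r => by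
    unfold Qk; rw [← intervalIntegral.integral_const_mul]; congr 1; ext a; rw [mul_assoc (q - r)]; ring
  simp_rw [e, Finset.sum_filter]
  have hb : ∀ q r : ℝ, m q * w q * (m r * w r) * Qk ((q - r) * κ) ≤ (if |r - q| ≤ 2 * π / κ then m q * w q ^ 2 * m r else 0) / 2 + (if |q - r| ≤ 2 * π / κ then m r * w r ^ 2 * m q else 0) / 2 := fun q r => by
    have hn : 0 ≤ m q * w q * (m r * w r) := mul_nonneg (mul_nonneg (hm _) (hw _)) (mul_nonneg (hm _) (hw _))
    rw [abs_sub_comm r q]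
    split_ifs with h
    · refine (mLL (Qk_le_one _) hn).trans ?_
      nlinarith [mul_nonneg (mul_nonneg (hm q) (hm r)) (sq_nonneg (w q - w r))]
    · have : Qk ((q - r) * κ) ≤ 0 := Qk_nonpos _ (by rw [abs_mul, abs_of_pos hκ]; rw [not_le, div_lt_iff₀ hκ] at h; exact h)
      nlinarith
  refine (Finset.sum_le_sum fun q _ => Finset.sum_le_sum fun r _ => hb q r).trans (le_of_eq ?_)
  simp_rw [Finset.sum_add_distrib, ← Finset.sum_div]
  rw [Finset.sum_comm (f := fun q r => if |q - r| ≤ 2 * π / κ then m r * w r ^ 2 * m q else 0), add_halves]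

lemma primeSum : ∃ C : ℝ, 0 < C ∧ ∀ L : ℝ, 1 ≤ L →
    L ^ 2 * (1 / 2 - lm / 3 + 1 / (2 * π) * (sin (2 * π * lm) / (2 * π * lm) ^ 2 - cos (2 * π * lm) / (2 * π * lm))) - C * L ≤
      ∑ n ∈ Finset.Icc 0 ⌊exp L⌋₊, log n * Rh (lm * log n / L) * cP n := by
  obtain ⟨C, hC, hS⟩ := mertP
  refine ⟨4 * C, by positivity, fun L hL => ?_⟩
  have hL0 : 0 < L := by linarith
  have hl : lm = 60729 / 100000 := rfl
  have hlm : 0 < lm := by rw [hl]; norm_num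
  have hlm1 : lm ≤ 1 := by rw [hl]; norm_num
  set b := exp L with hb
  have hb1 : 1 ≤ b := Real.one_le_exp hL0.le
  set φ : ℝ → ℝ := fun y => y * Rh (lm * y / L) with hφ
  set φ' : ℝ → ℝ := fun y => Rh (lm * y / L) + y * ((-1 + cos (2 * π * (lm * y / L))) * (lm / L)) with hφ'
  have hin : ∀ y : ℝ, HasDerivAt (fun y : ℝ => lm * y / L) (lm / L) y := fun y => by
    simpa using ((hasDerivAt_id y).const_mul lm).div_const L
  have hφd : ∀ y, HasDerivAt φ (φ' y) y := fun y => by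
    refine HasDerivAt.congr_deriv ((hasDerivAt_id y).mul ((Rh_deriv _).comp y (hin y))) ?_
    simp only [hφ', id, Function.comp, one_mul]
  have hfd : ∀ t : ℝ, 0 < t → HasDerivAt (fun t => φ (log t)) (φ' (log t) * t⁻¹) t := fun t ht =>
    (hφd _).comp t (Real.hasDerivAt_log ht.ne')
  set Φ : ℝ → ℝ := fun y => y ^ 2 / 2 - lm / L * y ^ 3 / 3 + 1 / (2 * π) * (sin (2 * π * (lm * y / L)) * (L / (2 * π * lm)) ^ 2 - y * cos (2 * π * (lm * y / L)) * (L / (2 * π * lm))) with hΦ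
  have hΦd : ∀ y, HasDerivAt Φ (φ y) y := fun y => by
    have h1 := (hin y).const_mul (2 * π)
    have := (((hasDerivAt_pow 2 y).div_const 2).sub (((hasDerivAt_pow 3 y).const_mul (lm / L)).div_const 3)).add
      (((h1.sin.mul_const ((L / (2 * π * lm)) ^ 2)).sub (((hasDerivAt_id y).mul h1.cos).mul_const (L / (2 * π * lm)))).const_mul (1 / (2 * π)))
    refine HasDerivAt.congr_deriv this ?_
    simp only [hφ, Rh, id]; push_cast; field_simp; ring
  have hφb : ∀ y, 0 ≤ y → y ≤ L → |φ' y| ≤ 3 := fun y h0 h1 => by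
    have h2 := Rh_bd (a := lm * y / L) (by positivity) (by rw [div_le_one hL0]; nlinarith)
    have h3 : 0 ≤ y * lm / L ∧ y * lm / L ≤ 1 := ⟨by positivity, by rw [div_le_one hL0]; nlinarith⟩
    have e : φ' y = Rh (lm * y / L) + y * lm / L * (-1 + cos (2 * π * (lm * y / L))) := by simp only [hφ']; ring
    have h4 := Real.neg_one_le_cos (2 * π * (lm * y / L))
    have h5 := Real.cos_le_one (2 * π * (lm * y / L))
    rw [e, abs_le]; constructor <;> nlinarith
  have hφc : Continuous φ' := by have := Rh_cont; rw [hφ']; fun_prop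
  have hfc : ContinuousOn (fun t => φ' (log t) * t⁻¹) (Set.Icc 1 b) := by
    refine (hφc.comp_continuousOn (Real.continuousOn_log.mono fun t ht => ?_)).mul (continuousOn_inv₀.mono fun t ht => ?_) <;>
      exact (zero_lt_one.trans_le ht.1).ne'
  have hder : ∀ t ∈ Set.Icc 1 b, deriv (fun t => φ (log t)) t = φ' (log t) * t⁻¹ := fun t ht => (hfd t (zero_lt_one.trans_le ht.1)).deriv
  have hint : IntegrableOn (deriv (fun t => φ (log t))) (Set.Icc 1 b) :=
    (hfc.integrableOn_Icc).congr_fun (fun t ht => (hder t ht).symm) measurableSet_Icc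
  have hA := sum_mul_eq_sub_integral_mul₀ cP (f := fun t => φ (log t)) (by simp [cP]) b (fun t ht => (hfd t (zero_lt_one.trans_le ht.1)).differentiableAt) hint
  have hlb : log b = L := Real.log_exp L
  have hcont : ContinuousOn (fun t => φ' (log t) * t⁻¹ * log t + 3 * C * t⁻¹) (Set.Icc 1 b) := by
    refine (hfc.mul (Real.continuousOn_log.mono fun t ht => ?_)).add (continuousOn_const.mul (continuousOn_inv₀.mono fun t ht => ?_)) <;>
      exact (zero_lt_one.trans_le ht.1).ne'
  have hI1 : ∫ t in Set.Ioc 1 b, deriv (fun t => φ (log t)) t * ∑ k ∈ Finset.Icc 0 ⌊t⌋₊, cP k ≤ ∫ t in Set.Ioc 1 b, (φ' (log t) * t⁻¹ * log t + 3 * C * t⁻¹) := by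
    refine setIntegral_mono_on ((integrableOn_mul_sum_Icc cP zero_le_one hint).mono_set Set.Ioc_subset_Icc_self) (hcont.integrableOn_Icc.mono_set Set.Ioc_subset_Icc_self) measurableSet_Ioc fun t ht => ?_
    have ht' : t ∈ Set.Icc 1 b := ⟨ht.1.le, ht.2⟩
    have ht0 : 0 < t := zero_lt_one.trans ht.1
    rw [hder t ht']
    have h1 := hS t ht.1.le
    have h2 := hφb (log t) (Real.log_nonneg ht.1.le) (hlb ▸ Real.log_le_log ht0 ht.2)
    have h3 : φ' (log t) * (∑ k ∈ Finset.Icc 0 ⌊t⌋₊, cP k - log t) ≤ 3 * C := by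
      refine (le_abs_self _).trans ?_
      rw [abs_mul]; exact mul_le_mul h2 h1 (abs_nonneg _) (by norm_num)
    have h4 := mLR h3 (inv_pos.2 ht0).le
    linarith
  have hI2 : ∫ t in Set.Ioc 1 b, (φ' (log t) * t⁻¹ * log t + 3 * C * t⁻¹) = φ L * L - Φ L + 3 * C * L := by
    rw [← intervalIntegral.integral_of_le hb1]
    rw [intervalIntegral.integral_eq_sub_of_hasDerivAt (f := fun t => φ (log t) * log t - Φ (log t) + 3 * C * log t) (fun t ht => ?_) (hcont.intervalIntegrable_of_Icc hb1)]
    · simp [hlb, hΦ]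
    · rw [Set.uIcc_of_le hb1] at ht
      have ht0 : 0 < t := zero_lt_one.trans_le ht.1
      have hlg := Real.hasDerivAt_log ht0.ne'
      refine HasDerivAt.congr_deriv ((((hfd t ht0).mul hlg).sub ((hΦd _).comp t hlg)).add (hlg.const_mul (3 * C))) ?_
      ring
  have hΦL : Φ L = L ^ 2 * (1 / 2 - lm / 3 + 1 / (2 * π) * (sin (2 * π * lm) / (2 * π * lm) ^ 2 - cos (2 * π * lm) / (2 * π * lm))) := by
    simp only [hΦ]; rw [mul_div_assoc lm L L, div_self hL0.ne', mul_one]; field_simp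
  have hSb := hS b hb1
  rw [hlb] at hSb
  have hRL := Rh_bd (a := lm * L / L) (by positivity) (by rw [div_le_one hL0]; nlinarith)
  have hφL : 0 ≤ φ L ∧ φ L ≤ L := ⟨mul_nonneg hL0.le hRL.1, mul_le_of_le_one_right hL0.le hRL.2⟩
  have e : ∑ n ∈ Finset.Icc 0 ⌊b⌋₊, log n * Rh (lm * log n / L) * cP n = ∑ n ∈ Finset.Icc 0 ⌊b⌋₊, φ (log n) * cP n := rfl
  rw [e, hA, ← hΦL]
  simp only [hlb]
  have := (abs_le.1 hSb).1
  nlinarith [mul_nonneg hφL.1 (show 0 ≤ ∑ k ∈ Finset.Icc 0 ⌊b⌋₊, cP k - L + C by linarith)]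

lemma Adecomp (hRH : RiemannHypothesis) : ∃ C : ℝ, 0 < C ∧ ∀ T : ℝ, 8 ≤ T → ∀ v : ℝ, 0 ≤ v → ∃ A : ℂ, ∃ P : ℝ,
    HasSum (fun γ : ℝ => (((ordMult γ : ℝ) * w0 (γ / T) : ℝ) : ℂ) * ek γ v) A ∧
    HasSum (fun n : ℕ => vonMangoldt n / sqrt n * (T * bet (T * (log n - v)))) P ∧
    ‖A - ((log T * T * bet (T * v) - P : ℝ) : ℂ)‖ ≤ C * (exp (v / 2) + T / (1 + T * v)) := by
  obtain ⟨Cb, hCb, hb1, hb2⟩ := bet_good.lip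
  have hbn := bet_good.2.1
  set B := ∫ x, bet x with hB
  have hB0 : 0 < B := betInt_pos
  refine ⟨6 * B + (6 * |kap| + 36) * (Cb + B), by positivity, fun T hT v hv => ?_⟩
  have hT0 : 0 < T := by linarith
  set g : ℝ → ℂ := fun x => ((T * bet (T * (x - v)) : ℝ) : ℂ) with hg
  have hz : ∀ x, 1 / T ≤ |x - v| → g x = 0 := fun x hx => by
    have : bet (T * (x - v)) = 0 := bet_good.2.2.2 _ (by rw [abs_mul, abs_of_pos hT0]; rw [div_le_iff₀ hT0] at hx; linarith)
    simp [hg, this]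
  have hgs : ContDiff ℝ 2 g := Complex.ofRealCLM.contDiff.comp (contDiff_const.mul (bet_good.1.comp (contDiff_const.mul (contDiff_id.sub contDiff_const))))
  have hgc : HasCompactSupport g := HasCompactSupport.intro (isCompact_Icc (a := v - 1 / T) (b := v + 1 / T)) fun x hx =>
    hz x (by by_contra hn; refine hx ?_; have := abs_le.1 (not_le.1 hn).le; constructor <;> linarith)
  have gn : ∀ x, ‖g x‖ = T * bet (T * (x - v)) := fun x => by
    rw [hg]; simp only; rw [Complex.norm_real, Real.norm_of_nonneg (mul_nonneg hT0.le (hbn _))]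
  have gi : ∫ x, ‖g x‖ = B := by
    simp_rw [gn]
    rw [integral_const_mul, integral_sub_right_eq_self (fun x => bet (T * x)), Measure.integral_comp_mul_left, abs_of_pos (by positivity), smul_eq_mul, ← hB]
    field_simp
  have gint : Integrable g := hgs.continuous.integrable_of_hasCompactSupport hgc
  obtain ⟨G, P, hG, hP, hZ⟩ := EF hRH g hgs hgc
  -- zeros
  have hft : ∀ γ : ℝ, ∫ x, g x * ek γ x = (w0 (γ / T) : ℂ) * ek γ v := fun γ => by
    have e1 : ∀ x, g x * ek γ x = (fun x => (fun y => (T * ek γ v : ℂ) * ((bet y : ℂ) * ek (γ / T) y)) (T * x)) (x - v) := fun x => by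
      have h2 : ek γ x = ek γ v * ek (γ / T) (T * (x - v)) := by
        unfold ek; rw [← Complex.exp_add]; congr 1; rw [show γ / T * (T * (x - v)) = γ * (x - v) by field_simp]; push_cast; ring
      simp only [hg]; rw [h2]; push_cast; ring
    simp_rw [e1]
    rw [integral_sub_right_eq_self (fun x => (fun y => (T * ek γ v : ℂ) * ((bet y : ℂ) * ek (γ / T) y)) (T * x)),
      Measure.integral_comp_mul_left (fun y => (T * ek γ v : ℂ) * ((bet y : ℂ) * ek (γ / T) y)), integral_const_mul, bet_ft, abs_of_pos (by positivity), Complex.real_smul]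
    have : (T:ℂ) ≠ 0 := by exact_mod_cast hT0.ne'
    push_cast; field_simp
  simp_rw [hft] at hZ
  -- primes
  have hP2 : ∀ n : ℕ, ((vonMangoldt n / sqrt n : ℝ) : ℂ) * (g (log n) + g (-log n)) =
      ((vonMangoldt n / sqrt n * (T * bet (T * (log n - v))) : ℝ) : ℂ) := fun n => by
    by_cases h2 : 2 ≤ n
    · have hl : 1 / T ≤ log n := by
        have h3 := Real.log_two_gt_d9
        have h4 : log 2 ≤ log n := Real.log_le_log (by norm_num) (by exact_mod_cast h2)
        have h5 : 1 / T ≤ 1 / 8 := one_div_le_one_div_of_le (by norm_num) hT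
        linarith
      rw [hz (-log n) (by rw [abs_of_nonpos (by have : 0 < 1 / T := by positivity
                                                linarith)]; linarith), add_zero, hg]; push_cast; rfl
    · have : n = 0 ∨ n = 1 := by omega
      rcases this with rfl | rfl <;> simp
  simp_rw [hP2] at hP
  obtain ⟨Pr, hPr⟩ : ∃ Pr : ℝ, HasSum (fun n : ℕ => vonMangoldt n / sqrt n * (T * bet (T * (log n - v)))) Pr :=
    (Complex.hasSum_re hP).summable.congr (fun n => by rw [Complex.ofReal_re])
  have hPP : P = (Pr : ℂ) := hP.unique (Complex.hasSum_ofReal.2 hPr)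
  refine ⟨_, Pr, hZ.congr_fun (fun γ => by push_cast; ring), hPr, ?_⟩
  set pl := ∫ x, ((exp (|x| / 2) : ℝ) : ℂ) * g x with hpl
  have hpole : ‖pl‖ ≤ 3 * B * exp (v / 2) := by
    rw [← gi, show 3 * (∫ x, ‖g x‖) * exp (v / 2) = ∫ x, (3 * exp (v / 2)) * ‖g x‖ by rw [integral_const_mul]; ring]
    refine norm_integral_le_of_norm_le (gint.norm.const_mul _) (ae_of_all _ fun x => ?_)
    rw [norm_mul, Complex.norm_real, Real.norm_of_nonneg (Real.exp_pos _).le]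
    by_cases h : 1 / T ≤ |x - v|
    · rw [hz x h]; simp
    · refine mLR ?_ (norm_nonneg _)
      have h5 : 1 / T ≤ 1 / 8 := one_div_le_one_div_of_le (by norm_num) hT
      have h6 : |x| ≤ v + 1 := by have := abs_le.1 (not_le.1 h).le; rw [abs_le]; constructor <;> linarith
      have h7 : exp (|x| / 2) ≤ exp (v / 2 + 1) := Real.exp_le_exp.2 (by linarith)
      rw [Real.exp_add] at h7
      have := Real.exp_one_lt_d9
      nlinarith [Real.exp_pos (v / 2)]
  have g0 : g 0 = ((T * bet (T * v) : ℝ) : ℂ) := by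
    simp only [hg]; rw [zero_sub, mul_neg, bet_good.2.2.1]
  have hkey : ‖2 * (kap : ℂ) * g 0 + (G - ((log T : ℝ) : ℂ) * g 0)‖ ≤ (6 * |kap| + 36) * (Cb + B) * (T / (1 + T * v)) := by
    rcases le_total v (2 / T) with h | h
    · have hTv : T * v ≤ 2 := by rw [le_div_iff₀ hT0] at h; linarith
      have hTv0 : 0 ≤ T * v := by positivity
      have hx : T / 3 ≤ T / (1 + T * v) := div_le_div_of_nonneg_left hT0.le (by positivity) (by linarith)
      set K := ⌈T⌉₊ with hK
      have hKl : T ≤ K := Nat.le_ceil _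
      have hKu : (K:ℝ) < T + 1 := Nat.ceil_lt_add_one hT0.le
      have hK1 : 1 ≤ K := by exact_mod_cast (show (1:ℝ) ≤ K by linarith)
      have hKp : (0:ℝ) < K := by linarith
      have hh := harm_le K hK1
      have gb : ‖g 0‖ ≤ T * Cb := by rw [gn]; exact mLL (hb1 _) hT0.le
      have hGt := gammaTail g hgs.continuous hgc (T * Cb) (T ^ 2 * Cb) gb (fun x => by
        simp only [hg]; rw [← Complex.ofReal_sub, Complex.norm_real, Real.norm_eq_abs, ← mul_sub, abs_mul, abs_of_pos hT0]
        have := hb2 (T * (x - v)) (T * (0 - v))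
        rw [show T * (x - v) - T * (0 - v) = T * x by ring, abs_mul, abs_of_pos hT0] at this
        nlinarith) G hG K hK1
      set H : ℝ := ∑ k ∈ Finset.range K, 1 / ((k : ℝ) + 1) with hH
      have hI : ∑ k ∈ Finset.range K, ‖∫ x, ((exp (-(2 * k + 5 / 2) * |x|) : ℝ) : ℂ) * g x‖ ≤ K * B := by
        have : ∀ k ∈ Finset.range K, ‖∫ x, ((exp (-(2 * k + 5 / 2) * |x|) : ℝ) : ℂ) * g x‖ ≤ B := fun k _ => by
          rw [← gi]
          refine norm_integral_le_of_norm_le gint.norm (ae_of_all _ fun x => ?_)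
          rw [norm_mul, Complex.norm_real, Real.norm_of_nonneg (Real.exp_pos _).le]
          exact mul_le_of_le_one_left (norm_nonneg _) (Real.exp_le_one_iff.2 (by rw [neg_mul]; have : 0 ≤ (2 * (k:ℝ) + 5 / 2) * |x| := by positivity
                                                                                 linarith))
        simpa using Finset.sum_le_sum this
      have h3 : (T * Cb + 2 * (T ^ 2 * Cb)) / K ≤ 3 * T * Cb := by
        rw [div_le_iff₀ hKp]
        nlinarith [mul_pos hT0 hCb, mul_nonneg (mul_pos hT0 hCb).le (sub_nonneg.2 hKl)]
      have hHL : |H - log T| ≤ 2 := by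
        have h4 : log T ≤ log K := Real.log_le_log hT0 hKl
        have h5 : log K ≤ log T + 1 := by
          have h6 : (K:ℝ) ≤ T * exp 1 := by nlinarith [Real.add_one_le_exp (1:ℝ)]
          have := Real.log_le_log hKp h6
          rwa [Real.log_mul hT0.ne' (Real.exp_pos 1).ne', Real.log_exp] at this
        rw [abs_le]; constructor <;> linarith
      have e : 2 * (kap : ℂ) * g 0 + (G - ((log T : ℝ) : ℂ) * g 0) = 2 * (kap : ℂ) * g 0 + (G - g 0 * (H : ℂ)) + g 0 * ((H - log T : ℝ) : ℂ) := by push_cast; ring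
      have n1 : ‖2 * (kap : ℂ) * g 0‖ ≤ 2 * |kap| * (T * Cb) := by
        rw [norm_mul, norm_mul, Complex.norm_real, Complex.norm_two, Real.norm_eq_abs]
        exact mLL gb (by positivity)
      have n2 : ‖g 0 * ((H - log T : ℝ) : ℂ)‖ ≤ T * Cb * 2 := by
        rw [norm_mul, Complex.norm_real (H - log T), Real.norm_eq_abs]
        exact mul_le_mul gb hHL (abs_nonneg _) (by positivity)
      rw [e]
      have n3 := norm_add₃_le (a := 2 * (kap : ℂ) * g 0) (b := G - g 0 * (H : ℂ)) (c := g 0 * ((H - log T : ℝ) : ℂ))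
      have n4 : (6 * |kap| + 36) * (Cb + B) * (T / 3) ≤ (6 * |kap| + 36) * (Cb + B) * (T / (1 + T * v)) := mLL hx (by positivity)
      have q1 : 0 ≤ |kap| * B * T := by positivity
      have q2 : (K:ℝ) * B ≤ (T + 1) * B := mLR hKu.le hB0.le
      nlinarith [mul_pos hT0 hCb, mul_pos hT0 hB0]
    · have hv0 : 0 < v := lt_of_lt_of_le (by positivity) h
      have hTv : 2 ≤ T * v := by rw [div_le_iff₀ hT0] at h; linarith
      have h1v : 1 / T ≤ v / 2 := by rw [div_le_div_iff₀ hT0 (by norm_num)]; linarith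
      have hg0 : g 0 = 0 := hz 0 (by rw [zero_sub, abs_neg, abs_of_pos hv0]; linarith)
      rw [hg0, mul_zero, mul_zero, zero_add, sub_zero]
      have := gammaFar g hgs.continuous hgc (v / 2) (by positivity) (fun x hx => hz x (by
        have h1 := abs_sub_abs_le_abs_sub v x
        rw [abs_of_pos hv0, abs_sub_comm] at h1; linarith)) G hG
      rw [gi] at this
      refine this.trans ?_
      have h2 : 1 / (2 * (v / 2)) ≤ 2 * (T / (1 + T * v)) := by
        rw [show 2 * (v / 2) = v by ring, ← mul_div_assoc, div_le_div_iff₀ hv0 (by positivity)]; nlinarith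
      have h3 : 0 ≤ T / (1 + T * v) := by positivity
      calc _ ≤ 2 * (T / (1 + T * v)) * B := mLR h2 hB0.le
        _ ≤ _ := by
          have : 2 * B ≤ (6 * |kap| + 36) * (Cb + B) := by nlinarith [abs_nonneg kap, mul_nonneg (abs_nonneg kap) (add_pos hCb hB0).le]
          nlinarith
  have e : pl + 2 * kap * g 0 + G - P - ((log T * T * bet (T * v) - Pr : ℝ) : ℂ) = pl + (2 * (kap : ℂ) * g 0 + (G - ((log T : ℝ) : ℂ) * g 0)) := by
    rw [hPP, g0]; push_cast; ring
  rw [e]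
  refine (norm_add_le _ _).trans ((add_le_add hpole hkey).trans ?_)
  have h3 : 0 ≤ T / (1 + T * v) := by positivity
  have h4 : 0 ≤ (6 * |kap| + 36) * (Cb + B) * exp (v / 2) := by positivity
  have h5 : 0 ≤ B * (T / (1 + T * v)) := by positivity
  nlinarith [mul_pos hB0 (Real.exp_pos (v / 2))]

/-- Main term of the squared exponential sum. -/
def Nv (T v : ℝ) : ℝ := (log T * T * bet (T * v)) ^ 2 + ∑ n ∈ Finset.Icc 0 ⌊T⌋₊, log n * cP n * (T * bet (T * (log n - v))) ^ 2

lemma logFar {T : ℝ} (hT : 8 ≤ T) {v : ℝ} (hv : T * v ≤ 1) (n : ℕ) : vonMangoldt n = 0 ∨ bet (T * (log n - v)) = 0 := by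
  by_cases h2 : 2 ≤ n
  · right
    refine bet_good.2.2.2 _ ?_
    have h3 := Real.log_two_gt_d9
    have h4 : log 2 ≤ log n := Real.log_le_log (by norm_num) (by exact_mod_cast h2)
    refine le_trans ?_ (le_abs_self _)
    nlinarith
  · left
    have : n = 0 ∨ n = 1 := by omega
    rcases this with rfl | rfl <;> simp

lemma Mlower {T : ℝ} (hT : 8 ≤ T) {v : ℝ} {P : ℝ} 
    (hP : HasSum (fun n : ℕ => vonMangoldt n / sqrt n * (T * bet (T * (log n - v)))) P) :
    Nv T v ≤ (log T * T * bet (T * v) - P) ^ 2 := by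
  have hbn := bet_good.2.1
  have hn0 : ∀ n : ℕ, 0 ≤ vonMangoldt n / sqrt n * (T * bet (T * (log n - v))) := fun n =>
    mul_nonneg (div_nonneg ArithmeticFunction.vonMangoldt_nonneg (Real.sqrt_nonneg _)) (mul_nonneg (by linarith) (hbn _))
  have hterm : ∀ n : ℕ, log n * cP n * (T * bet (T * (log n - v))) ^ 2 ≤ (vonMangoldt n / sqrt n * (T * bet (T * (log n - v)))) ^ 2 := fun n => by
    unfold cP
    split_ifs with h
    · rw [ArithmeticFunction.vonMangoldt_apply_prime h, mul_pow (log n / sqrt n), div_pow, Real.sq_sqrt (Nat.cast_nonneg _)]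
      exact le_of_eq (by ring)
    · rw [mul_zero, zero_mul]; positivity
  rcases le_total (T * v) 1 with h | h
  · have h1 : ∀ n : ℕ, vonMangoldt n / sqrt n * (T * bet (T * (log n - v))) = 0 := fun n => by
      rcases logFar hT h n with h | h <;> rw [h] <;> simp
    simp_rw [h1] at hP hterm
    have hP0 : P = 0 := hP.unique hasSum_zero
    unfold Nv; rw [hP0, sub_zero]
    have := Finset.sum_nonpos fun n (_ : n ∈ Finset.Icc 0 ⌊T⌋₊) => (hterm n).trans (by norm_num : (0:ℝ) ^ 2 ≤ 0)
    linarith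
  · have hb0 : bet (T * v) = 0 := bet_good.2.2.2 _ (h.trans (le_abs_self _))
    unfold Nv
    rw [hb0, mul_zero, zero_sub, neg_sq, zero_pow two_ne_zero, zero_add]
    refine (Finset.sum_le_sum fun n _ => hterm n).trans ((Finset.sum_sq_le_sq_sum_of_nonneg fun n _ => hn0 n).trans ?_)
    exact pow_le_pow_left₀ (Finset.sum_nonneg fun n _ => hn0 n) (sum_le_hasSum _ (fun n _ => hn0 n) hP) 2

lemma FApprox (hRH : RiemannHypothesis) : ∃ C : ℝ, 0 < C ∧ ∀ T : ℝ, 8 ≤ T → ∃ F : Finset ℝ, ∀ v : ℝ, 0 ≤ v → ∃ P : ℝ,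
    HasSum (fun n : ℕ => vonMangoldt n / sqrt n * (T * bet (T * (log n - v)))) P ∧
    ‖∑ γ ∈ F, (((ordMult γ : ℝ) * w0 (γ / T) : ℝ) : ℂ) * ek γ v - ((log T * T * bet (T * v) - P : ℝ) : ℂ)‖ ≤ C * (exp (v / 2) + T / (1 + T * v)) := by
  obtain ⟨C, hC, h⟩ := Adecomp hRH
  refine ⟨C + 1, by positivity, fun T hT => ?_⟩
  have hp0 : ∀ γ : ℝ, 0 ≤ (ordMult γ : ℝ) * w0 (γ / T) := fun γ => mul_nonneg (Nat.cast_nonneg _) (w0_nonneg _)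
  obtain ⟨A0, P0, hA0, -⟩ := h T hT 0 le_rfl
  have hs : Summable (fun γ : ℝ => (ordMult γ : ℝ) * w0 (γ / T)) :=
    (Complex.hasSum_re hA0).summable.congr (fun γ => by rw [show ek γ 0 = 1 by simp [ek], mul_one, Complex.ofReal_re])
  obtain ⟨a, ha⟩ := hs
  obtain ⟨F, hF⟩ := (ha.eventually (lt_mem_nhds (show a - 1 < a by linarith))).exists
  refine ⟨F, fun v hv => ?_⟩
  obtain ⟨A, P, hA, hP, hE⟩ := h T hT v hv
  refine ⟨P, hP, ?_⟩
  set f : ℝ → ℂ := fun γ => (((ordMult γ : ℝ) * w0 (γ / T) : ℝ) : ℂ) * ek γ v with hf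
  have hfn : ∀ γ, ‖f γ‖ = (ordMult γ : ℝ) * w0 (γ / T) := fun γ => by
    rw [hf]; simp only; rw [norm_mul, ek_norm, mul_one, Complex.norm_real, Real.norm_of_nonneg (hp0 γ)]
  have hd : ‖∑ γ ∈ F, f γ - A‖ ≤ 1 := by
    have ht : Tendsto (fun S : Finset ℝ => ‖∑ γ ∈ F, f γ - ∑ γ ∈ S, f γ‖) atTop (nhds ‖∑ γ ∈ F, f γ - A‖) := (tendsto_const_nhds.sub hA).norm
    refine le_of_tendsto ht ((eventually_ge_atTop F).mono fun S hS => ?_)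
    rw [norm_sub_rev, ← Finset.sum_sdiff hS, add_sub_cancel_right]
    refine (norm_sum_le _ _).trans ?_
    simp_rw [hfn]
    have h1 := sum_le_hasSum S (fun γ _ => hp0 γ) ha
    have h2 := Finset.sum_sdiff (f := fun γ : ℝ => (ordMult γ : ℝ) * w0 (γ / T)) hS
    simp only at hF
    linarith
  have h3 := norm_add_le (∑ γ ∈ F, f γ - A) (A - ((log T * T * bet (T * v) - P : ℝ) : ℂ))
  rw [sub_add_sub_cancel] at h3
  have h4 : 1 ≤ exp (v / 2) := Real.one_le_exp (by positivity)
  have h5 : 0 ≤ T / (1 + T * v) := by positivity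
  nlinarith

lemma diagUpper (F : Finset ℝ) (T : ℝ) (hT : 8 ≤ T) (C : ℝ) (hC : 0 < C) (h : ∀ v : ℝ, 0 ≤ v → ∃ P : ℝ,
    HasSum (fun n : ℕ => vonMangoldt n / sqrt n * (T * bet (T * (log n - v)))) P ∧
    ‖∑ γ ∈ F, (((ordMult γ : ℝ) * w0 (γ / T) : ℝ) : ℂ) * ek γ v - ((log T * T * bet (T * v) - P : ℝ) : ℂ)‖ ≤ C * (exp (v / 2) + T / (1 + T * v))) :
    ∑ γ ∈ F, (ordMult γ : ℝ) * w0 (γ / T) ^ 2 ≤ bet2 0 * T * log T + C * (∫ x, bet x) * 2 * T := by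
  have hbn := bet_good.2.1
  have hT0 : 0 < T := by linarith
  have hbc := bet_good.1.continuous
  have hpt : ∀ y, bet y * ∑ γ ∈ F, (ordMult γ : ℝ) * w0 (γ / T) * cos (γ / T * y) ≤ T * log T * (bet y * bet (0 - y)) + C * 2 * T * bet y := fun y => by
    by_cases hy : 1 ≤ |y|
    · simp [bet_good.2.2.2 y hy]
    · rw [not_le] at hy
      obtain ⟨P, hP, hE⟩ := h (|y| / T) (by positivity)
      have e1 : T * (|y| / T) = |y| := by field_simp
      have hP0 : P = 0 := by
        refine hP.unique ?_
        convert (hasSum_zero : HasSum (fun _ : ℕ => (0:ℝ)) 0) using 2 with n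
        rcases logFar hT (v := |y| / T) (by rw [e1]; exact hy.le) n with h | h <;> rw [h] <;> simp
      have hby : bet |y| = bet y := by
        rcases abs_choice y with h | h <;> rw [h]
        exact bet_good.2.2.1 y
      rw [hP0, sub_zero, e1, hby] at hE
      have h1 := (Complex.re_le_norm _).trans hE
      rw [Complex.sub_re, Complex.re_sum, Complex.ofReal_re] at h1
      have e2 : ∀ γ : ℝ, ((((ordMult γ : ℝ) * w0 (γ / T) : ℝ) : ℂ) * ek γ (|y| / T)).re = (ordMult γ : ℝ) * w0 (γ / T) * cos (γ / T * y) := fun γ => by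
        rw [Complex.re_ofReal_mul, ek, Complex.exp_ofReal_mul_I_re, ← Real.cos_abs (γ / T * y), ← Real.cos_abs (γ * (|y| / T))]
        congr 2; rw [abs_mul, abs_mul, abs_div, abs_div, abs_abs, abs_of_pos hT0]; ring
      simp_rw [e2] at h1
      have h2 : exp (|y| / T / 2) ≤ T := by
        have : exp (|y| / T / 2) ≤ exp 1 := Real.exp_le_exp.2 (by
          rw [div_div, div_le_one (by positivity)]; linarith)
        have := Real.exp_one_lt_d9; linarith
      have h3 : T / (1 + |y|) ≤ T := div_le_self hT0.le (by linarith [abs_nonneg y])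
      have h4 : ∑ γ ∈ F, (ordMult γ : ℝ) * w0 (γ / T) * cos (γ / T * y) ≤ log T * T * bet y + C * (T + T) := by
        have := mLL (add_le_add h2 h3) hC.le
        linarith
      have h5 := mLL h4 (hbn y)
      rw [zero_sub, bet_good.2.2.1]
      linarith
  have hi : ∀ γ : ℝ, Integrable (fun y => bet y * cos (γ / T * y)) := fun γ =>
    bet_good.int.mul_bdd (c := 1) (Continuous.aestronglyMeasurable (by fun_prop)) (ae_of_all _ fun y => by rw [Real.norm_eq_abs]; exact Real.abs_cos_le_one _)
  have hi2 : Integrable (fun y => bet y * bet (0 - y)) := by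
    obtain ⟨Cb, hCb, hb1, -⟩ := bet_good.lip
    exact bet_good.int.mul_bdd (c := Cb) (Continuous.aestronglyMeasurable (by fun_prop)) (ae_of_all _ fun y => by rw [Real.norm_of_nonneg (hbn _)]; exact hb1 _)
  have hL : ∀ y, bet y * ∑ γ ∈ F, (ordMult γ : ℝ) * w0 (γ / T) * cos (γ / T * y) = ∑ γ ∈ F, (ordMult γ : ℝ) * w0 (γ / T) * (bet y * cos (γ / T * y)) := fun y => by
    rw [Finset.mul_sum]; exact Finset.sum_congr rfl fun γ _ => by ring
  simp_rw [hL] at hpt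
  have hi3 : Integrable (fun y => T * log T * (bet y * bet (0 - y)) + C * 2 * T * bet y) := (hi2.const_mul _).add (bet_good.int.const_mul _)
  have := integral_mono (integrable_finsetSum F fun γ _ => (hi γ).const_mul _) hi3 hpt
  rw [integral_finsetSum F fun γ _ => (hi γ).const_mul _, integral_add (hi2.const_mul _) (bet_good.int.const_mul _), integral_const_mul, integral_const_mul] at this
  simp_rw [integral_const_mul] at this
  have e : ∑ γ ∈ F, (ordMult γ : ℝ) * w0 (γ / T) ^ 2 = ∑ γ ∈ F, (ordMult γ : ℝ) * w0 (γ / T) * ∫ y, bet y * cos (γ / T * y) :=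
    Finset.sum_congr rfl fun γ _ => by rw [← w0]; ring
  rw [e]
  refine this.trans (le_of_eq ?_)
  rw [bet2, cv]; ring

lemma betSq : ∫ x, bet x ^ 2 = bet2 0 := by
  rw [bet2, cv]; congr 1; ext y; rw [zero_sub, bet_good.2.2.1]; ring

lemma betFull {x y : ℝ} (hx : x ≤ -1) (hy : 1 ≤ y) : ∫ t in x..y, bet t ^ 2 = bet2 0 := by
  rw [← betSq]
  refine intervalIntegral.integral_eq_integral_of_support_subset fun t ht => ?_
  by_contra h
  refine ht ?_
  have : 1 ≤ |t| := by
    by_contra h2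
    rw [not_le, abs_lt] at h2
    exact h ⟨by linarith, by linarith⟩
  simp [bet_good.2.2.2 t this]

lemma betHalf {x : ℝ} (hx : x ≤ -1) : ∫ t in x..0, bet t ^ 2 = bet2 0 / 2 := by
  have hc := bet_good.1.continuous
  have h1 := betFull hx (show 1 ≤ -x by linarith)
  have h2 : ∫ t in x..0, bet t ^ 2 = ∫ t in (0:ℝ)..(-x), bet t ^ 2 := by
    have := intervalIntegral.integral_comp_neg (f := fun t => bet t ^ 2) (a := x) (b := 0)
    simp_rw [bet_good.2.2.1] at this
    rw [this, neg_zero]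
  have h3 := intervalIntegral.integral_add_adjacent_intervals (μ := volume) (f := fun t => bet t ^ 2) (a := x) (b := 0) (c := -x)
    (Continuous.intervalIntegrable (by fun_prop) _ _) (Continuous.intervalIntegrable (by fun_prop) _ _)
  linarith

lemma kerLower {T κ a1 : ℝ} (hT : 0 < T) (hκ : 0 < κ) (ha : 0 ≤ a1) (u : ℝ) :
    2 * (Rh (u / κ) - 2 / (T * κ)) * (T / κ) * (∫ x in (T * u - T * κ * a1)..(T * u), bet x ^ 2) ≤
      ∫ a in (0:ℝ)..a1, 2 * Rh a * (T * bet (T * (u - κ * a))) ^ 2 := by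
  have hc := bet_good.1.continuous
  have hR := Rh_cont
  have h1 := intervalIntegral.integral_comp_sub_mul (a := 0) (b := a1) (fun x => bet x ^ 2) (c := T * κ) (by positivity) (T * u)
  rw [mul_zero, sub_zero, smul_eq_mul] at h1
  have h2 : 2 * (Rh (u / κ) - 2 / (T * κ)) * (T / κ) * (∫ x in (T * u - T * κ * a1)..(T * u), bet x ^ 2) =
      ∫ a in (0:ℝ)..a1, 2 * (Rh (u / κ) - 2 / (T * κ)) * T ^ 2 * bet (T * u - T * κ * a) ^ 2 := by
    rw [intervalIntegral.integral_const_mul, h1]; field_simp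
  rw [h2]
  refine intervalIntegral.integral_mono_on ha (Continuous.intervalIntegrable (by fun_prop) _ _) (Continuous.intervalIntegrable (by fun_prop) _ _) fun a _ => ?_
  rw [show T * (u - κ * a) = T * u - T * κ * a by ring]
  by_cases hh : 1 ≤ |T * u - T * κ * a|
  · rw [bet_good.2.2.2 _ hh]; simp
  · rw [not_le] at hh
    have h3 := Rh_lip (u / κ) a
    have h4 : |u / κ - a| ≤ 1 / (T * κ) := by
      rw [le_div_iff₀ (by positivity), ← abs_of_pos (show 0 < T * κ by positivity), ← abs_mul]
      rw [show (u / κ - a) * (T * κ) = T * u - T * κ * a by field_simp]; exact hh.le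
    have h5 : Rh (u / κ) - 2 / (T * κ) ≤ Rh a := by
      have := (le_abs_self _).trans h3
      have e : 2 / (T * κ) = 2 * (1 / (T * κ)) := by ring
      rw [e]; linarith
    have h6 := mLR h5 (show 0 ≤ 2 * T ^ 2 * bet (T * u - T * κ * a) ^ 2 by positivity)
    nlinarith [h6]

set_option maxHeartbeats 1000000 in
lemma NvInt : ∃ C : ℝ, 0 < C ∧ ∀ T : ℝ, 8 ≤ T → 2 ≤ log T →
    T * bet2 0 * (log T * (1 + 3 / 1000000) - C) ≤ ∫ a in (0:ℝ)..(lm * (log T + 1) / log T), 2 * Rh a * Nv T (log T / lm * a) := by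
  obtain ⟨C1, hC1, h1⟩ := primeSum
  obtain ⟨C2, hC2, h2⟩ := mertP
  refine ⟨lm * (3 + 2 * C1 + 2 * C2), by unfold lm; positivity, fun T hT hL => ?_⟩
  have hnum := numer
  set Ψ : ℝ := 1 / 2 - lm / 3 + 1 / (2 * π) * (sin (2 * π * lm) / (2 * π * lm) ^ 2 - cos (2 * π * lm) / (2 * π * lm))
  have hT0 : 0 < T := by linarith
  set L := log T with hLd
  have hlm : 0 < lm := by unfold lm; norm_num
  have hlm1 : lm < 1 := by unfold lm; norm_num
  have hL0 : 0 < L := by linarith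
  set κ := L / lm with hκd
  have hκ : 0 < κ := by positivity
  set a1 := lm * (L + 1) / L with ha1
  have ha : 0 ≤ a1 := by positivity
  have hκa : κ * a1 = L + 1 := by rw [hκd, ha1]; field_simp
  have hB := betB_pos
  set B := bet2 0 with hBd
  have hc := bet_good.1.continuous
  have hR := Rh_cont
  set ε := 2 / (T * κ) with hε
  have hεL : ε ≤ 1 / L := by
    rw [hε, hκd, div_le_div_iff₀ (by positivity) hL0]
    rw [show T * (L / lm) = L * (T / lm) by ring]
    have : 8 ≤ T / lm := by rw [le_div_iff₀ hlm]; nlinarith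
    nlinarith
  have hs1 := h1 L (by linarith)
  rw [hLd, Real.exp_log hT0, ← hLd] at hs1
  have hs2 := (abs_le.1 (h2 T (by linarith))).2
  have hcp : ∀ n : ℕ, 0 ≤ cP n := fun n => by unfold cP; split_ifs <;> positivity
  have hs3 : ∑ n ∈ Finset.Icc 0 ⌊T⌋₊, log n * cP n ≤ L * (L + C2) := by
    calc _ ≤ ∑ n ∈ Finset.Icc 0 ⌊T⌋₊, L * cP n := Finset.sum_le_sum fun n hn => by
            refine mLR ?_ (hcp n)
            rcases Nat.eq_zero_or_pos n with h | h
            · rw [h]; simp [hL0.le]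
            · exact Real.log_le_log (by exact_mod_cast h) ((Nat.le_floor_iff hT0.le).1 (Finset.mem_Icc.1 hn).2)
      _ ≤ _ := by rw [← Finset.mul_sum]; exact mLL (by linarith) hL0.le
  have hcl : ∀ n : ℕ, 0 ≤ log n * cP n := fun n => mul_nonneg (Real.log_natCast_nonneg n) (hcp n)
  -- split integral
  have hI : ∫ a in (0:ℝ)..a1, 2 * Rh a * Nv T (κ * a) = L ^ 2 * (∫ a in (0:ℝ)..a1, 2 * Rh a * (T * bet (T * (0 - κ * a))) ^ 2) +
      ∑ n ∈ Finset.Icc 0 ⌊T⌋₊, log n * cP n * ∫ a in (0:ℝ)..a1, 2 * Rh a * (T * bet (T * (log n - κ * a))) ^ 2 := by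
    simp_rw [← intervalIntegral.integral_const_mul]
    rw [← intervalIntegral.integral_finsetSum fun n _ => Continuous.intervalIntegrable (by fun_prop) _ _,
      ← intervalIntegral.integral_add (Continuous.intervalIntegrable (by fun_prop) _ _) (Continuous.intervalIntegrable (by fun_prop) _ _)]
    refine intervalIntegral.integral_congr fun a _ => ?_
    simp only [Nv]
    rw [zero_sub, mul_neg, bet_good.2.2.1, mul_add, Finset.mul_sum]
    congr 1
    · ring
    · exact Finset.sum_congr rfl fun n _ => by ring
  have k0 := kerLower hT0 hκ ha 0
  rw [mul_zero, zero_div, zero_sub, betHalf (by rw [mul_assoc, hκa]; nlinarith), ← hε, ← hBd, show Rh 0 = 1 by simp [Rh]] at k0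
  have kn : ∀ n ∈ Finset.Icc 0 ⌊T⌋₊, 2 * (T * B / κ) * (log n * Rh (lm * log n / L) * cP n - 1 / L * (log n * cP n)) ≤
      log n * cP n * ∫ a in (0:ℝ)..a1, 2 * Rh a * (T * bet (T * (log n - κ * a))) ^ 2 := fun n hn => by
    by_cases hp : n.Prime
    · have hl2 : log 2 ≤ log n := Real.log_le_log (by norm_num) (by exact_mod_cast hp.two_le)
      have hlL : log n ≤ L := Real.log_le_log (by exact_mod_cast hp.pos) ((Nat.le_floor_iff hT0.le).1 (Finset.mem_Icc.1 hn).2)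
      have := Real.log_two_gt_d9
      have k := kerLower hT0 hκ ha (log n)
      rw [betFull (by rw [mul_assoc, hκa]; nlinarith) (by nlinarith), ← hε, ← hBd, show log n / κ = lm * log n / L by rw [hκd]; field_simp] at k
      have k2 := mLL k (hcl n)
      refine le_trans ?_ k2
      have k3 : 0 ≤ (1 / L - ε) * (2 * (T * B / κ) * (log n * cP n)) := mul_nonneg (by linarith) (mul_nonneg (by positivity) (hcl n))
      have e : 2 * (Rh (lm * log n / L) - ε) * (T / κ) * B = 2 * (T * B / κ) * (Rh (lm * log n / L) - ε) := by ring
      rw [e]; linarith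
    · have : cP n = 0 := by simp [cP, hp]
      rw [this]; simp
  have ksum := Finset.sum_le_sum kn
  rw [← Finset.mul_sum, Finset.sum_sub_distrib, ← Finset.mul_sum] at ksum
  rw [hI]
  have k1 := mLL k0 (sq_nonneg L)
  have hX : 0 < T * B / κ := by positivity
  set X := T * B / κ with hXd
  have hXe : T * B = X * (L / lm) := by rw [hXd, ← hκd]; field_simp
  have e0 : L ^ 2 * (2 * (1 - ε) * (T / κ) * (B / 2)) = X * (L ^ 2 * (1 - ε)) := by rw [hXd]; ring
  rw [e0] at k1
  have g1 : X * (L ^ 2 - L) ≤ X * (L ^ 2 * (1 - ε)) := mLL (by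
    have : L ^ 2 * ε ≤ L ^ 2 * (1 / L) := mLL hεL (sq_nonneg L)
    have e : L ^ 2 * (1 / L) = L := by field_simp
    linarith) hX.le
  have g2 : 2 * X * (L ^ 2 * Ψ - C1 * L - (L + C2)) ≤ 2 * X * (∑ n ∈ Finset.Icc 0 ⌊T⌋₊, log n * Rh (lm * log n / L) * cP n - 1 / L * ∑ n ∈ Finset.Icc 0 ⌊T⌋₊, log n * cP n) :=
    mLL (by
      have : 1 / L * ∑ n ∈ Finset.Icc 0 ⌊T⌋₊, log n * cP n ≤ 1 / L * (L * (L + C2)) := mLL hs3 (by positivity)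
      have e : 1 / L * (L * (L + C2)) = L + C2 := by field_simp
      linarith) (by positivity)
  have g3 : T * B * (L * (1 + 3 / 1000000) - lm * (3 + 2 * C1 + 2 * C2)) ≤ X * (L ^ 2 * (1 + 2 * Ψ) - (3 + 2 * C1 + 2 * C2) * L) := by
    rw [hXe]
    have : X * (L / lm) * (L * (1 + 3 / 1000000) - lm * (3 + 2 * C1 + 2 * C2)) ≤ X * (L / lm) * (L * (lm * (1 + 2 * Ψ)) - lm * (3 + 2 * C1 + 2 * C2)) :=
      mLL (by have := mLL hnum hL0.le; linarith) (by positivity)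
    refine this.trans (le_of_eq ?_)
    field_simp
  have g4 : X * C2 ≤ X * (C2 * L) := mLL (by nlinarith) hX.le
  linarith

lemma errInt {T κ a1 : ℝ} (hT : 8 ≤ T) (hκ : 0 < κ) (ha : 0 ≤ a1) (h : κ * a1 = log T + 1) :
    ∫ a in (0:ℝ)..a1, (exp (κ * a) + (T / (1 + T * (κ * a))) ^ 2) ≤ 4 * T / κ := by
  have hT0 : 0 < T := by linarith
  have hpos : ∀ a ∈ Set.uIcc 0 a1, 0 < 1 + T * (κ * a) := fun a h => by
    rw [Set.uIcc_of_le ha] at h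
    have := mul_nonneg hT0.le (mul_nonneg hκ.le h.1); linarith
  have hd : ∀ a ∈ Set.uIcc 0 a1, HasDerivAt (fun a => exp (κ * a) / κ - T / κ / (1 + T * (κ * a))) (exp (κ * a) + (T / (1 + T * (κ * a))) ^ 2) a := fun a h => by
    have hp := (hpos a h).ne'
    have d1 : HasDerivAt (fun a : ℝ => κ * a) κ a := by simpa using (hasDerivAt_id a).const_mul κ
    have d2 := (d1.const_mul T).const_add 1
    refine HasDerivAt.congr_deriv ((d1.exp.div_const κ).sub ((hasDerivAt_const a (T / κ)).div d2 hp)) ?_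
    field_simp; ring
  rw [intervalIntegral.integral_eq_sub_of_hasDerivAt hd (ContinuousOn.intervalIntegrable (by
    refine ContinuousOn.add (by fun_prop) (ContinuousOn.pow (ContinuousOn.div continuousOn_const (by fun_prop) fun a h => (hpos a h).ne') 2)))]
  rw [h, Real.exp_add, Real.exp_log hT0, mul_zero, mul_zero, add_zero, div_one, Real.exp_zero]
  have e1 := Real.exp_one_lt_d9
  have h1 : T * exp 1 / κ ≤ 3 * T / κ := div_le_div_of_nonneg_right (by nlinarith) hκ.le
  have h2 : 0 ≤ T / κ / (1 + T * (log T + 1)) := by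
    have := Real.log_nonneg (show 1 ≤ T by linarith); positivity
  have h3 : 0 < 1 / κ := by positivity
  have e : 4 * T / κ = 3 * T / κ + T / κ := by ring
  rw [e]; linarith

lemma sqPert (x e M : ℝ) (h : |M| ≤ x + e) : (1 - 1 / 1000000) * M ^ 2 - 1000000 * e ^ 2 ≤ x ^ 2 := by
  have h1 : M ^ 2 ≤ (x + e) ^ 2 := by rw [← sq_abs M]; exact pow_le_pow_left₀ (abs_nonneg _) h 2
  nlinarith [sq_nonneg (x / 1000000 - (1 - 1 / 1000000) * e), sq_nonneg e]

set_option maxHeartbeats 1000000 in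
lemma pairCorr (hRH : RiemannHypothesis) : ∃ c : ℝ, 0 < c ∧ ∃ T0 : ℝ, ∀ T : ℝ, T0 ≤ T → ∃ F : Finset ℝ,
    c * T * log T ≤ ∑ γ ∈ F, (ordMult γ : ℝ) * w0 (γ / T) ^ 2 * (∑ γ' ∈ F.filter (fun γ' => |γ' - γ| ≤ 2 * π * lm / log T), (ordMult γ' : ℝ) - 1) := by
  obtain ⟨C1, hC1, h1⟩ := FApprox hRH
  obtain ⟨C2, hC2, h2⟩ := NvInt
  have hB := betB_pos
  have hI := betInt_pos
  set B := bet2 0 with hBd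
  set K := B * C2 + 1000000 * 2 * 2 * C1 ^ 2 * 4 + C1 * (∫ x, bet x) * 2 with hK
  refine ⟨B / 2000000, by positivity, exp (8 + 2000000 * K / B), fun T hT => ?_⟩
  have hK0 : 0 < K := by positivity
  have hT0 : 0 < T := (Real.exp_pos _).trans_le hT
  have hL8 : 8 + 2000000 * K / B ≤ log T := by rwa [Real.le_log_iff_exp_le hT0]
  have hq : 0 < 2000000 * K / B := by positivity
  have hT8 : 8 ≤ T := by have := Real.log_le_sub_one_of_pos hT0; linarith
  obtain ⟨F, hF⟩ := h1 T hT8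
  refine ⟨F, ?_⟩
  have hd := diagUpper F T hT8 C1 hC1 hF
  have hN := h2 T hT8 (by linarith)
  set L := log T with hLd
  have hlm : 0 < lm := by unfold lm; norm_num
  have hlm1 : lm < 61 / 100 := by unfold lm; norm_num
  have hL0 : 0 < L := by linarith
  set κ := L / lm with hκd
  have hκ1 : 1 ≤ κ := by rw [hκd, le_div_iff₀ hlm]; linarith
  have hκ : 0 < κ := by linarith
  have hp := pairUpper F (fun γ => (ordMult γ : ℝ)) (fun γ => w0 (γ / T)) (fun γ => Nat.cast_nonneg _) (fun γ => w0_nonneg _) κ hκ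
  rw [show 2 * π / κ = 2 * π * lm / L by rw [hκd]; field_simp] at hp
  set a1 := lm * (L + 1) / L with ha1
  have ha : 0 ≤ a1 := by positivity
  have ha11 : a1 ≤ 1 := by rw [ha1, div_le_one hL0]; nlinarith
  have hκa : κ * a1 = L + 1 := by rw [hκd, ha1]; field_simp
  have hR := Rh_cont
  have hc := bet_good.1.continuous
  have hek := ek_cont
  set A : ℝ → ℂ := fun v => ∑ γ ∈ F, (((ordMult γ : ℝ) * w0 (γ / T) : ℝ) : ℂ) * ek γ v with hA
  have hAc : Continuous A := by rw [hA]; exact continuous_finsetSum _ fun γ _ => continuous_const.mul (hek γ)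
  have hNc : Continuous (Nv T) := by unfold Nv; fun_prop
  have hpt : ∀ a ∈ Set.Icc 0 a1, (1 - 1 / 1000000) * (2 * Rh a * Nv T (κ * a)) - 1000000 * 2 * 2 * C1 ^ 2 * (exp (κ * a) + (T / (1 + T * (κ * a))) ^ 2) ≤ 2 * Rh a * ‖A (κ * a)‖ ^ 2 := fun a ha' => by
    have hv : 0 ≤ κ * a := mul_nonneg hκ.le ha'.1
    obtain ⟨P, hP, hE⟩ := hF (κ * a) hv
    have hM := Mlower hT8 hP
    set M := log T * T * bet (T * (κ * a)) - P
    set E := C1 * (exp (κ * a / 2) + T / (1 + T * (κ * a))) with hEd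
    have s1 : |M| ≤ ‖A (κ * a)‖ + E := by
      have := norm_sub_norm_le ((M : ℝ) : ℂ) (A (κ * a))
      rw [norm_sub_rev, Complex.norm_real, Real.norm_eq_abs] at this
      linarith
    have s2 := sqPert _ _ _ s1
    have s3 : E ^ 2 ≤ 2 * C1 ^ 2 * (exp (κ * a) + (T / (1 + T * (κ * a))) ^ 2) := by
      have e : exp (κ * a) = exp (κ * a / 2) ^ 2 := by rw [← Real.exp_nat_mul]; congr 1; push_cast; ring
      rw [hEd, e, mul_pow]
      nlinarith [mul_nonneg (sq_nonneg C1) (sq_nonneg (exp (κ * a / 2) - T / (1 + T * (κ * a))))]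
    obtain ⟨r0, r1⟩ := Rh_bd ha'.1 (ha'.2.trans ha11)
    have s4 : (1 - 1 / 1000000) * Nv T (κ * a) - 1000000 * E ^ 2 ≤ ‖A (κ * a)‖ ^ 2 := by linarith
    have s5 := mLL s4 (show 0 ≤ 2 * Rh a by linarith)
    have s6 : Rh a * E ^ 2 ≤ 1 * E ^ 2 := mLR r1 (sq_nonneg E)
    linarith
  have hi1 : IntervalIntegrable (fun a => (1 - 1 / 1000000) * (2 * Rh a * Nv T (κ * a))) volume 0 a1 := Continuous.intervalIntegrable (by fun_prop) _ _
  have hi2 : IntervalIntegrable (fun a => 1000000 * 2 * 2 * C1 ^ 2 * (exp (κ * a) + (T / (1 + T * (κ * a))) ^ 2)) volume 0 a1 := by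
    refine ContinuousOn.intervalIntegrable (ContinuousOn.mul continuousOn_const (ContinuousOn.add (by fun_prop) (ContinuousOn.pow (ContinuousOn.div continuousOn_const (by fun_prop) fun a h => ?_) 2)))
    rw [Set.uIcc_of_le ha] at h
    have := mul_nonneg hT0.le (mul_nonneg hκ.le h.1); linarith
  have hi3 : ∀ x y, IntervalIntegrable (fun a => 2 * Rh a * ‖A (κ * a)‖ ^ 2) volume x y := fun x y => Continuous.intervalIntegrable (by fun_prop) _ _
  have hm := intervalIntegral.integral_mono_on ha (hi1.sub hi2) (hi3 _ _) hpt
  rw [intervalIntegral.integral_sub hi1 hi2, intervalIntegral.integral_const_mul, intervalIntegral.integral_const_mul] at hm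
  have herr := errInt hT8 hκ ha hκa
  have hadd := intervalIntegral.integral_add_adjacent_intervals (hi3 0 a1) (hi3 a1 1)
  have hnn : 0 ≤ ∫ a in a1..1, 2 * Rh a * ‖A (κ * a)‖ ^ 2 := intervalIntegral.integral_nonneg ha11 fun a h =>
    mul_nonneg (by linarith [(Rh_bd (ha.trans h.1) h.2).1]) (sq_nonneg _)
  have herr2 : 4 * T / κ ≤ 4 * T := div_le_self (by linarith) hκ1
  have hX : 0 < C1 ^ 2 := by positivity
  have herr3 := mLL (herr.trans herr2) (show 0 ≤ 1000000 * 2 * 2 * C1 ^ 2 by positivity)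
  have hfin : (1 - 1 / 1000000) * (T * B * (L * (1 + 3 / 1000000) - C2)) - 1000000 * 2 * 2 * C1 ^ 2 * (4 * T) ≤ ∫ a in (0:ℝ)..1, 2 * Rh a * ‖A (κ * a)‖ ^ 2 := by
    linarith
  have hfin2 := hfin.trans hp
  simp_rw [mul_sub, mul_one, Finset.sum_sub_distrib]
  refine le_trans ?_ (sub_le_sub hfin2 hd)
  have hKB : 2000000 * K ≤ L * B := by
    have : 2000000 * K / B ≤ L := by linarith
    rwa [div_le_iff₀ hB] at this
  have hTB : 0 < T * B := by positivity
  have hTBL : 0 < T * B * L := by positivity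
  have hKT := mLR hKB hT0.le
  rw [hK] at hKT
  nlinarith [mul_pos hTB hC2]

/-- Number of elements of `F` (with multiplicity) within `δ` of `γ`. -/
def nF (F : Finset ℝ) (δ γ : ℝ) : ℝ := ∑ γ' ∈ F.filter (fun γ' => |γ' - γ| ≤ δ), (ordMult γ' : ℝ)

lemma nF_mono (F : Finset ℝ) {δ δ' : ℝ} (h : δ ≤ δ') (γ : ℝ) : nF F δ γ ≤ nF F δ' γ :=
  Finset.sum_le_sum_of_subset_of_nonneg (fun x hx => by rw [Finset.mem_filter] at hx ⊢; exact ⟨hx.1, hx.2.trans h⟩) fun _ _ _ => Nat.cast_nonneg _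

set_option maxHeartbeats 1000000 in
lemma badCount (hRH : RiemannHypothesis) : ∃ c : ℝ, 0 < c ∧ ∃ A : ℝ, 1 ≤ A ∧ ∃ T0 : ℝ, ∀ T : ℝ, T0 ≤ T → ∃ F : Finset ℝ,
    c * T * log T ≤ ∑ γ ∈ F.filter (fun γ => |γ| ≤ A * T ∧ 1 < nF F (2 * π * lm / log T) γ), (ordMult γ : ℝ) := by
  obtain ⟨c, hc, T0, h1⟩ := pairCorr hRH
  obtain ⟨C, hC, h2⟩ := cluster hRH
  obtain ⟨K, hK, h3⟩ := w0_upper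
  set A2 := 4 * K ^ 2 * C / c + 1 with hA2
  set τ := c / (4 * K ^ 2 * C) with hτ
  have hA20 : 1 ≤ A2 := by rw [hA2]; linarith [show 0 < 4 * K ^ 2 * C / c by positivity]
  have hτ0 : 0 < τ := by positivity
  refine ⟨τ * c / (2 * K ^ 2), by positivity, sqrt A2, by rwa [Real.one_le_sqrt], max T0 (exp 8), fun T hT => ?_⟩
  have hT0 : 0 < T := (Real.exp_pos 8).trans_le ((le_max_right _ _).trans hT)
  have hL : 8 ≤ log T := by rw [Real.le_log_iff_exp_le hT0]; exact (le_max_right _ _).trans hT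
  obtain ⟨F, hF⟩ := h1 T ((le_max_left _ _).trans hT)
  refine ⟨F, ?_⟩
  have hcl := h2 T hL hT0 F
  set L := log T
  set δ := 2 * π * lm / L with hδ
  have hδ4 : δ ≤ 4 / L := by
    rw [hδ]; refine div_le_div_of_nonneg_right ?_ (by linarith)
    unfold lm; have := Real.pi_lt_d2; linarith
  have hpt : ∀ γ ∈ F, (ordMult γ : ℝ) * w0 (γ / T) ^ 2 * (nF F δ γ - 1) ≤
      K ^ 2 * (1 / A2 + τ) * ((ordMult γ : ℝ) * Wt T γ * (nF F (4 / L) γ) ^ 2) + K ^ 2 / τ * (if |γ| ≤ sqrt A2 * T ∧ 1 < nF F δ γ then (ordMult γ : ℝ) else 0) := fun γ _ => by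
    have hm : 0 ≤ (ordMult γ : ℝ) := Nat.cast_nonneg _
    have hW := Wt_pos T γ
    have hite : 0 ≤ (if |γ| ≤ sqrt A2 * T ∧ 1 < nF F δ γ then (ordMult γ : ℝ) else 0) := by split_ifs <;> linarith
    have hn4 := nF_mono F hδ4 γ
    by_cases hn : 1 < nF F δ γ
    · have hw : w0 (γ / T) ^ 2 ≤ K ^ 2 * Wt T γ ^ 2 := by
        rw [← mul_pow]; refine pow_le_pow_left₀ (w0_nonneg _) ((h3 _).trans (le_of_eq ?_)) 2
        unfold Wt; ring
      have hsq : nF F δ γ ^ 2 ≤ nF F (4 / L) γ ^ 2 := pow_le_pow_left₀ (by linarith) hn4 2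
      have hW1 : Wt T γ ≤ 1 := by unfold Wt; rw [div_le_one (by positivity)]; nlinarith [sq_nonneg (γ / T)]
      have s1 : (ordMult γ : ℝ) * w0 (γ / T) ^ 2 * (nF F δ γ - 1) ≤ (ordMult γ : ℝ) * (K ^ 2 * Wt T γ ^ 2) * nF F δ γ :=
        mul_le_mul (mLL hw hm) (by linarith) (by linarith) (by positivity)
      refine s1.trans ?_
      by_cases hA : |γ| ≤ sqrt A2 * T
      · rw [if_pos ⟨hA, hn⟩]
        have s2 : nF F δ γ ≤ τ * nF F δ γ ^ 2 + 1 / τ := by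
          have : 0 ≤ (τ * nF F δ γ - 1) ^ 2 / τ := by positivity
          have e : (τ * nF F δ γ - 1) ^ 2 / τ = τ * nF F δ γ ^ 2 - 2 * nF F δ γ + 1 / τ := by field_simp; ring
          linarith
        have s3 : Wt T γ ^ 2 * nF F δ γ ≤ Wt T γ * (τ * nF F (4 / L) γ ^ 2) + 1 / τ := by
          have q1 : Wt T γ ^ 2 * nF F δ γ ≤ Wt T γ ^ 2 * (τ * nF F (4 / L) γ ^ 2 + 1 / τ) := mLL (by nlinarith) (sq_nonneg _)
          have q2 : Wt T γ ^ 2 ≤ Wt T γ := by nlinarith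
          have q3 : 0 ≤ τ * nF F (4 / L) γ ^ 2 := by positivity
          have q4 : 0 < 1 / τ := by positivity
          nlinarith
        have s4 := mLL s3 (show 0 ≤ (ordMult γ : ℝ) * K ^ 2 by positivity)
        have s5 : 0 ≤ K ^ 2 * (1 / A2) * ((ordMult γ : ℝ) * Wt T γ * (nF F (4 / L) γ) ^ 2) := by positivity
        have e : K ^ 2 / τ * (ordMult γ : ℝ) = (ordMult γ : ℝ) * K ^ 2 * (1 / τ) := by ring
        rw [e]; linarith
      · rw [if_neg (fun h => hA h.1), mul_zero, add_zero]
        rw [not_le] at hA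
        have s2 : Wt T γ ≤ 1 / A2 := by
          unfold Wt; refine one_div_le_one_div_of_le (by linarith) ?_
          have : sqrt A2 ≤ |γ / T| := by rw [abs_div, abs_of_pos hT0, le_div_iff₀ hT0]; exact hA.le
          have := pow_le_pow_left₀ (Real.sqrt_nonneg _) this 2
          rw [sq_abs, Real.sq_sqrt (by linarith)] at this; linarith
        have s3 : Wt T γ ^ 2 * nF F δ γ ≤ Wt T γ * (1 / A2) * nF F (4 / L) γ ^ 2 := by
          rw [sq (Wt T γ)]
          exact mul_le_mul (mLL s2 hW.le) (by nlinarith) (by linarith) (by positivity)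
        have s4 := mLL s3 (show 0 ≤ (ordMult γ : ℝ) * K ^ 2 by positivity)
        have s5 : 0 ≤ K ^ 2 * τ * ((ordMult γ : ℝ) * Wt T γ * (nF F (4 / L) γ) ^ 2) := by positivity
        linarith
    · rw [not_lt] at hn
      have : (ordMult γ : ℝ) * w0 (γ / T) ^ 2 * (nF F δ γ - 1) ≤ 0 := mul_nonpos_of_nonneg_of_nonpos (by positivity) (by linarith)
      exact this.trans (by positivity)
  have hs := hF.trans (Finset.sum_le_sum hpt)
  rw [Finset.sum_add_distrib, ← Finset.mul_sum, ← Finset.mul_sum, ← Finset.sum_filter] at hs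
  set S := ∑ γ ∈ F.filter (fun γ => |γ| ≤ sqrt A2 * T ∧ 1 < nF F δ γ), (ordMult γ : ℝ)
  have hc2 : K ^ 2 * (1 / A2 + τ) * ∑ γ ∈ F, ((ordMult γ : ℝ) * Wt T γ * (nF F (4 / L) γ) ^ 2) ≤ c / 2 * T * L := by
    have q1 := mLL hcl (show 0 ≤ K ^ 2 * (1 / A2 + τ) by positivity)
    refine q1.trans ?_
    have q2 : 1 / A2 ≤ τ := by
      rw [hτ, hA2, div_le_div_iff₀ (by positivity) (by positivity)]
      have e : c * (4 * K ^ 2 * C / c + 1) = 4 * K ^ 2 * C + c := by field_simp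
      rw [e]; linarith
    have q3 : K ^ 2 * (τ + τ) * C = c / 2 := by rw [hτ]; field_simp; ring
    have q4 : K ^ 2 * (1 / A2 + τ) * C ≤ K ^ 2 * (τ + τ) * C := mLR (mLL (by linarith) (sq_nonneg _)) hC.le
    have q5 : 0 < T * L := mul_pos hT0 (by linarith)
    rw [q3] at q4
    nlinarith
  have hfin : c / 2 * (T * L) ≤ K ^ 2 / τ * S := by linarith
  have e : τ * c / (2 * K ^ 2) * T * L = τ / K ^ 2 * (c / 2 * (T * L)) := by field_simp
  have e2 : S = τ / K ^ 2 * (K ^ 2 / τ * S) := by field_simp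
  rw [e, e2]
  exact mLL hfin (by positivity)

lemma ordMult_neg (γ : ℝ) : ordMult (-γ) = ordMult γ := by
  rw [← (xiF_order (-γ)).1, ← (xiF_order γ).1, analyticOrderNatAt, analyticOrderNatAt]
  congr 1
  have h := analyticOrderAt_comp_of_deriv_ne_zero (f := xiF) (g := fun z : ℂ => -z) (z₀ := γ * Complex.I) (by fun_prop) (by simp)
  rw [show xiF ∘ (fun z : ℂ => -z) = xiF from funext fun z => xiF_neg z] at h
  rw [h]; push_cast; congr 1; ring

lemma ordMult_pos (γ : ℝ) : ordMult γ ≠ 0 ↔ riemannZeta (1 / 2 + γ * Complex.I) = 0 := by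
  rw [ne_eq, (xiF_order γ).2.2, not_not]

lemma zetaOrds_fin (T : ℝ) : (zetaOrds T).Finite := (ordsFinite T).subset fun γ h => ⟨by rw [abs_of_pos h.1]; exact h.2.1, h.2.2⟩

lemma dcount_lower (lam T δ : ℝ) (hδ : δ ≤ 2 * π * lam / log T) (hgap : ∀ γ : ℝ, 0 < γ → ordMult γ ≠ 0 → δ < γ)
    (G : Finset ℝ) (hG : ∀ γ ∈ G, 0 < γ ∧ γ ≤ T ∧ ordMult γ ≠ 0 ∧ (2 ≤ ordMult γ ∨ ∃ γ', γ' ≠ γ ∧ ordMult γ' ≠ 0 ∧ |γ' - γ| ≤ δ)) :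
    ∑ γ ∈ G, ordMult γ ≤ 2 * Dcount lam T := by
  classical
  set Z := (zetaOrds_fin T).toFinset with hZ
  have hZm : ∀ γ, γ ∈ Z ↔ 0 < γ ∧ γ ≤ T ∧ ordMult γ ≠ 0 := fun γ => by
    rw [hZ, Set.Finite.mem_toFinset, ordMult_pos]; rfl
  have hnext : ∀ γ γ' : ℝ, γ < γ' → ordMult γ' ≠ 0 → nextOrd γ ≤ γ' := fun γ γ' h1 h2 =>
    csInf_le ⟨γ, fun x hx => hx.1.le⟩ ⟨h1, (ordMult_pos _).1 h2⟩
  set I := Z.filter (fun γ => nextOrd γ - γ ≤ 2 * π * lam / log T) with hI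
  set J := G.filter (fun γ => ∃ γ', γ' < γ ∧ ordMult γ' ≠ 0 ∧ |γ' - γ| ≤ δ) with hJ
  have hD : Dcount lam T = ∑ γ ∈ Z, (ordMult γ - 1) + I.card := by
    rw [Dcount, finsum_mem_eq_finite_toFinset_sum _ (zetaOrds_fin T), Finset.sum_add_distrib, hI, Finset.card_filter]
  have hJI : J.card ≤ I.card := by
    have hp : ∀ γ ∈ J, ∃ p ∈ I, p < γ ∧ ∀ z ∈ Z, z < γ → z ≤ p := fun γ hγ => by
      obtain ⟨hγG, γ', h1, h2, h3⟩ := Finset.mem_filter.1 hγ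
      obtain ⟨g1, g2, g3, -⟩ := hG γ hγG
      have h4 := hgap γ g1 g3
      rw [abs_sub_comm, abs_of_pos (by linarith)] at h3
      have h5 : γ' ∈ Z.filter (fun z => z < γ) := Finset.mem_filter.2 ⟨(hZm _).2 ⟨by linarith, by linarith, h2⟩, h1⟩
      obtain ⟨p, hp, hpm⟩ := Finset.exists_max_image (Z.filter (fun z => z < γ)) id ⟨γ', h5⟩
      obtain ⟨hp1, hp2⟩ := Finset.mem_filter.1 hp
      have h6 := hpm γ' h5
      simp only [id] at h6
      refine ⟨p, Finset.mem_filter.2 ⟨hp1, ?_⟩, hp2, fun z hz hz2 => hpm z (Finset.mem_filter.2 ⟨hz, hz2⟩)⟩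
      have := hnext p γ hp2 g3
      linarith
    choose! p hp1 hp2 hp3 using hp
    have hlt : ∀ a ∈ J, ∀ b ∈ J, a < b → p a < p b := fun a ha b hb hab => by
      obtain ⟨g1, g2, g3, -⟩ := hG a (Finset.mem_filter.1 ha).1
      exact (hp2 a ha).trans_le (hp3 b hb a ((hZm a).2 ⟨g1, g2, g3⟩) hab)
    refine Finset.card_le_card_of_injOn p hp1 fun a ha b hb hab => ?_
    rcases lt_trichotomy a b with h | h | h
    · exact absurd hab (hlt a ha b hb h).ne
    · exact h
    · exact absurd hab (hlt b hb a ha h).ne'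
  have hGZ : G ⊆ Z := fun γ h => (hZm γ).2 ⟨(hG γ h).1, (hG γ h).2.1, (hG γ h).2.2.1⟩
  have hpt : ∀ γ ∈ G, ordMult γ ≤ 2 * (ordMult γ - 1) + (if γ ∈ I then 1 else 0) + (if γ ∈ J then 1 else 0) := fun γ hγ => by
    obtain ⟨g1, g2, g3, g4⟩ := hG γ hγ
    rcases g4 with h | ⟨γ', h1, h2, h3⟩
    · omega
    · rcases lt_or_gt_of_ne h1 with h | h
      · rw [if_pos (show γ ∈ J from Finset.mem_filter.2 ⟨hγ, γ', h, h2, h3⟩)]; omega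
      · rw [if_pos (show γ ∈ I from Finset.mem_filter.2 ⟨hGZ hγ, ?_⟩)]
        · omega
        · have := hnext γ γ' h h2
          have := le_abs_self (γ' - γ)
          linarith
  have hs := Finset.sum_le_sum hpt
  rw [Finset.sum_add_distrib, Finset.sum_add_distrib, ← Finset.mul_sum, Finset.sum_boole, Finset.sum_boole] at hs
  have c1 : (G.filter (· ∈ I)).card ≤ I.card := Finset.card_le_card fun x hx => (Finset.mem_filter.1 hx).2
  have c2 : (G.filter (· ∈ J)).card ≤ J.card := Finset.card_le_card fun x hx => (Finset.mem_filter.1 hx).2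
  have c3 : ∑ γ ∈ G, (ordMult γ - 1) ≤ ∑ γ ∈ Z, (ordMult γ - 1) := Finset.sum_le_sum_of_subset hGZ
  simp only [Nat.cast_id] at hs
  rw [hD]; omega

lemma Dcount_le (lam T : ℝ) : Dcount lam T ≤ zetaN T := by
  rw [Dcount, zetaN, finsum_mem_eq_finite_toFinset_sum _ (zetaOrds_fin T), finsum_mem_eq_finite_toFinset_sum _ (zetaOrds_fin T)]
  refine Finset.sum_le_sum fun γ h => ?_
  rw [Set.Finite.mem_toFinset] at h
  have := (ordMult_pos γ).2 h.2.2
  split_ifs <;> omega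

lemma zetaN_le (hRH : RiemannHypothesis) : ∃ C : ℝ, 0 < C ∧ ∀ T : ℝ, 2 ≤ T → (zetaN T : ℝ) ≤ C * T * log T := by
  obtain ⟨C, hC, h⟩ := zeroSum hRH
  refine ⟨2 * C, by positivity, fun T hT => ?_⟩
  obtain ⟨h1, h2⟩ := h T hT
  rw [zetaN, finsum_mem_eq_finite_toFinset_sum _ (zetaOrds_fin T)]
  have h3 := h1.sum_le_tsum (zetaOrds_fin T).toFinset fun γ _ => by positivity
  have h4 : ∑ γ ∈ (zetaOrds_fin T).toFinset, (ordMult γ : ℝ) ≤ 2 * ∑ γ ∈ (zetaOrds_fin T).toFinset, (ordMult γ : ℝ) * (1 / (1 + (γ / T) ^ 2)) := by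
    rw [Finset.mul_sum]
    refine Finset.sum_le_sum fun γ hγ => ?_
    rw [Set.Finite.mem_toFinset] at hγ
    have h5 : γ / T ≤ 1 := by rw [div_le_one (by linarith)]; exact hγ.2.1
    have h6 : 0 < γ / T := div_pos hγ.1 (by linarith)
    have h7 : 1 / 2 ≤ 1 / (1 + (γ / T) ^ 2) := one_div_le_one_div_of_le (by positivity) (by nlinarith)
    have := mLL h7 (Nat.cast_nonneg (α := ℝ) (ordMult γ))
    linarith
  push_cast
  linarith

lemma gap0 : ∃ d : ℝ, 0 < d ∧ ∀ γ : ℝ, 0 < γ → ordMult γ ≠ 0 → d < γ := by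
  classical
  set S := insert 1 (zetaOrds_fin 1).toFinset with hS
  obtain ⟨p, hp, hpm⟩ := Finset.exists_min_image S id ⟨1, by simp [hS]⟩
  have hp0 : 0 < p := by
    rcases Finset.mem_insert.1 hp with h | h
    · rw [h]; norm_num
    · rw [Set.Finite.mem_toFinset] at h; exact h.1
  refine ⟨p / 2, by positivity, fun γ h1 h2 => ?_⟩
  have h3 := hpm 1 (by simp [hS])
  simp only [id] at h3 hpm
  by_cases h : γ ≤ 1
  · have := hpm γ (Finset.mem_insert_of_mem (by rw [Set.Finite.mem_toFinset]; exact ⟨h1, h, (ordMult_pos _).1 h2⟩))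
    linarith
  · linarith

lemma nF_other {F : Finset ℝ} {δ γ : ℝ} (hn : 1 < nF F δ γ) : 2 ≤ ordMult γ ∨ ∃ γ', γ' ≠ γ ∧ ordMult γ' ≠ 0 ∧ |γ' - γ| ≤ δ := by
  by_contra! h
  have : nF F δ γ ≤ ordMult γ := by
    unfold nF
    refine (Finset.sum_le_sum_of_subset_of_nonneg (Finset.subset_insert γ _) fun _ _ _ => Nat.cast_nonneg _).trans ?_
    rw [Finset.sum_eq_single_of_mem γ (Finset.mem_insert_self _ _)]
    intro b hb hbγ
    rcases Finset.mem_insert.1 hb with h1 | h1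
    · exact absurd h1 hbγ
    · by_contra h2
      have := h.2 b hbγ (fun h3 => h2 (by rw [h3]; simp))
      linarith [(Finset.mem_filter.1 h1).2]
  have h2 : (ordMult γ : ℝ) ≤ 1 := by have : ordMult γ ≤ 1 := by omega
                                      exact_mod_cast this
  linarith

lemma bad_le (lam T δ : ℝ) (hδ : δ ≤ 2 * π * lam / log T) (hgap : ∀ γ : ℝ, 0 < γ → ordMult γ ≠ 0 → δ < γ) (F : Finset ℝ) :
    ∑ γ ∈ F.filter (fun γ => |γ| ≤ T ∧ 1 < nF F δ γ), (ordMult γ : ℝ) ≤ ordMult 0 + 4 * Dcount lam T := by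
  classical
  set H := F.filter (fun γ => |γ| ≤ T ∧ 1 < nF F δ γ) with hH
  set Gp := H.filter (fun γ => 0 < γ ∧ ordMult γ ≠ 0) with hGp
  set Gm := (H.filter (fun γ => γ < 0 ∧ ordMult γ ≠ 0)).image (fun x => -x) with hGm
  have d1 := dcount_lower lam T δ hδ hgap Gp fun γ hγ => by
    obtain ⟨h1, h2, h3⟩ := Finset.mem_filter.1 hγ
    obtain ⟨h4, h5, h6⟩ := Finset.mem_filter.1 h1
    exact ⟨h2, (le_abs_self _).trans h5, h3, nF_other h6⟩
  have d2 := dcount_lower lam T δ hδ hgap Gm fun γ hγ => by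
    obtain ⟨x, hx, rfl⟩ := Finset.mem_image.1 hγ
    obtain ⟨h1, h2, h3⟩ := Finset.mem_filter.1 hx
    obtain ⟨h4, h5, h6⟩ := Finset.mem_filter.1 h1
    refine ⟨by linarith, (neg_le_abs _).trans h5, by rwa [ordMult_neg], ?_⟩
    rw [ordMult_neg]
    refine (nF_other h6).imp_right ?_
    rintro ⟨y, h7, h8, h9⟩
    refine ⟨-y, fun h => h7 (by linarith), by rwa [ordMult_neg], ?_⟩
    rwa [show -y - -x = -(y - x) by ring, abs_neg]
  rw [hGm, Finset.sum_image (fun a _ b _ h => by simpa using h)] at d2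
  simp_rw [ordMult_neg] at d2
  clear_value H
  have hsub : ∑ γ ∈ H, ordMult γ ≤ ∑ γ ∈ ({0} : Finset ℝ), ordMult γ + ∑ γ ∈ Gp, ordMult γ + ∑ γ ∈ H.filter (fun γ => γ < 0 ∧ ordMult γ ≠ 0), ordMult γ := by
    rw [Finset.sum_filter, Finset.sum_filter, Finset.sum_singleton]
    rw [add_assoc, ← Finset.sum_add_distrib]
    have : ∑ γ ∈ H, (if γ = 0 then ordMult 0 else 0) ≤ ordMult 0 := by
      rw [Finset.sum_ite_eq']; split_ifs <;> omega
    refine le_trans ?_ (Nat.add_le_add_right this _)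
    rw [← Finset.sum_add_distrib]
    refine Finset.sum_le_sum fun γ _ => ?_
    by_cases hm : ordMult γ = 0
    · omega
    rcases lt_trichotomy γ 0 with h | h | h
    · rw [if_pos (show γ < 0 ∧ ordMult γ ≠ 0 from ⟨h, hm⟩)]; omega
    · rw [if_pos h, ← h]; omega
    · rw [if_pos (show 0 < γ ∧ ordMult γ ≠ 0 from ⟨h, hm⟩)]; omega
  rw [Finset.sum_singleton] at hsub
  have : ∑ γ ∈ H, ordMult γ ≤ ordMult 0 + 4 * Dcount lam T := by omega
  exact_mod_cast this

/-- Assume RH. Then `μ_D ≤ 0.60729`: for every `λ > 0.60729`,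
`liminf_{T→∞} D(λ, T) > 0`. -/
theorem muD_le_Selberg (hRH : RiemannHypothesis) :
    ∀ lam : ℝ, 0.60729 < lam → 0 < atTop.liminf (fun T : ℝ => Dprop lam T) := by
  intro lam hlam
  have hlm' : lm < lam := by unfold lm; linarith
  have hlm : 0 < lm := by unfold lm; norm_num
  obtain ⟨c, hc, A, hA, T0, h1⟩ := badCount hRH
  obtain ⟨C, hC, h2⟩ := zetaN_le hRH
  obtain ⟨d, hd, h3⟩ := gap0
  have hA0 : 0 < A := by linarith
  have hlA : 0 ≤ Real.log A := Real.log_nonneg hA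
  have hm0 : (0:ℝ) ≤ ordMult 0 := Nat.cast_nonneg _
  have hev : ∀ᶠ X : ℝ in atTop, c / (16 * A * C) ≤ Dprop lam X := by
    have hl := tendsto_atTop.1 Real.tendsto_log_atTop (2 * Real.log A + 4 / d + lam * Real.log A / (lam - lm) + 2 * ordMult 0 / c + 2)
    filter_upwards [hl, eventually_ge_atTop (A * max T0 2)] with X hX1 hX2
    have q1 : 0 < 4 / d := by positivity
    have q2 : 0 ≤ lam * Real.log A / (lam - lm) := div_nonneg (mul_nonneg (by linarith) hlA) (by linarith)
    have q3 : 0 ≤ 2 * (ordMult 0 : ℝ) / c := by positivity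
    have hX : max T0 2 ≤ X / A := by rw [le_div_iff₀ hA0]; linarith
    have hT2 : 2 ≤ X / A := (le_max_right _ _).trans hX
    have hX0 : 2 ≤ X := by rw [le_div_iff₀ hA0] at hT2; linarith
    obtain ⟨F, hF⟩ := h1 (X / A) ((le_max_left _ _).trans hX)
    have hlog : Real.log (X / A) = Real.log X - Real.log A := Real.log_div (by linarith) hA0.ne'
    rw [show A * (X / A) = X by field_simp] at hF
    have hl0 : 0 < Real.log (X / A) := by rw [hlog]; linarith
    have hδ : 2 * π * lm / Real.log (X / A) ≤ 2 * π * lam / Real.log X := by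
      rw [div_le_div_iff₀ hl0 (by linarith), hlog]
      have : lam * Real.log A ≤ Real.log X * (lam - lm) := by
        rw [← div_le_iff₀ (by linarith)]; linarith
      have hp := Real.pi_pos
      nlinarith
    have hgap : 2 * π * lm / Real.log (X / A) ≤ d := by
      rw [div_le_iff₀ hl0]
      have : 4 / d ≤ Real.log (X / A) := by rw [hlog]; linarith
      rw [div_le_iff₀ hd] at this
      have : 2 * π * lm ≤ 4 := by unfold lm; have := Real.pi_lt_d2; linarith
      linarith
    have hb := hF.trans (bad_le lam X _ hδ (fun γ g1 g2 => hgap.trans_lt (h3 γ g1 g2)) F)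
    have hmm : (ordMult 0 : ℝ) ≤ c / 2 * (X / A) * Real.log (X / A) := by
      have g1 : 2 * (ordMult 0 : ℝ) / c ≤ Real.log (X / A) := by rw [hlog]; linarith
      rw [div_le_iff₀ hc] at g1
      have g2 : c * Real.log (X / A) * 1 ≤ c * Real.log (X / A) * (X / A) := mul_le_mul_of_nonneg_left (by linarith) (by positivity)
      linarith
    have hhalf : Real.log X / 2 ≤ Real.log (X / A) := by rw [hlog]; linarith
    have hlow : c / (16 * A) * (X * Real.log X) ≤ Dcount lam X := by
      have g1 : c / 8 * (X / A) * (Real.log X / 2) ≤ c / 8 * (X / A) * Real.log (X / A) := mul_le_mul_of_nonneg_left hhalf (by positivity)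
      have e : c / (16 * A) * (X * Real.log X) = c / 8 * (X / A) * (Real.log X / 2) := by field_simp; ring
      rw [e]; linarith
    have hlX : 0 < Real.log X := by linarith
    have hpos : 0 < c / (16 * A) * (X * Real.log X) := mul_pos (by positivity) (mul_pos (by linarith) hlX)
    have hDN : (Dcount lam X : ℝ) ≤ zetaN X := by exact_mod_cast Dcount_le lam X
    have hN := h2 X hX0
    rw [Dprop, le_div_iff₀ (by linarith)]
    refine le_trans ?_ hlow
    refine (mul_le_mul_of_nonneg_left hN (by positivity)).trans (le_of_eq ?_)
    field_simp
  refine lt_of_lt_of_le (show 0 < c / (16 * A * C) by positivity) (le_liminf_of_le ?_ hev)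
  refine IsBoundedUnder.isCoboundedUnder_ge ⟨1, eventually_map.2 (Eventually.of_forall fun X => ?_)⟩
  exact div_le_one_of_le₀ (by exact_mod_cast Dcount_le lam X) (Nat.cast_nonneg _)
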